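/- Let ζ ∈ ℝ and ω ∈ ℂ with 0 < Im ω < 1/2. Then there exist constants C > 0 and b₀ ∈ (0,1) such that for all b ∈ (0, b₀): |𝓜(b, ζ/b, ω/b) · e^{−f_𝓜(ζ,ω)/b²} − √((coth(π(ζ+ω))+1)/2)| ≤ C·b, where the square root is the principal branch. (Equivalently, 𝓜(b, ζ/b, ω/b) = √((coth(π(ζ+ω))+1)/2) · e^{f_𝓜(ζ,ω)/b²} (1 + O(b)) as b → 0⁺.) -/

import Mathlib

open MeasureTheory

noncomputable section

/-- The dilogarithm `Li₂(z) = -∫₀¹ Log(1 - t z) dt / t` (principal branch of `Log`). -/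
def Li2 (z : ℂ) : ℂ := -∫ t in (0:ℝ)..1, Complex.log (1 - (t:ℂ) * z) / (t:ℂ)

/-- Negative-index polylogarithms: `LiNeg m = Li_{-m}`, with `Li₀(w) = w/(1-w)` and
`Li_{-m}(w) = w ⬝ d/dw Li_{-m+1}(w)`. -/
def LiNeg : ℕ → ℂ → ℂ
  | 0 => fun w => w / (1 - w)
  | (m+1) => fun w => w * deriv (LiNeg m) w

/-- `LiIdx n = Li_{2-2n}`: the dilogarithm for `n = 0`, and `Li_{-(2n-2)}` for `n ≥ 1`. -/
def LiIdx (n : ℕ) : ℂ → ℂ := if n = 0 then Li2 else LiNeg (2*n - 2)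

/-- `L_b(z) = i ∫₀^∞ ( sin(2yz)/(2 sinh(y/b) sinh(by)) - z/y ) dy/y`. -/
def Lb (b : ℝ) (z : ℂ) : ℂ :=
  Complex.I * ∫ y in Set.Ioi (0:ℝ),
    (Complex.sin (2 * (y:ℂ) * z) / (2 * (Real.sinh (y / b) : ℂ) * (Real.sinh (b * y) : ℂ))
      - z / (y:ℂ)) / (y:ℂ)

/-- Ruijsenaars' hyperbolic gamma function `s_b(z) = exp(L_b(z))`. -/
def sb (b : ℝ) (z : ℂ) : ℂ := Complex.exp (Lb b z)

/-- `Q = b + b⁻¹` as a complex number. -/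
def Qb (b : ℝ) : ℂ := (b:ℂ) + (b:ℂ)⁻¹

/-- The function `𝓜(b, ζ', ω')`, the contour being the horizontal line `Im = -Q/4`. -/
def Mfun (b : ℝ) (ζ : ℝ) (ω : ℂ) : ℂ :=
  sb b ζ * ∫ x : ℝ,
    Complex.exp (Complex.I * (Real.pi:ℂ) * ((x:ℂ) - Complex.I * Qb b / 4)
        * ((ζ:ℂ) - Complex.I * Qb b / 2 + 2 * ω)) *
      sb b ((x:ℂ) - Complex.I * Qb b / 4 - (ζ:ℂ))
        / sb b ((x:ℂ) - Complex.I * Qb b / 4 + Complex.I * Qb b / 2)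

/-- The exponent `f_𝓜(ζ, ω)`. -/
def fM (ζ : ℝ) (ω : ℂ) : ℂ :=
  -(Li2 (-Complex.exp (2 * (Real.pi:ℂ) * (ζ:ℂ)))
    + Li2 (-(Complex.exp (-((Real.pi:ℂ) * (ζ:ℂ))) * Complex.cosh ((Real.pi:ℂ) * ω)
        / Complex.sinh ((Real.pi:ℂ) * ((ζ:ℂ) + ω))))
    - Li2 (Complex.exp ((Real.pi:ℂ) * (ζ:ℂ)) * Complex.cosh ((Real.pi:ℂ) * ω)
        / Complex.sinh ((Real.pi:ℂ) * ((ζ:ℂ) + ω))))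
    / (2 * (Real.pi:ℂ) * Complex.I)
  + Complex.I * (Real.pi:ℂ) * (ζ:ℂ)^2
  + Complex.I * (ω - Complex.I / 2) *
      Complex.log (Complex.exp ((Real.pi:ℂ) * (ζ:ℂ)) * Complex.cosh ((Real.pi:ℂ) * ω)
        / Complex.sinh ((Real.pi:ℂ) * ((ζ:ℂ) + ω)))
  + Complex.I * (Real.pi:ℂ) / 6

/-- The function `𝓠(b, σ', μ')`, the contour being the horizontal line `Im = -3Q/8`. -/
def Qfun (b : ℝ) (σ μ : ℝ) : ℂ :=
  Complex.exp (Complex.I * (Real.pi:ℂ) *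
      (1/6 + 7 * (Qb b)^2 / 24 - (μ:ℂ)^2/2 + Complex.I * (μ:ℂ) * Qb b - (σ:ℂ)^2)) * sb b μ *
  ∫ x : ℝ,
    Complex.exp (-(Complex.I * (Real.pi:ℂ) * ((x:ℂ) - 3 * Complex.I * Qb b / 8)^2)) *
    Complex.exp (2 * Complex.I * (Real.pi:ℂ) * ((x:ℂ) - 3 * Complex.I * Qb b / 8)
      * ((μ:ℂ) - Complex.I * Qb b / 2)) *
    sb b ((x:ℂ) - 3 * Complex.I * Qb b / 8 + (σ:ℂ)) *
    sb b ((x:ℂ) - 3 * Complex.I * Qb b / 8 - (σ:ℂ))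

/-- The exponent `f_𝓠(σ, μ)`. -/
def fQ (σ μ : ℝ) : ℂ :=
  -(Li2 (-Complex.exp (2 * (Real.pi:ℂ) * (μ:ℂ)))) / (2 * (Real.pi:ℂ) * Complex.I)
  - Li2 (Complex.exp (-(2 * (Real.pi:ℂ) * (σ:ℂ))) *
      ((Real.cosh (2*Real.pi*σ) : ℂ) + Complex.I *
        (Real.sqrt (Real.exp (2*Real.pi*μ) - Real.sinh (2*Real.pi*σ)^2) : ℂ)))
    / (2 * (Real.pi:ℂ) * Complex.I)
  - Li2 (Complex.exp (2 * (Real.pi:ℂ) * (σ:ℂ)) *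
      ((Real.cosh (2*Real.pi*σ) : ℂ) + Complex.I *
        (Real.sqrt (Real.exp (2*Real.pi*μ) - Real.sinh (2*Real.pi*σ)^2) : ℂ)))
    / (2 * (Real.pi:ℂ) * Complex.I)
  + (1/2 + Complex.I * (μ:ℂ)) *
      Complex.log (-(Real.cosh (2*Real.pi*σ) : ℂ) - Complex.I *
        (Real.sqrt (Real.exp (2*Real.pi*μ) - Real.sinh (2*Real.pi*σ)^2) : ℂ))
  - (Real.pi:ℂ) * (μ:ℂ) + 5 * (Real.pi:ℂ) * Complex.I / 12

/-- The phase function `f(t)` of the saddle point analysis of `𝓜`. -/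
def fMt (ζ : ℝ) (ω t : ℂ) : ℂ :=
  -(Li2 (-Complex.exp (2*(Real.pi:ℂ)*(ζ:ℂ)))
    + Li2 (-Complex.exp (2*(Real.pi:ℂ)*(t-(ζ:ℂ))))
    - Li2 (-Complex.exp (2*(Real.pi:ℂ)*(t+Complex.I/2)))) / (2*(Real.pi:ℂ)*Complex.I)
  + Complex.I*(Real.pi:ℂ)*(ζ:ℂ)^2 + 2*Complex.I*(Real.pi:ℂ)*t*ω + (Real.pi:ℂ)*t
  + Complex.I*(Real.pi:ℂ)/6

/-- The amplitude `g(t)` of the saddle point analysis of `𝓜`. -/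
def gM (t : ℂ) : ℂ :=
  Complex.exp ((Real.pi:ℂ)*t - Complex.log (1 - Complex.exp (2*(Real.pi:ℂ)*t)) / 2)

/-- The error term `E(τ, t)` from the semiclassical analysis of `𝓜`. -/
def Efun (ζ τ : ℝ) (t : ℂ) : ℂ :=
  Complex.I * (Li2 (Complex.exp (2*(Real.pi:ℂ)*t))
      - Li2 (Complex.exp (Complex.I*(Real.pi:ℂ)*(τ:ℂ) + 2*(Real.pi:ℂ)*t))) / (2*(Real.pi:ℂ)*(τ:ℂ))
  + Complex.log (1 - Complex.exp (2*(Real.pi:ℂ)*t)) / 2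
  + (Complex.I*(Real.pi:ℂ)*(τ:ℂ)/12) *
      (Complex.exp (2*(Real.pi:ℂ)*t + Complex.I*(Real.pi:ℂ)*(τ:ℂ))
          / (Complex.exp (2*(Real.pi:ℂ)*t + Complex.I*(Real.pi:ℂ)*(τ:ℂ)) - 1)
        - Complex.exp (2*(Real.pi:ℂ)*(ζ:ℂ)) / (Complex.exp (2*(Real.pi:ℂ)*(ζ:ℂ)) + 1)
        - Complex.exp (2*(Real.pi:ℂ)*t)
          / (Complex.exp (2*(Real.pi:ℂ)*(ζ:ℂ)) + Complex.exp (2*(Real.pi:ℂ)*t)) + 2)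

/-- The phase function `f(t)` of the saddle point analysis of `𝓠`. -/
def fQt (σ μ : ℝ) (t : ℂ) : ℂ :=
  -(Li2 (-Complex.exp (2*(Real.pi:ℂ)*(μ:ℂ)))
    + Li2 (-Complex.exp (2*(Real.pi:ℂ)*(t-(σ:ℂ))))
    + Li2 (-Complex.exp (2*(Real.pi:ℂ)*(t+(σ:ℂ))))) / (2*(Real.pi:ℂ)*Complex.I)
  + 2*Complex.I*(Real.pi:ℂ)*(μ:ℂ)*t + (Real.pi:ℂ)*(t-(μ:ℂ)) + 5*Complex.I*(Real.pi:ℂ)/12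

/-- The amplitude `g(t)` of the saddle point analysis of `𝓠`. -/
def gQ (μ : ℝ) (t : ℂ) : ℂ := Complex.exp ((Real.pi:ℂ)*(t-(μ:ℂ)))

end

lemma seg_slit {z : ℂ} (hz : 1 - z ∈ Complex.slitPlane) {t : ℝ} (ht : t ∈ Set.Icc (0:ℝ) 1) :
    1 - (t:ℂ) * z ∈ Complex.slitPlane := by
  rw [Complex.mem_slitPlane_iff] at *
  simp only [Complex.sub_re, Complex.one_re, Complex.sub_im, Complex.one_im, Complex.mul_re,
    Complex.mul_im, Complex.ofReal_re, Complex.ofReal_im, zero_mul, sub_zero, add_zero] at *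
  rcases ht with ⟨h0, h1⟩
  rcases eq_or_lt_of_le h0 with h | h
  · left; rw [← h]; simp
  · rcases hz with hz | hz
    · left; nlinarith
    · right
      intro h2
      apply hz
      have : t * z.im = 0 := by linarith
      rcases mul_eq_zero.1 this with h3 | h3
      · exact absurd h3 h.ne'
      · simp [h3]

lemma isOpen_U : IsOpen {w : ℂ | 1 - w ∈ Complex.slitPlane} :=
  Complex.isOpen_slitPlane.preimage (by fun_prop)

lemma Li2_intble {z : ℂ} (hz : 1 - z ∈ Complex.slitPlane) :
    IntervalIntegrable (fun t : ℝ => Complex.log (1 - (t:ℂ) * z) / (t:ℂ)) volume 0 1 := by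
  set φ := dslope (fun w : ℂ => Complex.log (1 - w)) 0 with hφ
  have hU0 : {w : ℂ | 1 - w ∈ Complex.slitPlane} ∈ nhds (0:ℂ) :=
    isOpen_U.mem_nhds (by simp)
  have hc : ContinuousOn φ {w : ℂ | 1 - w ∈ Complex.slitPlane} := by
    rw [hφ, continuousOn_dslope hU0]
    constructor
    · exact ContinuousOn.clog (by fun_prop) (fun w hw => hw)
    · apply DifferentiableAt.clog (by fun_prop) (by simp)
  have h1 : ContinuousOn (fun t : ℝ => z * φ ((t:ℂ) * z)) (Set.uIcc 0 1) := by
    refine ContinuousOn.mul continuousOn_const (hc.comp (by fun_prop) ?_)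
    intro t ht
    rw [Set.uIcc_of_le zero_le_one] at ht
    exact seg_slit hz ht
  refine h1.intervalIntegrable.congr ?_
  intro t ht
  rw [Set.uIoc_of_le zero_le_one] at ht
  have ht0 : (t:ℂ) ≠ 0 := by exact_mod_cast ht.1.ne'
  by_cases hz0 : z = 0
  · simp [hz0]
  · simp only [hφ]
    rw [dslope_of_ne _ (mul_ne_zero ht0 hz0), slope_def_field]
    simp
    field_simp

lemma hasDerivAt_Li2' {z : ℂ} (hz : 1 - z ∈ Complex.slitPlane) :
    HasDerivAt Li2 (∫ t in (0:ℝ)..1, (1 - (t:ℂ) * z)⁻¹) z := by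
  obtain ⟨r, hr, hrU⟩ := Metric.nhds_basis_closedBall.mem_iff.1 (isOpen_U.mem_nhds hz)
  have hK : IsCompact (Set.Icc (0:ℝ) 1 ×ˢ Metric.closedBall z r) :=
    isCompact_Icc.prod (isCompact_closedBall z r)
  have hcont : ContinuousOn (fun p : ℝ × ℂ => (1 - (p.1:ℂ) * p.2)⁻¹)
      (Set.Icc (0:ℝ) 1 ×ˢ Metric.closedBall z r) := by
    refine ContinuousOn.inv₀ (by fun_prop) ?_
    rintro ⟨t, x⟩ ⟨ht, hx⟩
    exact Complex.slitPlane_ne_zero (seg_slit (hrU hx) ht)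
  obtain ⟨C, hC⟩ := hK.exists_bound_of_continuousOn hcont
  have key := intervalIntegral.hasDerivAt_integral_of_dominated_loc_of_deriv_le (𝕜 := ℂ)
    (μ := volume) (a := 0) (b := 1)
    (F := fun x t => Complex.log (1 - (t:ℂ) * x) / (t:ℂ))
    (F' := fun x t => -(1 - (t:ℂ) * x)⁻¹) (x₀ := z) (s := Metric.closedBall z r)
    (bound := fun _ => C) (Metric.closedBall_mem_nhds z hr) ?_ (Li2_intble hz) ?_ ?_ ?_ ?_
  · have := key.2.neg
    rw [intervalIntegral.integral_neg, neg_neg] at this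
    exact this
  · refine Filter.Eventually.of_forall fun x => ?_
    apply Measurable.aestronglyMeasurable
    have : Measurable Complex.log := Complex.measurable_log
    fun_prop
  · apply Measurable.aestronglyMeasurable
    fun_prop
  · refine Filter.Eventually.of_forall fun t ht x hx => ?_
    rw [Set.uIoc_of_le zero_le_one] at ht
    rw [norm_neg]
    exact hC (t, x) ⟨⟨ht.1.le, ht.2⟩, hx⟩
  · simp
  · refine Filter.Eventually.of_forall fun t ht x hx => ?_
    rw [Set.uIoc_of_le zero_le_one] at ht
    have ht0 : (t:ℂ) ≠ 0 := by exact_mod_cast ht.1.ne'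
    have hs := seg_slit (hrU hx) ⟨ht.1.le, ht.2⟩
    have h1 : HasDerivAt (fun x : ℂ => 1 - (t:ℂ) * x) (-(t:ℂ)) x := by
      simpa using ((hasDerivAt_id x).const_mul (t:ℂ)).const_sub 1
    convert! (h1.clog hs).div_const (t:ℂ) using 1
    rw [neg_div, neg_div, div_div_cancel_left' ht0]

lemma Li2_deriv_mul {z : ℂ} (hz : 1 - z ∈ Complex.slitPlane) :
    z * (∫ t in (0:ℝ)..1, (1 - (t:ℂ) * z)⁻¹) = -Complex.log (1 - z) := by
  have := Complex.log_inv_eq_integral hz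
  rw [Complex.log_inv _ (Complex.slitPlane_arg_ne_pi hz)] at this
  rw [this]
  simp

lemma diffAt_Li2 {z : ℂ} (hz : 1 - z ∈ Complex.slitPlane) : DifferentiableAt ℂ Li2 z :=
  (hasDerivAt_Li2' hz).differentiableAt

lemma Li2_zero : Li2 0 = 0 := by simp [Li2]

/-- chain rule along exponentials -/
lemma hasDerivAt_Li2_comp {g : ℂ → ℂ} {g' a v : ℂ} (hg : HasDerivAt g g' v) (hga : g' = a * g v)
    (hz : 1 - g v ∈ Complex.slitPlane) :
    HasDerivAt (fun v => Li2 (g v)) (-a * Complex.log (1 - g v)) v := by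
  have := (hasDerivAt_Li2' hz).comp v hg
  convert! this using 1
  rw [hga]
  linear_combination a * (Li2_deriv_mul hz).symm

lemma HasSum.congr_fun_aux {f g : ℕ → ℂ} {a : ℂ} (h : HasSum f a) (hfg : ∀ n, g n = f n) :
    HasSum g a := by
  rwa [show g = f from funext hfg]

lemma hasSum_Li2 {z : ℂ} (hz : ‖z‖ < 1) :
    HasSum (fun n : ℕ => z ^ (n+1) / ((n:ℂ)+1)^2) (Li2 z) := by
  have h := intervalIntegral.hasSum_integral_of_dominated_convergence (a := 0) (b := 1) (μ := volume)
    (F := fun (n : ℕ) (t : ℝ) => z ^ (n+1) / ((n:ℂ)+1) * (t:ℂ)^n)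
    (f := fun t => -(Complex.log (1 - (t:ℂ) * z) / (t:ℂ)))
    (bound := fun n _ => ‖z‖ ^ (n+1)) ?_ ?_ ?_ ?_ ?_
  · rw [intervalIntegral.integral_neg] at h
    refine HasSum.congr_fun_aux (a := Li2 z) h ?_
    intro n
    rw [intervalIntegral.integral_const_mul]
    have : (∫ x in (0:ℝ)..1, (x:ℂ)^n) = 1 / ((n:ℂ)+1) := by
      have h2 : (∫ x in (0:ℝ)..1, (x:ℂ)^n) = ((∫ x in (0:ℝ)..1, x^n : ℝ) : ℂ) := by
        rw [← intervalIntegral.integral_ofReal]; simp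
      rw [h2, integral_pow]; simp
    rw [this]
    have : (n:ℂ) + 1 ≠ 0 := by exact_mod_cast Nat.succ_ne_zero n
    field_simp
  · intro n
    exact (by fun_prop : Continuous _).aestronglyMeasurable
  · intro n
    refine Filter.Eventually.of_forall fun t ht => ?_
    rw [Set.uIoc_of_le zero_le_one] at ht
    rw [norm_mul, norm_div, norm_pow, norm_pow, Complex.norm_real, Real.norm_of_nonneg ht.1.le]
    have h1 : ‖(n:ℂ)+1‖ = n + 1 := by
      rw [show (n:ℂ)+1 = ((n+1 : ℝ):ℂ) by push_cast; ring, Complex.norm_real,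
        Real.norm_of_nonneg (by positivity)]
    rw [h1]
    have h2 : t ^ n ≤ 1 := pow_le_one₀ ht.1.le ht.2
    have h3 : ‖z‖^(n+1) / (n+1) ≤ ‖z‖^(n+1) := div_le_self (by positivity) (by linarith [n.cast_nonneg (α := ℝ)])
    calc _ ≤ ‖z‖^(n+1) * 1 := by gcongr; exact pow_nonneg ht.1.le n
      _ = _ := mul_one _
  · refine Filter.Eventually.of_forall fun t ht => ?_
    exact (summable_nat_add_iff 1).2 (summable_geometric_of_lt_one (norm_nonneg z) hz)
  · simp
  · refine Filter.Eventually.of_forall fun t ht => ?_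
    rw [Set.uIoc_of_le zero_le_one] at ht
    have ht0 : (t:ℂ) ≠ 0 := by exact_mod_cast ht.1.ne'
    have hlt : ‖(t:ℂ) * z‖ < 1 := by
      rw [norm_mul, Complex.norm_real, Real.norm_of_nonneg ht.1.le]
      nlinarith [norm_nonneg z, ht.1, ht.2]
    have := (Complex.hasSum_taylorSeries_neg_log' hlt).div_const (t:ℂ)
    convert! this using 1
    · ext n
      rw [mul_pow]; field_simp; ring
    · ring

lemma summable_sq : Summable (fun n : ℕ => 1 / ((n:ℝ)+1)^2) := by
  have := (summable_nat_add_iff 1).2 (Real.summable_one_div_nat_pow.2 one_lt_two)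
  simpa using this

lemma tsum_sq : ∑' n : ℕ, 1 / ((n:ℝ)+1)^2 = Real.pi^2/6 := by
  have := hasSum_zeta_two
  have h2 := (hasSum_nat_add_iff' 1).2 this
  simpa using h2.tsum_eq

lemma norm_term (z : ℂ) (hz : ‖z‖ ≤ 1) (n : ℕ) :
    ‖z ^ (n+1) / ((n:ℂ)+1)^2‖ ≤ 1 / ((n:ℝ)+1)^2 := by
  have h1 : ‖(n:ℂ)+1‖ = n + 1 := by
      rw [show (n:ℂ)+1 = ((n+1 : ℝ):ℂ) by push_cast; ring, Complex.norm_real,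
        Real.norm_of_nonneg (by positivity)]
  rw [norm_div, norm_pow, norm_pow, h1]
  gcongr
  exact pow_le_one₀ (norm_nonneg _) hz

lemma norm_Li2_le {z : ℂ} (hz : ‖z‖ < 1) : ‖Li2 z‖ ≤ Real.pi^2/6 := by
  rw [← (hasSum_Li2 hz).tsum_eq, ← tsum_sq]
  exact tsum_of_norm_bounded summable_sq.hasSum (norm_term z hz.le)

/-- the series on the closed disc -/
lemma contOn_series : ContinuousOn (fun z : ℂ => ∑' n : ℕ, z ^ (n+1) / ((n:ℂ)+1)^2)
    (Metric.closedBall 0 1) :=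
  continuousOn_tsum (fun n => by fun_prop) summable_sq (fun n z hz => norm_term z (by simpa using hz) n)

lemma tendsto_Li2_one : Filter.Tendsto Li2 (nhdsWithin 1 (Metric.ball 0 1)) (nhds ((Real.pi:ℂ)^2/6)) := by
  have h := (contOn_series 1 (by simp)).tendsto.mono_left (nhdsWithin_mono _ Metric.ball_subset_closedBall)
  have e : (∑' n : ℕ, (1:ℂ) ^ (n+1) / ((n:ℂ)+1)^2) = (Real.pi:ℂ)^2/6 := by
    have := congrArg (fun x : ℝ => (x:ℂ)) tsum_sq
    push_cast at this
    simpa using this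
  simp only [e] at h
  refine h.congr' ?_
  filter_upwards [self_mem_nhdsWithin] with z hz
  exact (hasSum_Li2 (by simpa using hz)).tsum_eq

lemma tendsto_ofReal_ball (a : ℂ) (ha : ‖a‖ = 1) : Filter.Tendsto (fun r : ℝ => (r:ℂ) * a) (nhdsWithin 1 (Set.Ioo 0 1))
    (nhdsWithin a (Metric.ball 0 1)) := by
  apply tendsto_nhdsWithin_of_tendsto_nhds_of_eventually_within
  · have : Filter.Tendsto (fun r : ℝ => (r:ℂ) * a) (nhds 1) (nhds (((1:ℝ):ℂ) * a)) :=
      (by fun_prop : Continuous (fun r : ℝ => (r:ℂ) * a)).tendsto 1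
    simp only [Complex.ofReal_one, one_mul] at this
    exact this.mono_left nhdsWithin_le_nhds
  · filter_upwards [self_mem_nhdsWithin] with r hr
    simp [ha, abs_of_pos hr.1, hr.2]

lemma slit_of_norm_le {z : ℂ} (hz : ‖z‖ ≤ 1) (h1 : z ≠ 1) : 1 - z ∈ Complex.slitPlane := by
  rw [Complex.mem_slitPlane_iff]
  by_contra h
  push Not at h
  simp at h
  apply h1
  have hz2 : z.re ≤ ‖z‖ := Complex.re_le_norm z
  apply Complex.ext <;> simp
  · linarith
  · exact h.2

lemma norm_Li2_le' {z : ℂ} (hz : ‖z‖ ≤ 1) (h1 : z ≠ 1) : ‖Li2 z‖ ≤ Real.pi^2/6 := by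
  rcases hz.lt_or_eq with h | h
  · exact norm_Li2_le h
  have hc : ContinuousAt Li2 z := (diffAt_Li2 (slit_of_norm_le hz h1)).continuousAt
  have h2 := (hc.tendsto.mono_left nhdsWithin_le_nhds).comp (tendsto_ofReal_ball z h)
  have : (nhdsWithin (1:ℝ) (Set.Ioo 0 1)).NeBot := by
    rw [← mem_closure_iff_nhdsWithin_neBot, closure_Ioo (by norm_num)]; simp
  refine le_of_tendsto h2.norm ?_
  filter_upwards [self_mem_nhdsWithin] with r hr
  apply norm_Li2_le
  simp [h, abs_of_pos hr.1, hr.2]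

lemma Li2_dup {z : ℂ} (hz : ‖z‖ < 1) : Li2 z + Li2 (-z) = Li2 (z^2) / 2 := by
  have h1 := hasSum_Li2 hz
  have h2 := hasSum_Li2 (z := -z) (by simpa)
  have h3 := hasSum_Li2 (z := z^2) (by rw [norm_pow]; nlinarith [norm_nonneg z])
  have h4 := h1.add h2
  have h5 : HasSum (fun n : ℕ => z ^ (n+1) / ((n:ℂ)+1)^2 + (-z) ^ (n+1) / ((n:ℂ)+1)^2) (0 + Li2 (z^2)/2) := by
    apply HasSum.even_add_odd
    · convert! hasSum_zero using 1
      ext n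
      rw [show 2 * n + 1 = 2*n+1 from rfl, neg_pow, pow_succ (-1:ℂ), pow_mul]; simp; ring
    · convert! h3.div_const 2 using 1
      ext n
      have : (n:ℂ) + 1 ≠ 0 := by exact_mod_cast Nat.succ_ne_zero n
      rw [show 2 * n + 1 + 1 = 2*(n+1) by ring, neg_pow, pow_mul (-1:ℂ), ← pow_mul]
      push_cast
      have h7 : (2*(n:ℂ)+1+1) = 2 * ((n:ℂ)+1) := by ring
      rw [h7]
      simp
      field_simp
      ring
  rw [zero_add] at h5
  exact h4.unique h5

lemma Li2_neg_one : Li2 (-1) = -(Real.pi:ℂ)^2/12 := by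
  have hne : (nhdsWithin (1:ℝ) (Set.Ioo 0 1)).NeBot := by
    rw [← mem_closure_iff_nhdsWithin_neBot, closure_Ioo (by norm_num)]; simp
  have h1 := tendsto_Li2_one.comp (tendsto_ofReal_ball 1 (by simp))
  have hc : ContinuousAt Li2 (-1) := (diffAt_Li2 (by simp; norm_num [Complex.mem_slitPlane_iff])).continuousAt
  have h2 := (hc.tendsto.mono_left nhdsWithin_le_nhds).comp (tendsto_ofReal_ball (-1) (by simp))
  have h3 : Filter.Tendsto (fun r : ℝ => r^2) (nhdsWithin 1 (Set.Ioo 0 1)) (nhdsWithin 1 (Set.Ioo 0 1)) := by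
    apply tendsto_nhdsWithin_of_tendsto_nhds_of_eventually_within
    · have : Filter.Tendsto (fun r : ℝ => r^2) (nhds 1) (nhds (1^2)) :=
        (by fun_prop : Continuous (fun r : ℝ => r^2)).tendsto 1
      rw [one_pow] at this
      exact this.mono_left nhdsWithin_le_nhds
    · filter_upwards [self_mem_nhdsWithin] with r hr
      exact ⟨by have := hr.1; positivity, by nlinarith [hr.1, hr.2]⟩
  have h4 := (h1.comp h3).div_const 2
  have h5 := h1.add h2
  have h6 := tendsto_nhds_unique (h5.congr' (f₂ := fun r : ℝ => Li2 (((r^2:ℝ):ℂ) * 1) / 2) (by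
    filter_upwards [self_mem_nhdsWithin] with r hr
    have := Li2_dup (z := (r:ℂ)) (by simp [abs_of_pos hr.1, hr.2])
    simp only [Function.comp]
    push_cast
    simpa using this)) h4
  linear_combination h6

/-! ### elementary bounds -/

lemma norm_cexp_le_abs_im (w : ℂ) : ‖Complex.exp (w * Complex.I)‖ ≤ Real.exp |w.im| := by
  rw [Complex.norm_exp]
  apply Real.exp_le_exp.2
  simp
  exact neg_le_abs _

lemma norm_cos_le (w : ℂ) : ‖Complex.cos w‖ ≤ Real.exp |w.im| := by
  unfold Complex.cos
  have h1 := norm_cexp_le_abs_im w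
  have h2 := norm_cexp_le_abs_im (-w)
  rw [Complex.neg_im, abs_neg] at h2
  rw [norm_div, Complex.norm_ofNat, div_le_iff₀ (by norm_num)]
  calc _ ≤ _ := norm_add_le _ _
    _ ≤ _ := by linarith

lemma norm_sin_le_exp (w : ℂ) : ‖Complex.sin w‖ ≤ Real.exp |w.im| := by
  unfold Complex.sin
  have h1 := norm_cexp_le_abs_im w
  have h2 := norm_cexp_le_abs_im (-w)
  rw [Complex.neg_im, abs_neg] at h2
  rw [norm_div, norm_mul, Complex.norm_I, Complex.norm_ofNat, div_le_iff₀ (by norm_num), mul_one]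
  calc _ ≤ _ := norm_sub_le _ _
    _ ≤ _ := by linarith

/-- mean value bound from the origin -/
lemma mvt_zero {f f' : ℂ → ℂ} (hf : ∀ z, HasDerivAt f (f' z) z) (w : ℂ) {C : ℝ}
    (hC : ∀ z, ‖z‖ ≤ ‖w‖ → |z.im| ≤ |w.im| → ‖f' z‖ ≤ C) : ‖f w - f 0‖ ≤ C * ‖w‖ := by
  have hs : Convex ℝ (segment ℝ (0:ℂ) w) := convex_segment _ _
  have := hs.norm_image_sub_le_of_norm_hasDerivWithin_le (f := f) (f' := f') (C := C)
    (fun z _ => (hf z).hasDerivWithinAt) ?_ (left_mem_segment ℝ _ _) (right_mem_segment ℝ _ _)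
  · simpa using this
  · intro z hz
    rw [segment_eq_image] at hz
    obtain ⟨t, ⟨h0, h1⟩, rfl⟩ := hz
    apply hC
    · simp [abs_of_nonneg h0]
      exact mul_le_of_le_one_left (norm_nonneg _) h1
    · simp [abs_mul, abs_of_nonneg h0]
      exact mul_le_of_le_one_left (abs_nonneg _) h1

lemma norm_sin_le (w : ℂ) : ‖Complex.sin w‖ ≤ ‖w‖ * Real.exp |w.im| := by
  have := mvt_zero (fun z => Complex.hasDerivAt_sin z) w (C := Real.exp |w.im|)
    (fun z _ h => (norm_cos_le z).trans (Real.exp_le_exp.2 h))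
  simpa [mul_comm] using this

lemma norm_cos_sub_one_le (w : ℂ) : ‖Complex.cos w - 1‖ ≤ ‖w‖^2 * Real.exp |w.im| := by
  have := mvt_zero (fun z => Complex.hasDerivAt_cos z) w (C := ‖w‖ * Real.exp |w.im|)
    (fun z hz h => by
      rw [norm_neg]
      exact (norm_sin_le z).trans (by gcongr))
  simp at this
  linarith

lemma norm_sin_sub_le (w : ℂ) : ‖Complex.sin w - w‖ ≤ ‖w‖^3 * Real.exp |w.im| := by
  have := mvt_zero (f := fun z => Complex.sin z - z)
    (fun z => (Complex.hasDerivAt_sin z).sub (hasDerivAt_id z)) w (C := ‖w‖^2 * Real.exp |w.im|)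
    (fun z hz h => (norm_cos_sub_one_le z).trans (by gcongr))
  simp at this
  linarith

lemma div_sinh_le {u : ℝ} (hu : 0 < u) : u / Real.sinh u ≤ (1 + 2*u) * Real.exp (-u) := by
  have hs : 0 < Real.sinh u := Real.sinh_pos_iff.2 hu
  rw [div_le_iff₀ hs, Real.sinh_eq]
  have h1 : Real.exp (-u) * Real.exp u = 1 := by rw [← Real.exp_add]; simp
  have h2 : (1 + 2*u) * (Real.exp (-u) * Real.exp (-u)) ≤ 1 := by
    have := Real.add_one_le_exp (2*u)
    have h3 : Real.exp (2*u) * (Real.exp (-u) * Real.exp (-u)) = 1 := by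
      rw [← Real.exp_add, ← Real.exp_add]; ring_nf; simp
    rw [← h3]
    gcongr
    linarith
  nlinarith

lemma intble_pow_exp (k : ℕ) {c : ℝ} (hc : 0 < c) :
    IntegrableOn (fun u : ℝ => u^k * Real.exp (-c*u)) (Set.Ioi 0) := by
  have := integrableOn_rpow_mul_exp_neg_mul_rpow (p := 1) (s := k) (b := c)
    (by have : (0:ℝ) ≤ k := by positivity
        linarith) one_pos hc
  simpa using this

lemma intble_sinh (k : ℕ) {a : ℝ} (ha : a < 1) :
    IntegrableOn (fun u : ℝ => u^k * (u / Real.sinh u) * Real.exp (a*u)) (Set.Ioi 0) := by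
  have hc : 0 < 1 - a := by linarith
  have h1 := (intble_pow_exp k hc).add ((intble_pow_exp (k+1) hc).const_mul 2)
  refine Integrable.mono' h1 ?_ ?_
  · apply Measurable.aestronglyMeasurable
    fun_prop
  · refine (ae_restrict_mem measurableSet_Ioi).mono fun u hu => ?_
    have hu : 0 < u := hu
    have hs : 0 < Real.sinh u := Real.sinh_pos_iff.2 hu
    rw [Real.norm_of_nonneg (by positivity)]
    have := div_sinh_le hu
    have h2 : Real.exp (-(1-a)*u) = Real.exp (-u) * Real.exp (a*u) := by
      rw [← Real.exp_add]; ring_nf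
    simp only [Pi.add_apply]
    rw [h2]
    calc _ ≤ u^k * ((1 + 2*u) * Real.exp (-u)) * Real.exp (a*u) := by gcongr
      _ = _ := by ring

/-- generic integrability -/
lemma intble_of_bound {f : ℝ → ℂ} (hm : Measurable f) (k : ℕ) {a C : ℝ} (ha : a < 1)
    (hb : ∀ u > 0, ‖f u‖ ≤ C * (u^k * (u / Real.sinh u) * Real.exp (a*u))) :
    IntegrableOn f (Set.Ioi 0) := by
  refine Integrable.mono' ((intble_sinh k ha).const_mul C) hm.aestronglyMeasurable ?_
  exact (ae_restrict_mem measurableSet_Ioi).mono fun u hu => hb u hu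

lemma im_two_mul (u : ℝ) (v : ℂ) : (2 * (u:ℂ) * v).im = 2 * u * v.im := by simp

lemma exp_im_eq {u : ℝ} (hu : 0 < u) (v : ℂ) :
    Real.exp |(2 * (u:ℂ) * v).im| = Real.exp ((2 * |v.im|) * u) := by
  rw [im_two_mul, abs_mul, abs_of_pos (by positivity : 0 < 2*u)]
  ring_nf

lemma norm_two_mul {u : ℝ} (hu : 0 < u) (v : ℂ) : ‖2 * (u:ℂ) * v‖ = 2 * u * ‖v‖ := by
  simp [abs_of_pos hu]

lemma norm_sinh_c {u : ℝ} (hu : 0 < u) : ‖(Real.sinh u : ℂ)‖ = Real.sinh u := by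
  rw [Complex.norm_real, Real.norm_of_nonneg (Real.sinh_pos_iff.2 hu).le]

noncomputable def p2 (v : ℂ) (u : ℝ) : ℂ := Complex.sin (2 * (u:ℂ) * v) / (Real.sinh u : ℂ)
noncomputable def p1 (v : ℂ) (u : ℝ) : ℂ := (Complex.cos (2 * (u:ℂ) * v) - 1) / ((u:ℂ) * (Real.sinh u : ℂ))
noncomputable def p0 (v : ℂ) (u : ℝ) : ℂ :=
  (Complex.sin (2 * (u:ℂ) * v) - 2 * (u:ℂ) * v) / (2 * (u:ℂ)^2 * (Real.sinh u : ℂ))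

lemma meas_p2 (v : ℂ) : Measurable (p2 v) := by unfold p2; fun_prop
lemma meas_p1 (v : ℂ) : Measurable (p1 v) := by unfold p1; fun_prop
lemma meas_p0 (v : ℂ) : Measurable (p0 v) := by unfold p0; fun_prop

lemma norm_p2_le {M a : ℝ} {v : ℂ} (hM : ‖v‖ ≤ M) (ha : 2 * |v.im| ≤ a) {u : ℝ} (hu : 0 < u) :
    ‖p2 v u‖ ≤ (2*M) * (u^0 * (u / Real.sinh u) * Real.exp (a*u)) := by
  have hs : 0 < Real.sinh u := Real.sinh_pos_iff.2 hu
  have hM0 : 0 ≤ M := (norm_nonneg _).trans hM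
  have h := norm_sin_le (2 * (u:ℂ) * v)
  rw [exp_im_eq hu, norm_two_mul hu] at h
  unfold p2
  rw [norm_div, norm_sinh_c hu, div_le_iff₀ hs]
  calc _ ≤ _ := h
    _ ≤ 2 * u * M * Real.exp (a*u) := by gcongr
    _ = _ := by field_simp

lemma norm_p1_le {M a : ℝ} {v : ℂ} (hM : ‖v‖ ≤ M) (ha : 2 * |v.im| ≤ a) {u : ℝ} (hu : 0 < u) :
    ‖p1 v u‖ ≤ (4*M^2) * (u^0 * (u / Real.sinh u) * Real.exp (a*u)) := by
  have hs : 0 < Real.sinh u := Real.sinh_pos_iff.2 hu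
  have hM0 : 0 ≤ M := (norm_nonneg _).trans hM
  have h := norm_cos_sub_one_le (2 * (u:ℂ) * v)
  rw [exp_im_eq hu, norm_two_mul hu] at h
  unfold p1
  rw [norm_div, norm_mul, norm_sinh_c hu, Complex.norm_real, Real.norm_of_nonneg hu.le,
    div_le_iff₀ (by positivity)]
  calc _ ≤ _ := h
    _ ≤ (2 * u * M)^2 * Real.exp (a*u) := by gcongr
    _ = _ := by field_simp; ring

lemma norm_p0_le {M a : ℝ} {v : ℂ} (hM : ‖v‖ ≤ M) (ha : 2 * |v.im| ≤ a) {u : ℝ} (hu : 0 < u) :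
    ‖p0 v u‖ ≤ (4*M^3) * (u^0 * (u / Real.sinh u) * Real.exp (a*u)) := by
  have hs : 0 < Real.sinh u := Real.sinh_pos_iff.2 hu
  have hM0 : 0 ≤ M := (norm_nonneg _).trans hM
  have h := norm_sin_sub_le (2 * (u:ℂ) * v)
  rw [exp_im_eq hu, norm_two_mul hu] at h
  unfold p0
  rw [norm_div, norm_mul, norm_mul, norm_pow, norm_sinh_c hu, Complex.norm_real,
    Real.norm_of_nonneg hu.le, Complex.norm_ofNat, div_le_iff₀ (by positivity)]
  calc _ ≤ _ := h
    _ ≤ (2 * u * M)^3 * Real.exp (a*u) := by gcongr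
    _ = _ := by field_simp; ring

lemma strip_two {v : ℂ} (hv : |v.im| < 1/2) : 2 * |v.im| < 1 := by linarith

lemma intble_p2 {v : ℂ} (hv : |v.im| < 1/2) : IntegrableOn (p2 v) (Set.Ioi 0) :=
  intble_of_bound (meas_p2 v) 0 (strip_two hv) fun _ hu => norm_p2_le le_rfl le_rfl hu
lemma intble_p1 {v : ℂ} (hv : |v.im| < 1/2) : IntegrableOn (p1 v) (Set.Ioi 0) :=
  intble_of_bound (meas_p1 v) 0 (strip_two hv) fun _ hu => norm_p1_le le_rfl le_rfl hu
lemma intble_p0 {v : ℂ} (hv : |v.im| < 1/2) : IntegrableOn (p0 v) (Set.Ioi 0) :=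
  intble_of_bound (meas_p0 v) 0 (strip_two hv) fun _ hu => norm_p0_le le_rfl le_rfl hu

/-- generic differentiation under the integral sign on the strip -/
lemma hasDerivAt_int_strip {f f' : ℂ → ℝ → ℂ} (hfm : ∀ v, Measurable (f v))
    (hfm' : ∀ v, Measurable (f' v)) (k : ℕ)
    (hd : ∀ v, ∀ u > 0, HasDerivAt (fun v => f v u) (f' v u) v)
    (hi : ∀ v : ℂ, |v.im| < 1/2 → IntegrableOn (f v) (Set.Ioi 0))
    (hb : ∀ M a : ℝ, ∃ C, ∀ v : ℂ, ‖v‖ ≤ M → 2 * |v.im| ≤ a → ∀ u > 0,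
      ‖f' v u‖ ≤ C * (u^k * (u / Real.sinh u) * Real.exp (a*u)))
    {v : ℂ} (hv : |v.im| < 1/2) :
    HasDerivAt (fun v => ∫ u in Set.Ioi (0:ℝ), f v u) (∫ u in Set.Ioi (0:ℝ), f' v u) v := by
  obtain ⟨a, ha1, ha2⟩ := exists_between (strip_two hv)
  obtain ⟨C, hC⟩ := hb (‖v‖ + 1) a
  have hs : {z : ℂ | ‖z‖ < ‖v‖ + 1 ∧ 2 * |z.im| < a} ∈ nhds v := by
    apply IsOpen.mem_nhds
    · have h2 : Continuous fun z : ℂ => 2 * |z.im| := by fun_prop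
      exact (isOpen_lt continuous_norm continuous_const).inter (isOpen_lt h2 continuous_const)
    · exact ⟨by linarith, ha1⟩
  refine (hasDerivAt_integral_of_dominated_loc_of_deriv_le
    (bound := fun u => C * (u^k * (u / Real.sinh u) * Real.exp (a*u))) hs
    (Filter.Eventually.of_forall fun z => (hfm z).aestronglyMeasurable) (hi v hv)
    (hfm' v).aestronglyMeasurable ?_ ((intble_sinh k ha2).const_mul C) ?_).2
  · exact (ae_restrict_mem measurableSet_Ioi).mono fun u hu z hz =>
      hC z hz.1.le hz.2.le u hu
  · exact (ae_restrict_mem measurableSet_Ioi).mono fun u hu z hz => hd z u hu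

noncomputable def P2 (v : ℂ) : ℂ := ∫ u in Set.Ioi (0:ℝ), p2 v u
noncomputable def P1 (v : ℂ) : ℂ := ∫ u in Set.Ioi (0:ℝ), p1 v u
noncomputable def P0 (v : ℂ) : ℂ := ∫ u in Set.Ioi (0:ℝ), p0 v u

lemma sinh_c_ne {u : ℝ} (hu : 0 < u) : (Real.sinh u : ℂ) ≠ 0 := by
  exact_mod_cast (Real.sinh_pos_iff.2 hu).ne'

lemma hasDerivAt_P0 {v : ℂ} (hv : |v.im| < 1/2) : HasDerivAt P0 (P1 v) v := by
  refine hasDerivAt_int_strip meas_p0 meas_p1 0 ?_ (fun v hv => intble_p0 hv)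
    (fun M a => ⟨_, fun v h1 h2 u hu => norm_p1_le h1 h2 hu⟩) hv
  intro v u hu
  have hs := sinh_c_ne hu
  have hu' : (u:ℂ) ≠ 0 := by exact_mod_cast hu.ne'
  have h1 : HasDerivAt (fun v : ℂ => 2 * (u:ℂ) * v) (2 * (u:ℂ)) v := by
    simpa using (hasDerivAt_id v).const_mul (2*(u:ℂ))
  have := ((h1.csin).sub h1).div_const (2 * (u:ℂ)^2 * (Real.sinh u : ℂ))
  refine this.congr_deriv ?_
  unfold p1
  field_simp

lemma hasDerivAt_P1 {v : ℂ} (hv : |v.im| < 1/2) : HasDerivAt P1 (-2 * P2 v) v := by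
  have := hasDerivAt_int_strip (f := p1) (f' := fun v u => -2 * p2 v u) meas_p1
    (fun v => (meas_p2 v).const_mul _) 0 ?_ (fun v hv => intble_p1 hv)
    (fun M a => ⟨2 * (2*M), fun v h1 h2 u hu => ?_⟩) hv
  · refine this.congr_deriv ?_
    rw [integral_const_mul]; rfl
  · intro v u hu
    have hs := sinh_c_ne hu
    have hu' : (u:ℂ) ≠ 0 := by exact_mod_cast hu.ne'
    have h1 : HasDerivAt (fun v : ℂ => 2 * (u:ℂ) * v) (2 * (u:ℂ)) v := by
      simpa using (hasDerivAt_id v).const_mul (2*(u:ℂ))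
    have := ((h1.ccos).sub_const 1).div_const ((u:ℂ) * (Real.sinh u : ℂ))
    refine this.congr_deriv ?_
    unfold p2
    field_simp
  · rw [norm_mul]
    have := norm_p2_le h1 h2 hu
    simp only [norm_neg, Complex.norm_ofNat]
    linarith

lemma int_sin_exp {v : ℂ} {c : ℝ} (hc : 2 * |v.im| < c) :
    ∫ u in Set.Ioi (0:ℝ), Complex.sin (2 * (u:ℂ) * v) * Complex.exp (-(c:ℂ) * u)
      = 2 * v / ((c:ℂ)^2 + 4 * v^2) := by
  have hi := abs_lt.1 (show |v.im| < c/2 by linarith)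
  have ha : (-2 * v * Complex.I - c).re < 0 := by simp; linarith
  have hb : (2 * v * Complex.I - c).re < 0 := by simp; linarith
  have e : ∀ u : ℝ, Complex.sin (2 * (u:ℂ) * v) * Complex.exp (-(c:ℂ) * u)
      = (Complex.I / 2) * Complex.exp ((-2 * v * Complex.I - c) * u)
        - (Complex.I / 2) * Complex.exp ((2 * v * Complex.I - c) * u) := by
    intro u
    unfold Complex.sin
    rw [show (-2 * v * Complex.I - c) * u = (-(2 * (u:ℂ) * v) * Complex.I) + (-(c:ℂ) * u) by ring,
      show (2 * v * Complex.I - c) * u = ((2 * (u:ℂ) * v) * Complex.I) + (-(c:ℂ) * u) by ring,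
      Complex.exp_add, Complex.exp_add]
    ring
  simp_rw [e]
  rw [integral_sub ((integrableOn_exp_mul_complex_Ioi ha 0).const_mul _)
    ((integrableOn_exp_mul_complex_Ioi hb 0).const_mul _), integral_const_mul, integral_const_mul,
    integral_exp_mul_complex_Ioi ha, integral_exp_mul_complex_Ioi hb]
  have h1 : (-2 * v * Complex.I - c) ≠ 0 := fun h => by rw [h] at ha; simp at ha
  have h2 : (2 * v * Complex.I - c) ≠ 0 := fun h => by rw [h] at hb; simp at hb
  have h3 : (c:ℂ)^2 + 4 * v^2 = (-2 * v * Complex.I - c) * (2 * v * Complex.I - c)  := by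
    linear_combination (4 * v^2) * Complex.I_sq
  rw [h3]
  simp only [Complex.ofReal_zero, mul_zero, Complex.exp_zero]
  have h4 : (2 * v * Complex.I - c) - (-2 * v * Complex.I - c) = 4 * v * Complex.I := by ring
  generalize (2 * v * Complex.I - c) = D2 at *
  generalize (-2 * v * Complex.I - c) = D1 at *
  field_simp
  linear_combination (-Complex.I) * h4 - 4 * v * Complex.I_sq

lemma hasSum_q {u : ℝ} (hu : 0 < u) :
    HasSum (fun n : ℕ => 2 * Real.exp (-(2 * ((n:ℝ)+1)) * u)) (Real.exp (-u) / Real.sinh u) := by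
  have h1 : Real.exp (-2*u) < 1 := by rw [Real.exp_lt_one_iff]; linarith
  have := (hasSum_geometric_of_lt_one (Real.exp_pos _).le h1).mul_left (2 * Real.exp (-2*u))
  convert! this using 1
  · funext n
    rw [← Real.exp_nat_mul, mul_assoc, ← Real.exp_add]
    ring_nf
  · have hs : 0 < Real.sinh u := Real.sinh_pos_iff.2 hu
    have h2 : 0 < 1 - Real.exp (-2*u) := by linarith
    rw [← div_eq_mul_inv, div_eq_div_iff hs.ne' h2.ne', Real.sinh_eq]
    have e1 : Real.exp (-2*u) = Real.exp (-u) * Real.exp (-u) := by rw [← Real.exp_add]; ring_nf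
    have e2 : Real.exp (-u) * Real.exp u = 1 := by rw [← Real.exp_add]; simp
    rw [e1]
    linear_combination (-Real.exp (-u)) * e2

noncomputable def qS (v : ℂ) (u : ℝ) : ℂ :=
  Complex.sin (2 * (u:ℂ) * v) * ((Real.exp (-u) / Real.sinh u : ℝ) : ℂ)

lemma intble_qS {v : ℂ} (hv : |v.im| < 1) : IntegrableOn (qS v) (Set.Ioi 0) := by
  refine intble_of_bound (C := 2 * ‖v‖) (a := 2*|v.im| - 1) (by unfold qS; fun_prop) 0
    (by linarith) ?_
  intro u hu
  have := norm_p2_le (v := v) le_rfl le_rfl hu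
  have e : qS v u = p2 v u * Real.exp (-u) := by unfold qS p2; push_cast; ring
  rw [e, norm_mul, Complex.norm_real, Real.norm_of_nonneg (Real.exp_pos _).le]
  calc _ ≤ _ * Real.exp (-u) := mul_le_mul_of_nonneg_right this (Real.exp_pos _).le
    _ = _ := by
      rw [show (2 * |v.im| - 1) * u = 2 * |v.im| * u + (-u) by ring, Real.exp_add]; ring

lemma hasSum_int_qS {v : ℂ} (hv : |v.im| < 1) :
    HasSum (fun n : ℕ => v / (((n:ℂ)+1)^2 + v^2)) (∫ u in Set.Ioi (0:ℝ), qS v u) := by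
  have := hasSum_integral_of_dominated_convergence (μ := volume.restrict (Set.Ioi (0:ℝ)))
    (F := fun (n:ℕ) (u:ℝ) => Complex.sin (2 * (u:ℂ) * v) * (2 * Complex.exp (-((2 * ((n:ℝ)+1) : ℝ) : ℂ) * u)))
    (f := qS v)
    (fun (n:ℕ) (u:ℝ) => ‖Complex.sin (2 * (u:ℂ) * v)‖ * (2 * Real.exp (-(2 * ((n:ℝ)+1)) * u)))
    (fun n => by apply Measurable.aestronglyMeasurable; fun_prop)
    ?_ ?_ ?_ ?_
  · convert! this using 2 with n
    have h0 : (0:ℝ) ≤ n := by positivity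
    have := int_sin_exp (v := v) (c := 2 * ((n:ℝ)+1)) (by linarith)
    simp_rw [mul_left_comm _ (2:ℂ) (Complex.exp _)]
    rw [integral_const_mul, this]
    push_cast
    rw [show (2 * ((n:ℂ)+1))^2 + 4*v^2 = 4 * (((n:ℂ)+1)^2+v^2) by ring]
    rw [← mul_div_assoc, show 2 * (2*v) = 4 * v by ring, mul_div_mul_left _ _ (by norm_num)]
  · intro n
    refine Filter.Eventually.of_forall fun u => ?_
    rw [norm_mul, norm_mul, Complex.norm_ofNat, Complex.norm_exp]
    simp
  · refine (ae_restrict_mem measurableSet_Ioi).mono fun u hu => ?_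
    exact (hasSum_q hu).summable.mul_left _
  · refine (intble_qS hv).norm.congr ?_
    refine (ae_restrict_mem measurableSet_Ioi).mono fun u hu => ?_
    have hu : 0 < u := hu
    have hs : 0 < Real.sinh u := Real.sinh_pos_iff.2 hu
    simp only
    rw [tsum_mul_left, (hasSum_q hu).tsum_eq]
    unfold qS
    rw [norm_mul, Complex.norm_real, Real.norm_of_nonneg (by positivity)]
  · refine (ae_restrict_mem measurableSet_Ioi).mono fun u hu => ?_
    have := (Complex.hasSum_ofReal.2 (hasSum_q hu)).mul_left (Complex.sin (2 * (u:ℂ) * v))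
    convert! this using 2 with n
    push_cast
    ring_nf

lemma int_qS {v : ℂ} (hv : |v.im| < 1) (h0 : v ≠ 0) :
    ∫ u in Set.Ioi (0:ℝ), qS v u
      = (Real.pi * (Complex.cosh (Real.pi * v) / Complex.sinh (Real.pi * v)) - 1 / v) / 2 := by
  have hx : Complex.I * v ∈ Complex.integerComplement := by
    rw [Complex.mem_integerComplement_iff]
    rintro ⟨n, hn⟩
    have hv' : v = -Complex.I * n := by
      rw [hn, ← mul_assoc]; simp
    rw [hv'] at hv h0
    simp at hv h0
    have : |n| < 1 := by exact_mod_cast hv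
    exact h0 (Int.abs_lt_one_iff.1 this)
  have h1 := cot_series_rep' hx
  have h2 := (hasSum_int_qS hv).tsum_eq
  have hne : ∀ n : ℕ, ((n:ℂ)+1)^2 + v^2 ≠ 0 ∧ Complex.I * v - (n+1) ≠ 0 ∧ Complex.I * v + (n+1) ≠ 0 := by
    intro n
    have a1 : Complex.I * v - (n+1) ≠ 0 := by
      intro h
      apply hx
      exact ⟨n+1, by push_cast; linear_combination -h⟩
    have a2 : Complex.I * v + (n+1) ≠ 0 := by
      intro h
      apply hx
      exact ⟨-(n+1), by push_cast; linear_combination -h⟩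
    refine ⟨?_, a1, a2⟩
    have : ((n:ℂ)+1)^2 + v^2 = -((Complex.I * v - (n+1)) * (Complex.I * v + (n+1))) := by
      linear_combination v^2 * Complex.I_sq
    rw [this]
    exact neg_ne_zero.2 (mul_ne_zero a1 a2)
  have h3 : ∀ n : ℕ, 1 / (Complex.I * v - (n+1)) + 1 / (Complex.I * v + (n+1))
      = (-2 * Complex.I) * (v / (((n:ℂ)+1)^2 + v^2)) := by
    intro n
    obtain ⟨a0, a1, a2⟩ := hne n
    have : ((n:ℂ)+1)^2 + v^2 = -((Complex.I * v - (n+1)) * (Complex.I * v + (n+1))) := by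
      linear_combination v^2 * Complex.I_sq
    rw [this]
    field_simp
    ring
  simp_rw [h3] at h1
  rw [tsum_mul_left, h2] at h1
  have h4 : Complex.cot (Real.pi * (Complex.I * v))
      = -Complex.I * (Complex.cosh (Real.pi * v) / Complex.sinh (Real.pi * v)) := by
    rw [Complex.cot, show (Real.pi:ℂ) * (Complex.I * v) = (Real.pi * v) * Complex.I by ring,
      Complex.cos_mul_I, Complex.sin_mul_I]
    rw [div_mul_eq_div_div_swap, Complex.div_I]
    ring
  rw [h4] at h1
  have h5 : 1 / (Complex.I * v) = -Complex.I * (1/v) := by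
    rw [one_div, mul_inv, Complex.inv_I]; ring
  rw [h5] at h1
  have h6 := congrArg (fun z => Complex.I / 2 * z) h1
  linear_combination (-1) * h6 + (-((Real.pi * (Complex.cosh (Real.pi * v) / Complex.sinh (Real.pi * v))) - 1/v)/2 + ∫ u in Set.Ioi (0:ℝ), qS v u) * Complex.I_sq

lemma P2_eq {v : ℂ} (hv : |v.im| < 1/2) :
    P2 v = Real.pi / 2 * (Complex.sinh (Real.pi * v) / Complex.cosh (Real.pi * v)) := by
  by_cases h0 : v = 0
  · subst h0
    simp [P2, p2]
  have hv1 : |v.im| < 1 := by linarith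
  have hv2 : |(2*v).im| < 1 := by simp [abs_mul]; linarith
  have key : ∀ u ∈ Set.Ioi (0:ℝ), p2 v u = qS (2*v) (2⁻¹ * u) - qS v u := by
    intro u hu
    have hu : 0 < u := hu
    have hs : 0 < Real.sinh u := Real.sinh_pos_iff.2 hu
    have hs2 : 0 < Real.sinh (2⁻¹*u) := Real.sinh_pos_iff.2 (by positivity)
    unfold p2 qS
    have e : (Real.sinh u)⁻¹ = Real.exp (-(2⁻¹ * u)) / Real.sinh (2⁻¹ * u)
        - Real.exp (-u) / Real.sinh u := by
      have : Real.sinh u = 2 * Real.sinh (2⁻¹ * u) * Real.cosh (2⁻¹ * u) := by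
        rw [← Real.sinh_two_mul]; ring_nf
      have hc := Real.cosh_pos (2⁻¹ * u)
      have e2 : Real.exp (-u) = Real.exp (-(2⁻¹ * u)) * Real.exp (-(2⁻¹ * u)) := by
        rw [← Real.exp_add]; ring_nf
      have e3 : Real.exp ((2⁻¹ * u)) * Real.exp (-(2⁻¹ * u)) = 1 := by
        rw [← Real.exp_add]; simp
      rw [this, e2]
      generalize 2⁻¹ * u = x at *
      field_simp
      rw [Real.cosh_eq]
      linear_combination -e3
    rw [div_eq_mul_inv, ← Complex.ofReal_inv, e]
    push_cast
    ring_nf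
  unfold P2
  rw [setIntegral_congr_fun measurableSet_Ioi key]
  have hi2 : IntegrableOn (fun u => qS (2*v) (2⁻¹ * u)) (Set.Ioi 0) := by
    have := (integrableOn_Ioi_comp_mul_left_iff (qS (2*v)) 0 (a := 2⁻¹) (by norm_num)).2
    apply this
    simpa using intble_qS hv2
  rw [integral_sub hi2 (intble_qS hv1), integral_comp_mul_left_Ioi (qS (2*v)) 0 (by norm_num)]
  rw [mul_zero, int_qS hv2 (by simpa using h0), int_qS hv1 h0]
  have hc : Complex.cosh (Real.pi * v) ≠ 0 := by
    intro h
    rw [← Complex.cos_mul_I, Complex.cos_eq_zero_iff] at h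
    obtain ⟨k, hk⟩ := h
    have h1 := congrArg Complex.re hk
    simp at h1
    have h2 : v.im = -(2*k+1)/2 := by
      have hp := Real.pi_pos
      have hh : Real.pi * (v.im + (2*k+1)/2) = 0 := by linarith
      rcases mul_eq_zero.1 hh with h | h
      · exact absurd h hp.ne'
      · linarith
    rw [h2, abs_div, abs_neg] at hv
    simp at hv
    have h3 : |2*k+1| < 1 := by exact_mod_cast (show |(2*k+1:ℝ)| < 1 by linarith)
    have := Int.abs_lt_one_iff.1 h3
    omega
  by_cases hsh : Complex.sinh (Real.pi * v) = 0
  · exfalso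
    rw [← mul_left_inj' Complex.I_ne_zero, ← Complex.sin_mul_I, zero_mul, Complex.sin_eq_zero_iff] at hsh
    obtain ⟨k, hk⟩ := hsh
    have hv3 : v = -Complex.I * k := by
      have hp : (Real.pi:ℂ) ≠ 0 := by exact_mod_cast Real.pi_ne_zero
      have : (Real.pi:ℂ) * (v * Complex.I - k) = 0 := by linear_combination hk
      have h4 := (mul_eq_zero.1 this).resolve_left hp
      calc v = -Complex.I * (v * Complex.I) := by ring_nf; simp
        _ = _ := by rw [show v * Complex.I = k by linear_combination h4]
    rw [hv3] at hv1 h0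
    simp at hv1 h0
    have : |k| < 1 := by exact_mod_cast hv1
    exact h0 (Int.abs_lt_one_iff.1 this)
  rw [show (Real.pi:ℂ) * (2*v) = 2 * (Real.pi * v) by ring, Complex.cosh_two_mul, Complex.sinh_two_mul]
  simp only [inv_inv, Complex.real_smul]
  push_cast
  have hcs := Complex.cosh_sq_sub_sinh_sq (Real.pi * v)
  field_simp
  ring

/-! ### Frullani integrals -/

lemma sinh_le_mul_cosh {u : ℝ} (hu : 0 ≤ u) : Real.sinh u ≤ u * Real.cosh u := by
  have hd : ∀ x : ℝ, HasDerivAt (fun x => x * Real.cosh x - Real.sinh x) (x * Real.sinh x) x := by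
    intro x
    have := ((hasDerivAt_id x).mul (Real.hasDerivAt_cosh x)).sub (Real.hasDerivAt_sinh x)
    refine this.congr_deriv ?_
    simp
  have hm : MonotoneOn (fun x => x * Real.cosh x - Real.sinh x) (Set.Ici 0) := by
    apply monotoneOn_of_deriv_nonneg (convex_Ici 0)
    · exact fun x _ => (hd x).continuousAt.continuousWithinAt
    · exact fun x _ => (hd x).differentiableAt.differentiableWithinAt
    · intro x hx
      simp at hx
      rw [(hd x).deriv]
      exact mul_nonneg hx.le (Real.sinh_nonneg_iff.2 hx.le)
  have := hm (Set.mem_Ici.2 le_rfl) (Set.mem_Ici.2 hu) hu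
  simp at this
  linarith

noncomputable def hfun (u : ℝ) : ℝ := Real.cosh u / Real.sinh u - 1 / u

lemma hfun_nonneg {u : ℝ} (hu : 0 < u) : 0 ≤ hfun u := by
  have hs : 0 < Real.sinh u := Real.sinh_pos_iff.2 hu
  unfold hfun
  rw [sub_nonneg, div_le_div_iff₀ hu hs]
  linarith [sinh_le_mul_cosh hu.le]

lemma hfun_le {u : ℝ} (hu : 0 < u) : hfun u ≤ u := by
  have hs : 0 < Real.sinh u := Real.sinh_pos_iff.2 hu
  have hx : 0 < u/2 := by positivity
  have hs2 : 0 < Real.sinh (u/2) := Real.sinh_pos_iff.2 hx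
  have hc2 := Real.cosh_pos (u/2)
  have h1 : 1 / u ≥ 1 / Real.sinh u := one_div_le_one_div_of_le hu (Real.self_le_sinh_iff.2 hu.le)
  have h2 := sinh_le_mul_cosh hx.le
  have e1 : Real.sinh u = 2 * Real.sinh (u/2) * Real.cosh (u/2) := by
    rw [← Real.sinh_two_mul]; ring_nf
  have e2 : Real.cosh u = 2 * Real.sinh (u/2)^2 + 1 := by
    have := Real.cosh_two_mul (u/2)
    rw [show 2 * (u/2) = u by ring] at this
    have := Real.cosh_sq (u/2)
    linarith
  have h3 : Real.cosh u / Real.sinh u - 1 / Real.sinh u ≤ u := by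
    rw [← sub_div, div_le_iff₀ hs, e1, e2]
    nlinarith [mul_pos hs2 hc2]
  unfold hfun
  linarith

lemma hfun_sub_one {u : ℝ} (hu : 0 < u) : |hfun u - 1| ≤ 1 / u := by
  have hs : 0 < Real.sinh u := Real.sinh_pos_iff.2 hu
  have e : Real.cosh u / Real.sinh u - 1 = Real.exp (-u) / Real.sinh u := by
    rw [← Real.cosh_sub_sinh]; field_simp
  have h1 : 0 ≤ Real.exp (-u) / Real.sinh u := by positivity
  have h2 : Real.exp (-u) / Real.sinh u ≤ 1 / u :=
    div_le_div₀ zero_le_one (Real.exp_le_one_iff.2 (by linarith)) hu (Real.self_le_sinh_iff.2 hu.le)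
  unfold hfun
  rw [abs_le]
  constructor <;> linarith

lemma measurable_hfun : Measurable hfun := by unfold hfun; fun_prop

lemma contOn_hfun : ContinuousOn hfun (Set.Ioi 0) := by
  unfold hfun
  apply ContinuousOn.sub
  · exact Real.continuous_cosh.continuousOn.div Real.continuous_sinh.continuousOn
      fun u hu => (Real.sinh_pos_iff.2 hu).ne'
  · exact continuousOn_const.div continuousOn_id fun u hu => (ne_of_gt hu)

lemma frul_intble {a b : ℝ} (ha : 0 < a) (hb : 0 < b) :
    IntegrableOn (fun x : ℝ => x⁻¹ • (hfun (a*x) - hfun (b*x))) (Set.Ioi 0) := by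
  rw [← Set.Ioc_union_Ioi_eq_Ioi (zero_le_one (α := ℝ)), integrableOn_union]
  have hm : Measurable (fun x : ℝ => x⁻¹ • (hfun (a*x) - hfun (b*x))) := by
    have := measurable_hfun
    fun_prop
  constructor
  · refine Integrable.mono' (g := fun _ => a + b) (by simp) hm.aestronglyMeasurable ?_
    refine (ae_restrict_mem measurableSet_Ioc).mono fun x hx => ?_
    have hx0 : 0 < x := hx.1
    have h1 := hfun_nonneg (mul_pos ha hx0)
    have h2 := hfun_nonneg (mul_pos hb hx0)
    have h3 := hfun_le (mul_pos ha hx0)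
    have h4 := hfun_le (mul_pos hb hx0)
    rw [norm_smul, norm_inv, Real.norm_of_nonneg hx0.le, ← div_eq_inv_mul, div_le_iff₀ hx0,
      Real.norm_eq_abs, abs_le]
    constructor <;> nlinarith [mul_pos ha hx0, mul_pos hb hx0]
  · have hi : IntegrableOn (fun x : ℝ => (1/a+1/b) * x^(-2:ℝ)) (Set.Ioi 1) :=
      (integrableOn_Ioi_rpow_of_lt (by norm_num) one_pos).const_mul _
    refine Integrable.mono' hi hm.aestronglyMeasurable ?_
    refine (ae_restrict_mem measurableSet_Ioi).mono fun x hx => ?_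
    have hx0 : 0 < x := lt_trans one_pos hx
    have h1 := hfun_sub_one (mul_pos ha hx0)
    have h2 := hfun_sub_one (mul_pos hb hx0)
    rw [norm_smul, norm_inv, Real.norm_of_nonneg hx0.le, ← div_eq_inv_mul, div_le_iff₀ hx0]
    have e : (1/a+1/b) * x^(-2:ℝ) * x = 1/(a*x) + 1/(b*x) := by
      rw [Real.rpow_neg hx0.le, Real.rpow_two]; field_simp
    rw [e, Real.norm_eq_abs]
    have := abs_sub (hfun (a*x) - 1) (hfun (b*x) - 1)
    rw [show hfun (a*x) - hfun (b*x) = (hfun (a*x) - 1) - (hfun (b*x) - 1) by ring]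
    linarith

lemma frul {a b : ℝ} (ha : 0 < a) (hb : 0 < b) :
    ∫ x in Set.Ioi (0:ℝ), x⁻¹ • (hfun (a*x) - hfun (b*x)) = -Real.log (b/a) := by
  have := Frullani.integral_Ioi_eq (f := hfun) (L := 0) (R := 1)
    (contOn_hfun.locallyIntegrableOn measurableSet_Ioi) ha hb ?_ ?_ (frul_intble ha hb)
  · rw [this]; simp
  · refine tendsto_of_tendsto_of_tendsto_of_le_of_le' (f := hfun) (g := fun _ => (0:ℝ)) (h := id) tendsto_const_nhds
      (tendsto_nhdsWithin_of_tendsto_nhds (Filter.tendsto_id (α := ℝ))) ?_ ?_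
    · exact eventually_mem_nhdsWithin.mono fun u hu => hfun_nonneg hu
    · exact eventually_mem_nhdsWithin.mono fun u hu => hfun_le hu
  · rw [tendsto_iff_norm_sub_tendsto_zero]
    refine squeeze_zero' (Filter.Eventually.of_forall fun _ => norm_nonneg _)
      ((Filter.eventually_gt_atTop 0).mono fun u hu => hfun_sub_one hu) ?_
    exact (tendsto_inv_atTop_zero (𝕜 := ℝ)).congr fun u => (one_div u).symm

lemma half_arg {u : ℝ} (hu : 0 < u) : 1/u - 1/Real.sinh u = hfun (1*u) - hfun (1/2*u) := by
  have hs2 : 0 < Real.sinh (u/2) := Real.sinh_pos_iff.2 (by positivity)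
  have hc2 := Real.cosh_pos (u/2)
  have e1 : Real.sinh u = 2 * Real.sinh (u/2) * Real.cosh (u/2) := by
    rw [← Real.sinh_two_mul]; ring_nf
  have e2 : Real.cosh u = 2 * Real.cosh (u/2)^2 - 1 := by
    have := Real.cosh_two_mul (u/2)
    rw [show 2 * (u/2) = u by ring] at this
    have := Real.cosh_sq (u/2)
    linarith
  unfold hfun
  rw [one_mul, e1, e2, show 1/2*u = u/2 by ring]
  generalize Real.sinh (u/2) = s at *
  generalize Real.cosh (u/2) = c at *
  field_simp
  ring

lemma intble_log2 : IntegrableOn (fun u : ℝ => (((1/u - 1/Real.sinh u)/u : ℝ) : ℂ)) (Set.Ioi 0) := by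
  have : IntegrableOn (fun u : ℝ => (1/u - 1/Real.sinh u)/u) (Set.Ioi 0) := by
    refine (frul_intble one_pos one_half_pos).congr ?_
    refine (ae_restrict_mem measurableSet_Ioi).mono fun u hu => ?_
    simp only
    rw [← half_arg hu, smul_eq_mul, ← div_eq_inv_mul]
  exact this.ofReal

lemma int_log2 : ∫ u in Set.Ioi (0:ℝ), (((1/u - 1/Real.sinh u)/u : ℝ) : ℂ) = Real.log 2 := by
  rw [integral_complex_ofReal]
  congr 1
  have h := frul one_pos one_half_pos
  rw [show ((1:ℝ)/2)/1 = 2⁻¹ by norm_num, Real.log_inv, neg_neg] at h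
  rw [← h]
  refine setIntegral_congr_fun measurableSet_Ioi fun u hu => ?_
  rw [← half_arg hu, smul_eq_mul, ← div_eq_inv_mul]

/-! ### the strip, Λ and G -/

def strip : Set ℂ := {v | |v.im| < 1/2}

lemma isOpen_strip : IsOpen strip :=
  isOpen_lt (by fun_prop : Continuous fun v : ℂ => |v.im|) continuous_const

lemma convex_strip : Convex ℝ strip := by
  have : strip = Complex.imCLM ⁻¹' (Set.Ioo (-(1/2)) (1/2)) := by
    ext v; simp [strip, abs_lt]
  rw [this]
  exact (convex_Ioo _ _).linear_preimage Complex.imCLM.toLinearMap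

lemma eqOn_strip {f g f' : ℂ → ℂ} (hf : ∀ v ∈ strip, HasDerivAt f (f' v) v)
    (hg : ∀ v ∈ strip, HasDerivAt g (f' v) v) (h0 : f 0 = g 0) : Set.EqOn f g strip := by
  refine IsOpen.eqOn_of_deriv_eq isOpen_strip convex_strip.isPreconnected
    (fun v hv => (hf v hv).differentiableAt.differentiableWithinAt)
    (fun v hv => (hg v hv).differentiableAt.differentiableWithinAt) ?_
    (show (0:ℂ) ∈ strip by simp [strip]) h0
  intro v hv
  rw [(hf v hv).deriv, (hg v hv).deriv]

lemma exp_slit {z : ℂ} (h : |z.im| < Real.pi) : Complex.exp z ∈ Complex.slitPlane := by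
  rw [Complex.mem_slitPlane_iff, Complex.exp_re, Complex.exp_im]
  have h' := abs_lt.1 h
  by_cases hz : z.im = 0
  · left; rw [hz]; simp [Real.exp_pos]
  · right
    apply mul_ne_zero (Real.exp_ne_zero _)
    rw [Real.sin_ne_zero_iff]
    intro n hn
    have h1 : |(n:ℝ) * Real.pi| < Real.pi := by rwa [hn]
    rw [abs_mul, abs_of_pos Real.pi_pos] at h1
    have h2 : |(n:ℝ)| < 1 := by nlinarith [Real.pi_pos]
    have h3 : |n| < 1 := by exact_mod_cast h2
    rw [Int.abs_lt_one_iff.1 h3] at hn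
    simp at hn
    exact hz hn.symm

lemma one_add_slit {w : ℂ} (h : w ∈ Complex.slitPlane) : 1 + w ∈ Complex.slitPlane := by
  rw [Complex.mem_slitPlane_iff] at *
  rcases h with h | h
  · left; simp; linarith
  · right; simpa using h

lemma strip_slit {v : ℂ} (hv : |v.im| < 1/2) :
    1 + Complex.exp (-2 * Real.pi * v) ∈ Complex.slitPlane := by
  apply one_add_slit
  apply exp_slit
  have : (-2 * Real.pi * v).im = (-2 * Real.pi) * v.im := by simp
  rw [this, abs_mul, abs_mul, abs_of_pos Real.pi_pos]
  simp
  nlinarith [Real.pi_pos]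

noncomputable def Lam (v : ℂ) : ℂ := Real.pi * v + Complex.log (1 + Complex.exp (-2 * Real.pi * v))
noncomputable def Hf (v : ℂ) : ℂ := -(Complex.I / (2 * Real.pi)) * Li2 (-Complex.exp (-2 * Real.pi * v))
noncomputable def Gf (v : ℂ) : ℂ := -Complex.I * (Real.pi * v^2/2 + Real.pi/24) + Hf v

lemma pi_c_ne : (Real.pi:ℂ) ≠ 0 := by exact_mod_cast Real.pi_ne_zero

lemma hasDerivAt_e (v : ℂ) : HasDerivAt (fun v : ℂ => Complex.exp (-2 * Real.pi * v))
    ((-2 * Real.pi) * Complex.exp (-2 * Real.pi * v)) v := by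
  have h1 : HasDerivAt (fun v : ℂ => (-2 * Real.pi : ℂ) * v) (-2 * Real.pi : ℂ) v := by
    simpa using (hasDerivAt_id v).const_mul (-2 * (Real.pi:ℂ))
  exact (h1.cexp).congr_deriv (by ring)

lemma cosh_mul_exp (v : ℂ) : 2 * Complex.cosh (Real.pi * v)
    = Complex.exp (Real.pi * v) * (1 + Complex.exp (-2 * Real.pi * v)) := by
  rw [Complex.cosh, mul_add, ← Complex.exp_add, show (Real.pi * v + -2 * Real.pi * v : ℂ) = -(Real.pi * v) by ring]
  ring

lemma exp_Lam {v : ℂ} (hv : |v.im| < 1/2) : Complex.exp (Lam v) = 2 * Complex.cosh (Real.pi * v) := by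
  rw [cosh_mul_exp, Lam, Complex.exp_add, Complex.exp_log (Complex.slitPlane_ne_zero (strip_slit hv))]

lemma cosh_ne {v : ℂ} (hv : |v.im| < 1/2) : Complex.cosh (Real.pi * v) ≠ 0 := by
  have := exp_Lam hv
  intro h
  rw [h, mul_zero] at this
  exact Complex.exp_ne_zero _ this

lemma hasDerivAt_Lam {v : ℂ} (hv : |v.im| < 1/2) : HasDerivAt Lam (2 * P2 v) v := by
  have h1 : HasDerivAt (fun v : ℂ => (Real.pi : ℂ) * v) (Real.pi : ℂ) v := by
    simpa using (hasDerivAt_id v).const_mul (Real.pi:ℂ)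
  have := h1.add (((hasDerivAt_e v).const_add 1).clog (strip_slit hv))
  refine this.congr_deriv ?_
  rw [P2_eq hv]
  have h2 := Complex.slitPlane_ne_zero (strip_slit hv)
  have h3 := cosh_mul_exp v
  have h4 : 2 * Complex.sinh (Real.pi * v)
      = Complex.exp (Real.pi * v) * (1 - Complex.exp (-2 * Real.pi * v)) := by
    rw [Complex.sinh, mul_sub, ← Complex.exp_add, show (Real.pi * v + -2 * Real.pi * v : ℂ) = -(Real.pi * v) by ring]
    ring
  have h5 : Complex.sinh (Real.pi * v) / Complex.cosh (Real.pi * v)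
      = (1 - Complex.exp (-2 * Real.pi * v)) / (1 + Complex.exp (-2 * Real.pi * v)) := by
    rw [← mul_div_mul_left _ _ (two_ne_zero (α := ℂ)), h3, h4, mul_div_mul_left _ _ (Complex.exp_ne_zero _)]
  rw [h5]
  generalize Complex.exp (-2 * Real.pi * v) = e at *
  field_simp
  ring

lemma K_eq {v : ℂ} (hv : |v.im| < 1/2) : (Real.log 2 : ℂ) - P1 v = Lam v := by
  refine eqOn_strip (f := fun v => (Real.log 2 : ℂ) - P1 v) (g := Lam) (f' := fun v => 2 * P2 v)
    (fun v hv => ?_) (fun v hv => hasDerivAt_Lam hv) ?_ hv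
  · exact ((hasDerivAt_P1 hv).const_sub _).congr_deriv (by ring)
  · have h1 : P1 0 = 0 := by simp [P1, p1]
    simp only [h1, Lam]
    norm_num

lemma hasDerivAt_Gf {v : ℂ} (hv : |v.im| < 1/2) : HasDerivAt Gf (-Complex.I * Lam v) v := by
  have h1 := hasDerivAt_Li2_comp (g := fun v => -Complex.exp (-2 * Real.pi * v)) (a := -2 * Real.pi)
    (hasDerivAt_e v).fun_neg (by ring) (by simpa using strip_slit hv)
  have h2 : HasDerivAt (fun v : ℂ => -Complex.I * (Real.pi * v^2/2 + Real.pi/24))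
      (-Complex.I * (Real.pi * v)) v := by
    have := ((((hasDerivAt_pow 2 v).const_mul (Real.pi:ℂ)).div_const 2).add_const (Real.pi/24:ℂ)).const_mul (-Complex.I)
    refine this.congr_deriv ?_
    push_cast; ring
  refine (h2.add (h1.const_mul (-(Complex.I / (2 * Real.pi))))).congr_deriv ?_
  unfold Lam
  have := pi_c_ne
  rw [sub_neg_eq_add]
  field_simp
  ring

lemma Gf_zero : Gf 0 = 0 := by
  have := pi_c_ne
  simp [Gf, Hf, Li2_neg_one]
  field_simp
  ring

lemma G_eq {v : ℂ} (hv : |v.im| < 1/2) : Complex.I * (P0 v - v * Real.log 2) = Gf v := by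
  refine eqOn_strip (f := fun v => Complex.I * (P0 v - v * Real.log 2)) (g := Gf)
    (f' := fun v => -Complex.I * Lam v)
    (fun v hv => ?_) (fun v hv => hasDerivAt_Gf hv) ?_ hv
  · refine (((hasDerivAt_P0 hv).sub ((hasDerivAt_id v).mul_const (Real.log 2:ℂ))).const_mul Complex.I).congr_deriv ?_
    rw [← K_eq hv]; ring
  · have h1 : P0 0 = 0 := by simp [P0, p0]
    simp only [h1, Gf_zero]
    ring

lemma P0_neg (v : ℂ) : P0 (-v) = -P0 v := by
  unfold P0
  rw [← integral_neg]
  congr 1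
  funext u
  unfold p0
  rw [mul_neg, Complex.sin_neg]
  ring

lemma Gf_neg {v : ℂ} (hv : |v.im| < 1/2) : Gf (-v) = -Gf v := by
  rw [← G_eq hv, ← G_eq (by simpa using hv), P0_neg]
  ring

noncomputable def ellI (τ : ℝ) (v : ℂ) (u : ℝ) : ℂ :=
  ((τ:ℂ) * Complex.sin (2 * (u:ℂ) * v) / (2 * (Real.sinh u : ℂ) * (Real.sinh (τ * u) : ℂ))
    - v / (u:ℂ)) / (u:ℂ)

noncomputable def ell (τ : ℝ) (v : ℂ) : ℂ :=
  Complex.I / τ * ∫ u in Set.Ioi (0:ℝ), ellI τ v u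

lemma Lb_eq_ell {b : ℝ} (hb : 0 < b) (v : ℂ) : Lb b (v / b) = ell (b^2) v := by
  unfold Lb ell
  have h := integral_comp_mul_left_Ioi (fun y : ℝ =>
    (Complex.sin (2 * (y:ℂ) * (v/b)) / (2 * (Real.sinh (y / b) : ℂ) * (Real.sinh (b * y) : ℂ))
      - (v/b) / (y:ℂ)) / (y:ℂ)) 0 hb
  rw [mul_zero] at h
  have hb' : (b:ℂ) ≠ 0 := by exact_mod_cast hb.ne'
  have h2 := congrArg (fun z : ℂ => (b:ℂ) * z) h
  simp only [Complex.real_smul, Complex.ofReal_inv] at h2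
  rw [mul_inv_cancel_left₀ hb'] at h2
  rw [← h2, div_mul_eq_mul_div, mul_div_assoc]
  congr 1
  rw [← integral_const_mul, ← integral_div]
  refine setIntegral_congr_fun measurableSet_Ioi fun u hu => ?_
  have hu0 : 0 < u := hu
  have hu' : (u:ℂ) ≠ 0 := by exact_mod_cast hu0.ne'
  have hs := sinh_c_ne hu0
  have hs2 := sinh_c_ne (show 0 < b^2 * u by positivity)
  unfold ellI
  rw [show b * u / b = u by field_simp, show b * (b*u) = b^2 * u by ring]
  rw [show 2 * ((b*u:ℝ):ℂ) * (v/b) = 2 * (u:ℂ) * v by push_cast; field_simp]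
  push_cast at *
  field_simp

/-! ### remainder -/

noncomputable def Nf (x : ℝ) : ℝ := x / Real.sinh x - 1 + x^2/6

lemma Nf_le {x : ℝ} (hx : 0 < x) : |Nf x| ≤ 2 * x^4 := by
  have hs : 0 < Real.sinh x := Real.sinh_pos_iff.2 hx
  have hxs := Real.self_le_sinh_iff.2 hx.le
  rcases le_or_gt x 1 with h1 | h1
  · have e1 := Real.exp_bound (x := x) (by rwa [abs_of_pos hx]) (n := 5) (by norm_num)
    have e2 := Real.exp_bound (x := -x) (by rwa [abs_neg, abs_of_pos hx]) (n := 5) (by norm_num)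
    rw [abs_neg] at e2
    rw [abs_of_pos hx] at e1 e2
    simp [Finset.sum_range_succ, Nat.factorial] at e1 e2
    norm_num at e1 e2
    rw [abs_le] at e1 e2
    obtain ⟨r, hr⟩ : ∃ r, r = Real.sinh x - x - x^3/6 := ⟨_, rfl⟩
    have hr1 : |r| ≤ x^5 / 100 := by
      rw [hr, Real.sinh_eq, abs_le]
      have : (-x)^3 = -x^3 := by ring
      have : (-x)^2 = x^2 := by ring
      have : (-x)^4 = x^4 := by ring
      constructor <;> nlinarith
    have hsx : Real.sinh x = x + x^3/6 + r := by linarith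
    have hN : Nf x = (-r + x^5/36 + x^2 * r/6) / Real.sinh x := by
      unfold Nf
      field_simp
      rw [hsx]; ring
    rw [hN, abs_div, abs_of_pos hs, div_le_iff₀ hs]
    rw [abs_le] at hr1
    have hx2 : x^2 ≤ 1 := by nlinarith
    have hx5 : 0 < x^5 := by positivity
    have hx4 : 0 < x^4 := by positivity
    have h5 : 2 * x^4 * Real.sinh x ≥ 2 * x^5 := by nlinarith
    have h6 : |x^2 * r| ≤ x^5/100 := by
      rw [abs_mul, abs_of_nonneg (sq_nonneg x)]
      have := abs_le.2 hr1
      nlinarith [abs_nonneg r]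
    rw [abs_le] at h6
    rw [abs_le]
    constructor <;> linarith
  · have h2 : x / Real.sinh x ≤ 1 := by rw [div_le_one hs]; exact hxs
    have h3 : 0 < x / Real.sinh x := by positivity
    have h4 : 1 ≤ x^2 := by nlinarith
    unfold Nf
    rw [abs_le]
    constructor <;> nlinarith

noncomputable def chi (τ u : ℝ) : ℝ := Nf (τ*u) / (2 * u^2 * Real.sinh u)

lemma meas_chi (τ : ℝ) : Measurable (chi τ) := by unfold chi Nf; fun_prop

lemma chi_le {τ u : ℝ} (hτ : 0 < τ) (hu : 0 < u) : |chi τ u| ≤ τ^4 * (u^1 * (u / Real.sinh u)) := by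
  have hs : 0 < Real.sinh u := Real.sinh_pos_iff.2 hu
  unfold chi
  rw [abs_div, abs_of_pos (show 0 < 2 * u^2 * Real.sinh u by positivity), div_le_iff₀ (by positivity)]
  refine (Nf_le (mul_pos hτ hu)).trans (le_of_eq ?_)
  field_simp

noncomputable def xI (τ : ℝ) (v : ℂ) (u : ℝ) : ℂ := Complex.sin (2 * (u:ℂ) * v) * (chi τ u : ℂ)
noncomputable def xI' (τ : ℝ) (v : ℂ) (u : ℝ) : ℂ := Complex.cos (2 * (u:ℂ) * v) * (2 * u) * (chi τ u : ℂ)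

lemma meas_xI (τ : ℝ) (v : ℂ) : Measurable (xI τ v) := by
  have := meas_chi τ
  unfold xI; fun_prop
lemma meas_xI' (τ : ℝ) (v : ℂ) : Measurable (xI' τ v) := by
  have := meas_chi τ
  unfold xI'; fun_prop

lemma norm_xI_le {τ a : ℝ} (hτ : 0 < τ) {v : ℂ} (ha : 2 * |v.im| ≤ a) {u : ℝ} (hu : 0 < u) :
    ‖xI τ v u‖ ≤ τ^4 * (u^1 * (u / Real.sinh u) * Real.exp (a*u)) := by
  have h1 := norm_sin_le_exp (2 * (u:ℂ) * v)
  rw [exp_im_eq hu] at h1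
  have h2 := chi_le hτ hu
  unfold xI
  rw [norm_mul, Complex.norm_real, Real.norm_eq_abs]
  calc _ ≤ Real.exp (a*u) * (τ^4 * (u^1 * (u / Real.sinh u))) := by
        refine mul_le_mul (h1.trans ?_) h2 (abs_nonneg _) (Real.exp_pos _).le
        gcongr
    _ = _ := by ring

lemma norm_xI'_le {τ a : ℝ} (hτ : 0 < τ) {v : ℂ} (ha : 2 * |v.im| ≤ a) {u : ℝ} (hu : 0 < u) :
    ‖xI' τ v u‖ ≤ (2*τ^4) * (u^2 * (u / Real.sinh u) * Real.exp (a*u)) := by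
  have h1 := norm_cos_le (2 * (u:ℂ) * v)
  rw [exp_im_eq hu] at h1
  have h2 := chi_le hτ hu
  unfold xI'
  rw [norm_mul, norm_mul, norm_mul, Complex.norm_real, Complex.norm_real, Real.norm_eq_abs,
    Real.norm_eq_abs, abs_of_pos hu, Complex.norm_ofNat]
  calc _ ≤ (Real.exp (a*u) * (2*u)) * (τ^4 * (u^1 * (u / Real.sinh u))) := by
        refine mul_le_mul (mul_le_mul_of_nonneg_right (h1.trans ?_) (by positivity)) h2 (abs_nonneg _) (by positivity)
        gcongr
    _ = _ := by ring

lemma intble_xI {τ : ℝ} (hτ : 0 < τ) {v : ℂ} (hv : |v.im| < 1/2) : IntegrableOn (xI τ v) (Set.Ioi 0) :=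
  intble_of_bound (meas_xI τ v) 1 (strip_two hv) fun _ hu => norm_xI_le hτ le_rfl hu

noncomputable def Xf (τ : ℝ) (v : ℂ) : ℂ := ∫ u in Set.Ioi (0:ℝ), xI τ v u

lemma diff_Xf {τ : ℝ} (hτ : 0 < τ) {v : ℂ} (hv : |v.im| < 1/2) : DifferentiableAt ℂ (Xf τ) v := by
  refine (hasDerivAt_int_strip (f' := xI' τ) (meas_xI τ) (meas_xI' τ) 2 ?_ (fun v hv => intble_xI hτ hv)
    (fun M a => ⟨_, fun v _ h2 u hu => norm_xI'_le hτ h2 hu⟩) hv).differentiableAt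
  intro v u hu
  have h1 : HasDerivAt (fun v : ℂ => 2 * (u:ℂ) * v) (2 * (u:ℂ)) v := by
    simpa using (hasDerivAt_id v).const_mul (2*(u:ℂ))
  exact (h1.csin).mul_const _

lemma norm_Xf_le {τ ρ : ℝ} (hτ : 0 < τ) (hρ : ρ < 1/2) {v : ℂ} (hv : |v.im| ≤ ρ) :
    ‖Xf τ v‖ ≤ τ^4 * ∫ u in Set.Ioi (0:ℝ), u^1 * (u / Real.sinh u) * Real.exp ((2*ρ)*u) := by
  unfold Xf
  rw [← integral_const_mul]
  refine norm_integral_le_of_norm_le ((intble_sinh 1 (by linarith)).const_mul _) ?_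
  exact (ae_restrict_mem measurableSet_Ioi).mono fun u hu => norm_xI_le hτ (by linarith) hu

/-! ### decomposition -/

lemma ellI_eq {τ : ℝ} (hτ : 0 < τ) (v : ℂ) {u : ℝ} (hu : 0 < u) :
    ellI τ v u = (p0 v u - v * (((1/u - 1/Real.sinh u)/u : ℝ) : ℂ)) +
      (-(τ:ℂ)^2/12 * p2 v u + xI τ v u) := by
  have hu' : (u:ℂ) ≠ 0 := by exact_mod_cast hu.ne'
  have ht' : (τ:ℂ) ≠ 0 := by exact_mod_cast hτ.ne'
  have hs := sinh_c_ne hu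
  have hs2 := sinh_c_ne (show 0 < τ * u by positivity)
  unfold ellI p0 p2 xI chi Nf
  push_cast at *
  field_simp
  ring

lemma intble_ellI {τ : ℝ} (hτ : 0 < τ) {v : ℂ} (hv : |v.im| < 1/2) :
    IntegrableOn (ellI τ v) (Set.Ioi 0) := by
  have := ((intble_p0 hv).sub (intble_log2.const_mul v)).add
    (((intble_p2 hv).const_mul (-(τ:ℂ)^2/12)).add (intble_xI hτ hv))
  refine this.congr ?_
  exact (ae_restrict_mem measurableSet_Ioi).mono fun u hu => (ellI_eq hτ v hu).symm

noncomputable def Er (τ : ℝ) (v : ℂ) : ℂ := Complex.I * (-(τ:ℂ)^2/12 * P2 v + Xf τ v)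

lemma ell_eq {τ : ℝ} (hτ : 0 < τ) {v : ℂ} (hv : |v.im| < 1/2) :
    ell τ v = (Gf v + Er τ v) / τ := by
  unfold ell
  rw [setIntegral_congr_fun measurableSet_Ioi (fun u hu => ellI_eq hτ v hu)]
  have h2 := (intble_p2 hv).const_mul (-(τ:ℂ)^2/12)
  have h3 := intble_log2.const_mul v
  have h4 : Integrable (fun u => p0 v u - v * (((1/u - 1/Real.sinh u)/u : ℝ) : ℂ))
    (volume.restrict (Set.Ioi 0)) := (intble_p0 hv).sub h3
  have h5 : Integrable (fun u => -(τ:ℂ)^2/12 * p2 v u + xI τ v u)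
    (volume.restrict (Set.Ioi 0)) := h2.add (intble_xI hτ hv)
  rw [integral_add h4 h5,
    integral_sub (intble_p0 hv) h3, integral_add h2 (intble_xI hτ hv),
    integral_const_mul, integral_const_mul, int_log2, ← G_eq hv]
  unfold Er P0 P2 Xf
  ring

lemma ell_neg (τ : ℝ) (v : ℂ) : ell τ (-v) = -ell τ v := by
  unfold ell
  rw [← mul_neg, ← integral_neg]
  congr 2
  funext u
  unfold ellI
  rw [mul_neg, Complex.sin_neg]
  ring

lemma diff_P2 {v : ℂ} (hv : |v.im| < 1/2) : DifferentiableAt ℂ P2 v := by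
  have h : P2 =ᶠ[nhds v] fun v => Real.pi / 2 * (Complex.sinh (Real.pi * v) / Complex.cosh (Real.pi * v)) :=
    Filter.eventuallyEq_of_mem (isOpen_strip.mem_nhds hv) fun z hz => P2_eq hz
  rw [h.differentiableAt_iff]
  have := cosh_ne hv
  fun_prop (disch := assumption)

lemma diff_Er {τ : ℝ} (hτ : 0 < τ) {v : ℂ} (hv : |v.im| < 1/2) : DifferentiableAt ℂ (Er τ) v := by
  have := diff_P2 hv
  have := diff_Xf hτ hv
  unfold Er
  fun_prop

lemma diff_ell {τ : ℝ} (hτ : 0 < τ) {v : ℂ} (hv : |v.im| < 1/2) : DifferentiableAt ℂ (ell τ) v := by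
  have h : ell τ =ᶠ[nhds v] fun v => (Gf v + Er τ v) / τ :=
    Filter.eventuallyEq_of_mem (isOpen_strip.mem_nhds hv) fun z hz => ell_eq hτ hz
  rw [h.differentiableAt_iff]
  exact ((hasDerivAt_Gf hv).differentiableAt.add (diff_Er hτ hv)).div_const _

lemma ell_FE {τ : ℝ} (hτ : 0 < τ) {v : ℂ} (hv : |v.im| + τ/2 < 1/2) :
    ell τ (v + Complex.I * τ/2) - ell τ (v - Complex.I * τ / 2) = Lam v := by
  have hv0 : |v.im| < 1/2 := by linarith
  have him1 : (v + Complex.I * τ/2).im = v.im + τ/2 := by simp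
  have him2 : (v - Complex.I * τ/2).im = v.im - τ/2 := by simp
  have hv1 : |(v + Complex.I * τ/2).im| < 1/2 := by
    rw [him1]
    have := abs_add_le v.im (τ/2)
    rw [abs_of_pos (half_pos hτ)] at this
    linarith
  have hv2 : |(v - Complex.I * τ/2).im| < 1/2 := by
    rw [him2]
    have := abs_sub v.im (τ/2)
    rw [abs_of_pos (half_pos hτ)] at this
    linarith
  have ht' : (τ:ℂ) ≠ 0 := by exact_mod_cast hτ.ne'
  unfold ell
  rw [← mul_sub, ← integral_sub (intble_ellI hτ hv1) (intble_ellI hτ hv2), ← K_eq hv0, ← int_log2]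
  unfold P1
  rw [← integral_sub intble_log2 (intble_p1 hv0), ← integral_const_mul]
  refine setIntegral_congr_fun measurableSet_Ioi fun u hu => ?_
  have hu0 : 0 < u := hu
  have hu' : (u:ℂ) ≠ 0 := by exact_mod_cast hu0.ne'
  have hs := sinh_c_ne hu0
  have hs2 := sinh_c_ne (show 0 < τ * u by positivity)
  have e1 : Complex.sin (2 * (u:ℂ) * (v + Complex.I * τ/2))
      = Complex.sin (2 * (u:ℂ) * v) * Complex.cosh (τ * u) + Complex.cos (2 * (u:ℂ) * v) * Complex.sinh (τ*u) * Complex.I := by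
    rw [show 2 * (u:ℂ) * (v + Complex.I * τ/2) = 2 * (u:ℂ) * v + (τ * u) * Complex.I by ring,
      Complex.sin_add, Complex.cos_mul_I, Complex.sin_mul_I]
    ring
  have e2 : Complex.sin (2 * (u:ℂ) * (v - Complex.I * τ/2))
      = Complex.sin (2 * (u:ℂ) * v) * Complex.cosh (τ * u) - Complex.cos (2 * (u:ℂ) * v) * Complex.sinh (τ*u) * Complex.I := by
    rw [show 2 * (u:ℂ) * (v - Complex.I * τ/2) = 2 * (u:ℂ) * v - (τ * u) * Complex.I by ring,
      Complex.sin_sub, Complex.cos_mul_I, Complex.sin_mul_I]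
    ring
  unfold ellI p1
  rw [e1, e2]
  push_cast at *
  field_simp
  linear_combination (2 * τ * Complex.sinh (τ*u) * (Complex.cos (2 * (u:ℂ) * v) * u - Complex.sinh u)) * Complex.I_sq

lemma ell_special {τ : ℝ} (hτ : 0 < τ) :
    ell τ (Complex.I * (1 - τ) / 2) = -(Real.log τ : ℂ) / 2 := by
  have hF := frul hτ one_pos
  have ht' : (τ:ℂ) ≠ 0 := by exact_mod_cast hτ.ne'
  rw [one_div, Real.log_inv, neg_neg] at hF
  have hF' : ((∫ x in Set.Ioi (0:ℝ), x⁻¹ • (hfun (τ*x) - hfun (1*x)) : ℝ) : ℂ) = (Real.log τ : ℂ) := by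
    rw [hF]
  rw [← integral_complex_ofReal] at hF'
  rw [← hF', show ∀ z : ℂ, -z/2 = (-1/2) * z from fun z => by ring]
  unfold ell
  rw [← integral_const_mul, ← integral_const_mul]
  refine setIntegral_congr_fun measurableSet_Ioi fun u hu => ?_
  have hu0 : 0 < u := hu
  have hu' : (u:ℂ) ≠ 0 := by exact_mod_cast hu0.ne'
  have hs := sinh_c_ne hu0
  have hs2 := sinh_c_ne (show 0 < τ * u by positivity)
  have e1 : Complex.sin (2 * (u:ℂ) * (Complex.I * (1 - τ) / 2))
      = (Complex.sinh u * Complex.cosh (τ * u) - Complex.cosh u * Complex.sinh (τ*u)) * Complex.I := by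
    rw [show 2 * (u:ℂ) * (Complex.I * (1 - τ) / 2) = (u - τ * u) * Complex.I by ring,
      Complex.sin_mul_I, Complex.sinh_sub]
  unfold ellI hfun
  rw [e1, one_mul, smul_eq_mul]
  push_cast at *
  field_simp
  ring_nf
  simp only [Complex.I_sq]
  ring

lemma RL_aux (f : ℝ → ℂ) : Filter.Tendsto
    (fun x : ℝ => ∫ u in Set.Ioi (0:ℝ), Complex.exp (-(2 * u * x) * Complex.I) * f u)
    (Filter.cocompact ℝ) (nhds 0) := by
  have h := Real.tendsto_integral_exp_smul_cocompact ((Set.Ioi (0:ℝ)).indicator f)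
  have h2 : Filter.Tendsto (fun x : ℝ => x * Real.pi⁻¹) (Filter.cocompact ℝ) (Filter.cocompact ℝ) :=
    (Homeomorph.mulRight₀ (Real.pi⁻¹) (inv_ne_zero Real.pi_ne_zero)).isClosedEmbedding.tendsto_cocompact
  refine (h.comp h2).congr fun x => ?_
  simp only [Function.comp]
  rw [← integral_indicator measurableSet_Ioi]
  congr 1
  funext u
  by_cases hu : u ∈ Set.Ioi (0:ℝ)
  · rw [Set.indicator_of_mem hu, Set.indicator_of_mem hu, Circle.smul_def, Real.fourierChar_apply,
      smul_eq_mul]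
    congr 2
    have := pi_c_ne
    push_cast
    field_simp
  · rw [Set.indicator_of_notMem hu, Set.indicator_of_notMem hu, smul_zero]

lemma tendsto_Xf {τ y : ℝ} (hτ : 0 < τ) (hy : |y| < 1/2) :
    Filter.Tendsto (fun x : ℝ => Xf τ (x + y * Complex.I)) Filter.atTop (nhds 0) := by
  have h1 := (RL_aux (fun u => Real.exp (2*u*y) * chi τ u)).mono_left (atTop_le_cocompact (α := ℝ))
  have h2 := ((RL_aux (fun u => Real.exp (-(2*u*y)) * chi τ u)).mono_left (atBot_le_cocompact (α := ℝ))).comp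
    Filter.tendsto_neg_atTop_atBot
  have h3 := (h1.sub h2).const_mul (Complex.I / 2)
  rw [sub_zero, mul_zero] at h3
  refine h3.congr fun x => ?_
  simp only [Function.comp]
  have hi : ∀ (s t : ℝ), |s| ≤ 2 * |y| → IntegrableOn (fun u : ℝ => Complex.exp (-(2 * u * t) * Complex.I) * (((Real.exp (s*u) : ℝ):ℂ) * chi τ u)) (Set.Ioi 0) := by
    intro s t hs
    refine intble_of_bound (k := 1) (a := 2 * |y|) (C := τ^4) ?_ (by linarith) ?_
    · have := meas_chi τ
      fun_prop
    · intro u hu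
      rw [norm_mul, norm_mul, Complex.norm_real, Complex.norm_real, Real.norm_eq_abs, Real.norm_eq_abs, Complex.norm_exp]
      have := chi_le hτ hu
      rw [abs_of_pos (Real.exp_pos _)]
      have h5 : Real.exp (s*u) ≤ Real.exp (2 * |y| * u) := by
        have := le_abs_self s
        have hu' : 0 < u := hu
        apply Real.exp_le_exp.2
        gcongr
        linarith
      simp
      calc _ ≤ Real.exp (2 * |y| * u) * (τ^4 * (u^1 * (u / Real.sinh u))) := by gcongr
        _ = _ := by ring
  have e1 := hi (2*y) x (by rw [abs_mul]; simp)
  have e2 := hi (-(2*y)) (-x) (by rw [abs_neg, abs_mul]; simp)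
  have e1' : IntegrableOn (fun u : ℝ => Complex.exp (-(2 * u * x) * Complex.I) * (((Real.exp (2*u*y) : ℝ):ℂ) * chi τ u)) (Set.Ioi 0) := by
    convert! e1 using 6
    ring
  have e2' : IntegrableOn (fun u : ℝ => Complex.exp (-(2 * u * (-x:ℝ)) * Complex.I) * (((Real.exp (-(2*u*y)) : ℝ):ℂ) * chi τ u)) (Set.Ioi 0) := by
    convert! e2 using 6
    ring
  rw [← integral_sub e1' e2', ← integral_const_mul]
  unfold Xf
  congr 1
  funext u
  unfold xI Complex.sin
  have a1 : Complex.exp (-(2 * (u:ℂ) * (x + y * Complex.I)) * Complex.I)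
      = Complex.exp (-(2 * u * x) * Complex.I) * Real.exp (2*u*y) := by
    push_cast
    rw [← Complex.exp_add]
    congr 1
    linear_combination (-(2*(u:ℂ)*y)) * Complex.I_sq
  have a2 : Complex.exp ((2 * (u:ℂ) * (x + y * Complex.I)) * Complex.I)
      = Complex.exp (-(2 * u * (-x:ℝ)) * Complex.I) * Real.exp (-(2*u*y)) := by
    push_cast
    rw [← Complex.exp_add]
    congr 1
    linear_combination ((2*(u:ℂ)*y)) * Complex.I_sq
  rw [a1, a2]
  ring

lemma norm_P2_le {ρ : ℝ} (hρ : ρ < 1/2) {v : ℂ} (hv : |v.im| ≤ ρ) :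
    ‖P2 v‖ ≤ Real.pi / 2 / Real.cos (Real.pi * ρ) := by
  have hρ0 : 0 ≤ ρ := (abs_nonneg _).trans hv
  have hc : 0 < Real.cos (Real.pi * ρ) := by
    apply Real.cos_pos_of_mem_Ioo
    constructor <;> nlinarith [Real.pi_pos]
  rw [P2_eq (by linarith), norm_mul, div_eq_mul_inv (Real.pi/2)]
  have h1 : ‖(Real.pi / 2 : ℂ)‖ = Real.pi/2 := by
    simp [abs_of_pos Real.pi_pos]
  rw [h1]
  apply mul_le_mul_of_nonneg_left _ (by positivity)
  have hA : ‖Complex.sinh (Real.pi * v)‖ ≤ Real.cosh (Real.pi * v.re) := by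
    rw [Complex.sinh, norm_div, Complex.norm_ofNat, Real.cosh_eq]
    have := norm_sub_le (Complex.exp (Real.pi * v)) (Complex.exp (-(Real.pi * v)))
    rw [Complex.norm_exp, Complex.norm_exp] at this
    simp at this
    linarith
  have hcc := Real.cosh_pos (Real.pi * v.re)
  have hB : Real.cosh (Real.pi * v.re) * Real.cos (Real.pi * ρ) ≤ ‖Complex.cosh (Real.pi * v)‖ := by
    have h2 : (Complex.cosh (Real.pi * v)).re = Real.cosh (Real.pi * v.re) * Real.cos (Real.pi * v.im) := by
      conv_lhs => rw [← Complex.re_add_im v, mul_add, ← mul_assoc, Complex.cosh_add, Complex.cosh_mul_I, Complex.sinh_mul_I]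
      rw [← Complex.ofReal_mul, ← Complex.ofReal_mul, ← Complex.ofReal_cosh, ← Complex.ofReal_cos, ← Complex.ofReal_sinh, ← Complex.ofReal_sin]
      simp only [Complex.add_re, Complex.mul_re, Complex.ofReal_re, Complex.ofReal_im, Complex.mul_im, Complex.I_re, Complex.I_im]
      ring
    have h3 : Real.cos (Real.pi * ρ) ≤ Real.cos (Real.pi * v.im) := by
      rw [← Real.cos_abs (Real.pi * v.im), abs_mul, abs_of_pos Real.pi_pos]
      apply Real.cos_le_cos_of_nonneg_of_le_pi (by positivity)
      · nlinarith [Real.pi_pos]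
      · gcongr
    calc _ ≤ Real.cosh (Real.pi * v.re) * Real.cos (Real.pi * v.im) := by gcongr
      _ = _ := h2.symm
      _ ≤ _ := Complex.re_le_norm _
  rw [norm_div, div_le_iff₀ (lt_of_lt_of_le (by positivity) hB)]
  calc _ ≤ _ := hA
    _ = (Real.cos (Real.pi * ρ))⁻¹ * (Real.cosh (Real.pi * v.re) * Real.cos (Real.pi * ρ)) := by field_simp
    _ ≤ _ := by gcongr

lemma Er_bound {ρ : ℝ} (hρ : ρ < 1/2) : ∃ C, ∀ τ : ℝ, 0 < τ → τ ≤ 1 → ∀ v : ℂ, |v.im| ≤ ρ →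
    ‖Er τ v‖ ≤ C * τ^2 := by
  refine ⟨Real.pi / 2 / Real.cos (Real.pi * ρ) +
    ∫ u in Set.Ioi (0:ℝ), u^1 * (u / Real.sinh u) * Real.exp ((2*ρ)*u), ?_⟩
  intro τ hτ hτ1 v hv
  have h1 := norm_P2_le hρ hv
  have h2 := norm_Xf_le hτ hρ hv
  set J := ∫ u in Set.Ioi (0:ℝ), u^1 * (u / Real.sinh u) * Real.exp ((2*ρ)*u) with hJ
  have hJ0 : 0 ≤ J := by
    apply setIntegral_nonneg measurableSet_Ioi
    intro u hu
    have hu : 0 < u := hu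
    have hs : 0 < Real.sinh u := Real.sinh_pos_iff.2 hu
    positivity
  unfold Er
  rw [norm_mul, Complex.norm_I, one_mul]
  have h3 : ‖-(τ:ℂ)^2/12 * P2 v‖ ≤ τ^2 * ‖P2 v‖ := by
    rw [norm_mul]
    gcongr
    simp
    nlinarith [sq_nonneg τ]
  have h4 : τ^4 ≤ τ^2 := pow_le_pow_of_le_one hτ.le hτ1 (by norm_num)
  calc _ ≤ _ := norm_add_le _ _
    _ ≤ τ^2 * ‖P2 v‖ + τ^4 * J := by gcongr
    _ ≤ τ^2 * (Real.pi / 2 / Real.cos (Real.pi * ρ)) + τ^2 * J := by gcongr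
    _ = _ := by ring

lemma tendsto_e (y : ℝ) : Filter.Tendsto (fun x : ℝ => Complex.exp (-2 * Real.pi * (x + y * Complex.I)))
    Filter.atTop (nhds 0) := by
  rw [tendsto_zero_iff_norm_tendsto_zero]
  have : (fun x : ℝ => ‖Complex.exp (-2 * Real.pi * (x + y * Complex.I))‖) = fun x => Real.exp (-(2 * Real.pi * x)) := by
    funext x
    rw [Complex.norm_exp]
    simp
  rw [this]
  refine Real.tendsto_exp_neg_atTop_nhds_zero.comp ?_
  exact Filter.tendsto_id.const_mul_atTop (by positivity)

lemma tanh_eq (v : ℂ) : Complex.sinh (Real.pi * v) / Complex.cosh (Real.pi * v)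
      = (1 - Complex.exp (-2 * Real.pi * v)) / (1 + Complex.exp (-2 * Real.pi * v)) := by
  have h4 : 2 * Complex.sinh (Real.pi * v)
      = Complex.exp (Real.pi * v) * (1 - Complex.exp (-2 * Real.pi * v)) := by
    rw [Complex.sinh, mul_sub, ← Complex.exp_add, show (Real.pi * v + -2 * Real.pi * v : ℂ) = -(Real.pi * v) by ring]
    ring
  rw [← mul_div_mul_left _ _ (two_ne_zero (α := ℂ)), cosh_mul_exp, h4, mul_div_mul_left _ _ (Complex.exp_ne_zero _)]

lemma tendsto_Er {τ y : ℝ} (hτ : 0 < τ) (hy : |y| < 1/2) :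
    Filter.Tendsto (fun x : ℝ => Er τ (x + y * Complex.I)) Filter.atTop
      (nhds (-Complex.I * Real.pi * τ^2 / 24)) := by
  have h1 : Filter.Tendsto (fun x : ℝ => P2 (x + y * Complex.I)) Filter.atTop (nhds (Real.pi / 2)) := by
    have h2 := (((tendsto_e y).const_sub 1).div ((tendsto_e y).const_add 1) (by simp)).const_mul (Real.pi / 2 : ℂ)
    simp only [sub_zero, add_zero, div_one, mul_one] at h2
    refine h2.congr fun x => ?_
    rw [P2_eq (by simpa using hy), tanh_eq]
    rfl
  have h3 := ((h1.const_mul (-(τ:ℂ)^2/12)).add (tendsto_Xf hτ hy)).const_mul Complex.I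
  refine h3.congr' ?_ |>.trans ?_
  · exact Filter.EventuallyEq.rfl
  · apply le_of_eq
    congr 1
    ring

lemma tendsto_Hf (y : ℝ) :
    Filter.Tendsto (fun x : ℝ => Hf (x + y * Complex.I)) Filter.atTop (nhds 0) := by
  have hc : ContinuousAt Li2 0 := (diffAt_Li2 (by simp)).continuousAt
  have h1 := (tendsto_e y).neg
  rw [neg_zero] at h1
  have h2 := (hc.tendsto.comp h1).const_mul (-(Complex.I / (2 * Real.pi)))
  rw [Li2_zero, mul_zero] at h2
  exact h2

lemma norm_Hf_le {v : ℂ} (hv : |v.im| < 1/2) (h0 : 0 ≤ v.re) : ‖Hf v‖ ≤ 1 := by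
  unfold Hf
  have hn : ‖-Complex.exp (-2 * Real.pi * v)‖ ≤ 1 := by
    rw [norm_neg, Complex.norm_exp, Real.exp_le_one_iff]
    simp
    positivity
  have h1 : -Complex.exp (-2 * Real.pi * v) ≠ 1 := by
    intro h
    have := strip_slit hv
    rw [show Complex.exp (-2 * Real.pi * v) = -1 by rw [← h]; ring] at this
    simp at this
  have h2 := norm_Li2_le' hn h1
  rw [norm_mul]
  have h3 : ‖-(Complex.I / (2 * Real.pi))‖ = 1 / (2 * Real.pi) := by
    rw [norm_neg, norm_div]; simp [abs_of_pos Real.pi_pos]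
  rw [h3]
  have hp := Real.pi_pos
  calc _ ≤ 1 / (2 * Real.pi) * (Real.pi^2/6) := by gcongr
    _ = Real.pi/12 := by field_simp; ring
    _ ≤ 1 := by linarith [Real.pi_lt_four]

lemma norm_Hf_le' {r : ℝ} {v : ℂ} (hv : |v.im| < 1/2) (h0 : -r ≤ v.re) :
    ‖Hf v‖ ≤ 1 + 2 * (Real.pi * (r + 1)^2 / 2 + Real.pi / 24) := by
  have hp := Real.pi_pos
  rcases le_or_gt 0 v.re with h | h
  · refine (norm_Hf_le hv h).trans ?_
    have : 0 ≤ 2 * (Real.pi * (r + 1)^2 / 2 + Real.pi / 24) := by positivity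
    linarith
  · have e := Gf_neg hv
    unfold Gf at e
    have e2 : Hf v = -Hf (-v) + 2 * Complex.I * (Real.pi * v^2/2 + Real.pi/24) := by
      linear_combination e
    have h1 : ‖Hf (-v)‖ ≤ 1 := norm_Hf_le (by simpa using hv) (by simp; linarith)
    have hvn : ‖v‖ ≤ r + 1 := by
      have := Complex.norm_le_abs_re_add_abs_im v
      rw [abs_of_neg h] at this
      linarith
    have h2 : ‖2 * Complex.I * (Real.pi * v^2/2 + Real.pi/24)‖ ≤ 2 * (Real.pi * (r + 1)^2 / 2 + Real.pi / 24) := by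
      rw [norm_mul]
      have : ‖(2 * Complex.I : ℂ)‖ = 2 := by simp
      rw [this]
      gcongr
      refine (norm_add_le _ _).trans ?_
      rw [norm_div, norm_mul, norm_pow, norm_div]
      simp only [Complex.norm_real, Real.norm_of_nonneg hp.le, Complex.norm_ofNat]
      gcongr
    rw [e2]
    refine (norm_add_le _ _).trans ?_
    rw [norm_neg]
    linarith

/-- `Dp = ell + (I/τ)(π v²/2+π/24)`. -/
noncomputable def Dp (τ : ℝ) (v : ℂ) : ℂ := (Hf v + Er τ v) / τ

lemma ell_eq_Dp {τ : ℝ} (hτ : 0 < τ) {v : ℂ} (hv : |v.im| < 1/2) :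
    ell τ v = -Complex.I * (Real.pi * v^2/2 + Real.pi/24) / τ + Dp τ v := by
  rw [ell_eq hτ hv, Gf, Dp]; ring

lemma ell_eq_Dp_neg {τ : ℝ} (hτ : 0 < τ) {v : ℂ} (hv : |v.im| < 1/2) :
    ell τ v = Complex.I * (Real.pi * v^2/2 + Real.pi/24) / τ - Dp τ (-v) := by
  have h := ell_neg τ v
  rw [ell_eq_Dp hτ (v := -v) (by simpa using hv)] at h
  linear_combination h

lemma Dp_bound {τ : ℝ} (hτ : 0 < τ) (hτ1 : τ ≤ 1) (r : ℝ) {ρ : ℝ} (hρ : ρ < 1/2) :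
    ∃ M, ∀ v : ℂ, -r ≤ v.re → |v.im| ≤ ρ → ‖Dp τ v‖ ≤ M := by
  obtain ⟨C, hC⟩ := Er_bound hρ
  refine ⟨(1 + 2 * (Real.pi * (r + 1)^2 / 2 + Real.pi / 24) + C * τ^2) / τ, fun v h1 h2 => ?_⟩
  unfold Dp
  rw [norm_div, Complex.norm_real, Real.norm_of_nonneg hτ.le]
  gcongr
  exact (norm_add_le _ _).trans (add_le_add (norm_Hf_le' (by linarith) h1) (hC τ hτ hτ1 v h2))

lemma tendsto_Dp {τ y : ℝ} (hτ : 0 < τ) (hy : |y| < 1/2) :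
    Filter.Tendsto (fun x : ℝ => Dp τ (x + y * Complex.I)) Filter.atTop
      (nhds (-Complex.I * Real.pi * τ / 24)) := by
  have ht' : (τ:ℂ) ≠ 0 := by exact_mod_cast hτ.ne'
  have := ((tendsto_Hf y).add (tendsto_Er hτ hy)).div_const (τ:ℂ)
  refine this.trans (le_of_eq ?_)
  congr 1
  field_simp
  ring

/-! ### general strip lemmas -/

lemma exp_neg_abs_integrable {d : ℝ} (hd : 0 < d) : Integrable (fun x : ℝ => Real.exp (-d * |x|)) := by
  have h1 : IntegrableOn (fun x : ℝ => Real.exp (-d * |x|)) (Set.Iic 0) := by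
    refine (integrableOn_exp_mul_Iic hd 0).congr_fun (fun x hx => ?_) measurableSet_Iic
    have hx : x ≤ 0 := hx
    simp only [abs_of_nonpos hx]
    congr 1; ring
  have h2 : IntegrableOn (fun x : ℝ => Real.exp (-d * |x|)) (Set.Ioi 0) := by
    refine (integrableOn_exp_mul_Ioi (a := -d) (by linarith) 0).congr_fun (fun x hx => ?_) measurableSet_Ioi
    have hx : 0 < x := hx
    simp only [abs_of_pos hx]
  have := h1.union h2
  rwa [Set.Iic_union_Ioi, integrableOn_univ] at this

lemma exp_neg_abs_tendsto_top {d : ℝ} (hd : 0 < d) (M : ℝ) : Filter.Tendsto (fun x : ℝ => M * Real.exp (-d * |x|)) Filter.atTop (nhds 0) := by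
  have : Filter.Tendsto (fun x : ℝ => Real.exp (-(d * |x|))) Filter.atTop (nhds 0) :=
    Real.tendsto_exp_neg_atTop_nhds_zero.comp (Filter.tendsto_abs_atTop_atTop.const_mul_atTop hd)
  simpa using this.const_mul M

lemma shift_contour {f : ℂ → ℂ} {y1 y2 M d : ℝ} (hd : 0 < d)
    (hf : ∀ z : ℂ, z.im ∈ Set.uIcc y1 y2 → DifferentiableAt ℂ f z)
    (hb : ∀ z : ℂ, z.im ∈ Set.uIcc y1 y2 → ‖f z‖ ≤ M * Real.exp (-d * |z.re|)) :
    ∫ x : ℝ, f (x + y1 * Complex.I) = ∫ x : ℝ, f (x + y2 * Complex.I) := by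
  have hint : ∀ y ∈ Set.uIcc y1 y2, Integrable (fun x : ℝ => f (x + y * Complex.I)) := by
    intro y hy
    have hc : Continuous (fun x : ℝ => f (x + y * Complex.I)) := by
      rw [continuous_iff_continuousAt]
      intro x
      have := (hf (x + y * Complex.I) (by simpa using hy)).continuousAt
      exact ContinuousAt.comp (f := fun x : ℝ => (x + y * Complex.I : ℂ)) this (by fun_prop)
    refine Integrable.mono' ((exp_neg_abs_integrable hd).const_mul M) hc.aestronglyMeasurable ?_
    filter_upwards with x
    simpa using hb (x + y * Complex.I) (by simpa using hy)
  have l1 := intervalIntegral_tendsto_integral (hint y1 Set.left_mem_uIcc) Filter.tendsto_neg_atTop_atBot Filter.tendsto_id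
  have l2 := intervalIntegral_tendsto_integral (hint y2 Set.right_mem_uIcc) Filter.tendsto_neg_atTop_atBot Filter.tendsto_id
  have side : ∀ (s : ℝ), |s| = 1 → Filter.Tendsto (fun T : ℝ => ∫ y in y1..y2, f ((s * T : ℝ) + y * Complex.I)) Filter.atTop (nhds 0) := by
    intro s hs
    refine squeeze_zero_norm (a := fun T => (M * |y2 - y1|) * Real.exp (-d * |T|)) ?_ (exp_neg_abs_tendsto_top hd _)
    intro T
    have := intervalIntegral.norm_integral_le_of_norm_le_const (a := y1) (b := y2) (f := fun y : ℝ => f ((s * T : ℝ) + y * Complex.I)) (C := M * Real.exp (-d * |T|)) ?_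
    · refine this.trans (le_of_eq ?_); ring
    · intro y hy
      have h := hb ((s * T : ℝ) + y * Complex.I) (by simpa using Set.uIoc_subset_uIcc hy)
      refine h.trans (le_of_eq ?_)
      simp [abs_mul, hs]
  have key : ∀ T : ℝ, (∫ x in (-T)..T, f (x + y1 * Complex.I)) - (∫ x in (-T)..T, f (x + y2 * Complex.I))
      = - Complex.I * (∫ y in y1..y2, f ((1 * T : ℝ) + y * Complex.I)) + Complex.I * (∫ y in y1..y2, f ((-1 * T : ℝ) + y * Complex.I)) := by
    intro T
    have := Complex.integral_boundary_rect_eq_zero_of_differentiableOn f ((-T:ℝ) + y1 * Complex.I) (T + y2 * Complex.I) ?_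
    · simp only [Complex.add_re, Complex.add_im, Complex.mul_re, Complex.mul_im, Complex.ofReal_re, Complex.ofReal_im,
        Complex.I_re, Complex.I_im, mul_zero, mul_one, sub_zero, zero_add, add_zero, smul_eq_mul] at this
      simp only [one_mul, neg_one_mul]
      linear_combination this
    · intro z hz
      rw [Complex.mem_reProdIm] at hz
      apply (hf z _).differentiableWithinAt
      simpa using hz.2
  have l3 := (((side 1 (by simp)).const_mul (-Complex.I)).add ((side (-1) (by simp)).const_mul Complex.I))
  have l4 := (l1.sub l2)
  have l5 := l3.congr (fun T => (key T).symm)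
  have := tendsto_nhds_unique l4 l5
  rw [mul_zero, mul_zero, add_zero] at this
  exact sub_eq_zero.1 this

/-! ### the integrand -/

noncomputable def gx (τ ζ : ℝ) (x : ℂ) : ℂ :=
  Complex.exp (Complex.I * Real.pi / τ * x * (ζ - Complex.I * (1 + τ) / 2)
    + ell τ (x - ζ) - ell τ (x + Complex.I * (1 + τ) / 2))

noncomputable def Kc (τ ζ : ℝ) : ℂ := Complex.I * Real.pi / (2 * τ) * ((ζ:ℂ)^2 + (1 + τ)^2/4)

lemma im1 (ζ : ℝ) (x : ℂ) : (x - ζ).im = x.im := by simp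
lemma im2 (τ : ℝ) (x : ℂ) : (x + Complex.I * (1 + τ) / 2).im = x.im + (1 + τ)/2 := by
  rw [show Complex.I * (1 + τ) / 2 = (((1+τ)/2 : ℝ) : ℂ) * Complex.I by push_cast; ring]
  simp
lemma re2 (τ : ℝ) (x : ℂ) : (x + Complex.I * (1 + τ) / 2).re = x.re := by
  rw [show Complex.I * (1 + τ) / 2 = (((1+τ)/2 : ℝ) : ℂ) * Complex.I by push_cast; ring]
  simp

lemma diff_gx {τ ζ : ℝ} (hτ : 0 < τ) {x : ℂ} (h1 : -(1/2) < x.im) (h2 : x.im < -τ/2) :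
    DifferentiableAt ℂ (gx τ ζ) x := by
  unfold gx
  have a1 : DifferentiableAt ℂ (fun x : ℂ => ell τ (x - ζ)) x := by
    have := diff_ell hτ (v := x - ζ) (by rw [im1, abs_lt]; constructor <;> linarith)
    exact DifferentiableAt.comp (f := fun x : ℂ => x - ζ) x this (by fun_prop)
  have a2 : DifferentiableAt ℂ (fun x : ℂ => ell τ (x + Complex.I * (1 + τ) / 2)) x := by
    have := diff_ell hτ (v := x + Complex.I * (1 + τ) / 2) (by rw [im2, abs_lt]; constructor <;> linarith)
    exact DifferentiableAt.comp (f := fun x : ℂ => x + Complex.I * (1 + τ) / 2) x this (by fun_prop)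
  fun_prop

lemma gx_eq_pos {τ ζ : ℝ} (hτ : 0 < τ) {x : ℂ} (h1 : -(1/2) < x.im) (h2 : x.im < -τ/2) :
    gx τ ζ x = Complex.exp (2 * Real.pi * Complex.I / τ * x * ζ - Kc τ ζ
      + (Dp τ (x - ζ) - Dp τ (x + Complex.I * (1 + τ) / 2))) := by
  unfold gx Kc
  rw [ell_eq_Dp hτ (v := x - ζ) (by rw [im1, abs_lt]; constructor <;> linarith),
    ell_eq_Dp hτ (v := x + Complex.I * (1 + τ) / 2) (by rw [im2, abs_lt]; constructor <;> linarith)]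
  have ht' : (τ:ℂ) ≠ 0 := by exact_mod_cast hτ.ne'
  congr 1
  field_simp
  linear_combination (96 * Real.pi * Complex.I * (1+τ)^2) * Complex.I_sq

lemma gx_eq_neg {τ ζ : ℝ} (hτ : 0 < τ) {x : ℂ} (h1 : -(1/2) < x.im) (h2 : x.im < -τ/2) :
    gx τ ζ x = Complex.exp (2 * Real.pi * Complex.I / τ * x * (-Complex.I * (1 + τ) / 2) + Kc τ ζ
      - (Dp τ (-(x - ζ)) - Dp τ (-(x + Complex.I * (1 + τ) / 2)))) := by
  unfold gx Kc
  rw [ell_eq_Dp_neg hτ (v := x - ζ) (by rw [im1, abs_lt]; constructor <;> linarith),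
    ell_eq_Dp_neg hτ (v := x + Complex.I * (1 + τ) / 2) (by rw [im2, abs_lt]; constructor <;> linarith)]
  have ht' : (τ:ℂ) ≠ 0 := by exact_mod_cast hτ.ne'
  congr 1
  field_simp
  linear_combination (-96 * Real.pi * Complex.I * (1+τ)^2) * Complex.I_sq

lemma gx_bound {τ : ℝ} (ζ : ℝ) (hτ : 0 < τ) (hτ3 : τ < 1/3) :
    ∃ M, 0 ≤ M ∧ ∀ x : ℂ, |x.im + (1+τ)/4| ≤ τ/2 →
      ‖gx τ ζ x‖ ≤ M * Real.exp (Real.pi * (1+τ)/τ * min x.re 0) := by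
  have hp := Real.pi_pos
  obtain ⟨M1, hM1⟩ := Dp_bound hτ (by linarith) (|ζ|) (ρ := (1+τ)/4 + τ/2) (by linarith)
  refine ⟨Real.exp (2 * Real.pi / τ * |ζ| + ‖Kc τ ζ‖ + 2 * M1), (Real.exp_pos _).le, fun x hx => ?_⟩
  rw [abs_le] at hx
  obtain ⟨hx1, hx2⟩ := hx
  have i1 : -(1/2) < x.im := by linarith
  have i2 : x.im < -τ/2 := by linarith
  rw [← Real.exp_add]
  have hz1 := neg_abs_le ζ
  have hz2 := le_abs_self ζ
  have b1 : |x.im| ≤ (1+τ)/4 + τ/2 := by rw [abs_le]; constructor <;> linarith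
  have b2 : |x.im + (1+τ)/2| ≤ (1+τ)/4 + τ/2 := by rw [abs_le]; constructor <;> linarith
  rcases le_total 0 x.re with h | h
  · rw [gx_eq_pos hτ i1 i2, Complex.norm_exp, Real.exp_le_exp, min_eq_right h]
    have e1 := hM1 (x - ζ) (by simp; linarith) (by rw [im1]; exact b1)
    have e2 := hM1 (x + Complex.I * (1 + τ) / 2) (by rw [re2]; linarith) (by rw [im2]; exact b2)
    have r1 := (abs_le.1 (Complex.abs_re_le_norm (Dp τ (x - ζ)))).2
    have r2 := (abs_le.1 (Complex.abs_re_le_norm (Dp τ (x + Complex.I * (1 + τ) / 2)))).1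
    have r3 := (abs_le.1 (Complex.abs_re_le_norm (Kc τ ζ))).1
    have r4 : (2 * Real.pi * Complex.I / τ * x * ζ).re = 2 * Real.pi / τ * (-x.im * ζ) := by
      rw [show (2 * Real.pi * Complex.I / τ * x * ζ : ℂ) = ((2 * Real.pi / τ : ℝ) : ℂ) * (x * ζ * Complex.I) by push_cast; ring,
        Complex.re_ofReal_mul]
      simp
    have r5 : 2 * Real.pi / τ * (-x.im * ζ) ≤ 2 * Real.pi / τ * |ζ| := by
      gcongr
      calc _ ≤ |-x.im * ζ| := le_abs_self _
        _ = |x.im| * |ζ| := by rw [abs_mul, abs_neg]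
        _ ≤ 1 * |ζ| := by gcongr; linarith
        _ = _ := one_mul _
    simp only [Complex.add_re, Complex.sub_re] at *
    rw [r4]
    linarith
  · rw [gx_eq_neg hτ i1 i2, Complex.norm_exp, Real.exp_le_exp, min_eq_left h]
    have e1 := hM1 (-(x - ζ)) (by simp; linarith) (by rw [Complex.neg_im, abs_neg, im1]; exact b1)
    have e2 := hM1 (-(x + Complex.I * (1 + τ) / 2)) (by rw [Complex.neg_re, re2]; have := abs_nonneg ζ; linarith) (by rw [Complex.neg_im, abs_neg, im2]; exact b2)
    have r1 := (abs_le.1 (Complex.abs_re_le_norm (Dp τ (-(x - ζ))))).1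
    have r2 := (abs_le.1 (Complex.abs_re_le_norm (Dp τ (-(x + Complex.I * (1 + τ) / 2))))).2
    have r3 := (abs_le.1 (Complex.abs_re_le_norm (Kc τ ζ))).2
    have ht' : (τ:ℂ) ≠ 0 := by exact_mod_cast hτ.ne'
    have r4 : (2 * Real.pi * Complex.I / τ * x * (-Complex.I * (1 + τ) / 2)).re = Real.pi * (1+τ) / τ * x.re := by
      rw [show (2 * Real.pi * Complex.I / τ * x * (-Complex.I * (1 + τ) / 2) : ℂ) = ((Real.pi * (1+τ) / τ : ℝ) : ℂ) * x by
        push_cast; field_simp; linear_combination (-(x * (1 + τ))) * Complex.I_sq,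
        Complex.re_ofReal_mul]
    have : 0 ≤ 2 * Real.pi / τ * |ζ| := by positivity
    rw [Complex.sub_re, Complex.add_re, r4, Complex.sub_re]
    linarith

noncomputable def Iw (τ ζ : ℝ) (ω x : ℂ) : ℂ := Complex.exp (2 * Real.pi * Complex.I / τ * x * ω) * gx τ ζ x

noncomputable def Ff (τ ζ : ℝ) (ω : ℂ) : ℂ := ∫ X : ℝ, Iw τ ζ ω (X + (-(1+τ)/4 : ℝ) * Complex.I)

lemma norm_ew {τ : ℝ} (ω x : ℂ) : ‖Complex.exp (2 * Real.pi * Complex.I / τ * x * ω)‖ =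
    Real.exp (2 * Real.pi / τ * (-(x.re * ω.im + x.im * ω.re))) := by
  rw [Complex.norm_exp, show (2 * Real.pi * Complex.I / τ * x * ω : ℂ) = ((2 * Real.pi / τ : ℝ) : ℂ) * (x * ω * Complex.I) by push_cast; ring,
        Complex.re_ofReal_mul]
  simp

/-- Bound uniform over a substrip of `ω`. -/
lemma Iw_bound {τ : ℝ} (ζ : ℝ) (hτ : 0 < τ) (hτ3 : τ < 1/3) {a b : ℝ} (ha : 0 < a) (hb : b < (1+τ)/2) :
    ∃ M d, 0 ≤ M ∧ 0 < d ∧ ∀ x ω : ℂ, |x.im + (1+τ)/4| ≤ τ/2 → a ≤ ω.im → ω.im ≤ b →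
      ‖Iw τ ζ ω x‖ ≤ (M * Real.exp (2 * Real.pi / τ * (-(x.im * ω.re)))) * Real.exp (-d * |x.re|) := by
  have hp := Real.pi_pos
  obtain ⟨M, hM0, hM⟩ := gx_bound ζ hτ hτ3
  refine ⟨M, 2 * Real.pi / τ * min a ((1+τ)/2 - b), hM0, mul_pos (by positivity) (lt_min ha (by linarith)), fun x ω hx h1 h2 => ?_⟩
  unfold Iw
  rw [norm_mul, norm_ew]
  refine (mul_le_mul_of_nonneg_left (hM x hx) (Real.exp_pos _).le).trans ?_
  rw [mul_left_comm, mul_assoc M, ← Real.exp_add, ← Real.exp_add]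
  apply mul_le_mul_of_nonneg_left _ hM0
  apply Real.exp_le_exp.2
  have e : Real.pi * (1+τ)/τ * min x.re 0 = 2 * Real.pi / τ * ((1+τ)/2 * min x.re 0) := by ring
  have e2 : 2 * Real.pi / τ * (-(x.im * ω.re)) + -(2 * Real.pi / τ * min a ((1+τ)/2 - b)) * |x.re|
      = 2 * Real.pi / τ * (-(x.im * ω.re) - min a ((1+τ)/2 - b) * |x.re|) := by ring
  rw [e, e2, ← mul_add]
  apply mul_le_mul_of_nonneg_left _ (by positivity : 0 ≤ 2 * Real.pi / τ)
  have m1 := min_le_left a ((1+τ)/2 - b)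
  have m2 := min_le_right a ((1+τ)/2 - b)
  rcases le_total 0 x.re with h | h
  · rw [min_eq_right h, abs_of_nonneg h]
    nlinarith
  · rw [min_eq_left h, abs_of_nonpos h]
    nlinarith

lemma diff_Iw {τ ζ : ℝ} (ω : ℂ) (hτ : 0 < τ) {x : ℂ} (h1 : -(1/2) < x.im) (h2 : x.im < -τ/2) :
    DifferentiableAt ℂ (Iw τ ζ ω) x := by
  unfold Iw
  have := diff_gx (ζ := ζ) hτ h1 h2
  fun_prop

lemma Ff_shift {τ : ℝ} (ζ : ℝ) (hτ : 0 < τ) (hτ3 : τ < 1/3) {ω : ℂ} (h1 : 0 < ω.im) (h2 : ω.im < (1+τ)/2)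
    {y : ℝ} (hy : |y + (1+τ)/4| ≤ τ/2) : ∫ X : ℝ, Iw τ ζ ω (X + y * Complex.I) = Ff τ ζ ω := by
  obtain ⟨M, d, hM, hd, hB⟩ := Iw_bound ζ hτ hτ3 h1 h2
  have hmem : ∀ z : ℂ, z.im ∈ Set.uIcc y (-(1+τ)/4) → |z.im + (1+τ)/4| ≤ τ/2 := by
    intro z hz
    rw [abs_le] at *
    rw [Set.mem_uIcc] at hz
    constructor <;> rcases hz with hz | hz <;> linarith
  refine shift_contour (M := M * Real.exp (2 * Real.pi / τ * |ω.re|)) hd ?_ ?_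
  · intro z hz
    have := abs_le.1 (hmem z hz)
    exact diff_Iw ω hτ (by linarith) (by linarith)
  · intro z hz
    refine (hB z ω (hmem z hz) le_rfl le_rfl).trans ?_
    have hp := Real.pi_pos
    gcongr
    have := abs_le.1 (hmem z hz)
    have h3 : |z.im| ≤ 1 := by rw [abs_le]; constructor <;> linarith
    calc _ ≤ |-(z.im * ω.re)| := le_abs_self _
      _ = |z.im| * |ω.re| := by rw [abs_neg, abs_mul]
      _ ≤ 1 * |ω.re| := by gcongr
      _ = _ := one_mul _

lemma Iw_integrable {τ : ℝ} (ζ : ℝ) (hτ : 0 < τ) (hτ3 : τ < 1/3) {ω : ℂ} (h1 : 0 < ω.im) (h2 : ω.im < (1+τ)/2)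
    {y : ℝ} (hy : |y + (1+τ)/4| ≤ τ/2) : Integrable (fun X : ℝ => Iw τ ζ ω (X + y * Complex.I)) := by
  obtain ⟨M, d, hM, hd, hB⟩ := Iw_bound ζ hτ hτ3 h1 h2
  have hy' := abs_le.1 hy
  have hc : Continuous (fun x : ℝ => Iw τ ζ ω (x + y * Complex.I)) := by
    rw [continuous_iff_continuousAt]
    intro x
    have := (diff_Iw (ζ := ζ) ω hτ (x := x + y * Complex.I) (by simp; linarith) (by simp; linarith)).continuousAt
    exact ContinuousAt.comp (f := fun x : ℝ => (x + y * Complex.I : ℂ)) this (by fun_prop)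
  refine Integrable.mono' ((exp_neg_abs_integrable hd).const_mul (M * Real.exp (2 * Real.pi / τ * (-(y * ω.re))))) hc.aestronglyMeasurable ?_
  filter_upwards with x
  simpa using hB (x + y * Complex.I) ω (by simpa using hy) le_rfl le_rfl

lemma Iw_shift_minus {τ : ℝ} (ζ : ℝ) (hτ : 0 < τ) (ω x : ℂ) :
    Iw τ ζ (ω - Complex.I * τ / 2) x = Complex.exp (Real.pi * x) * Iw τ ζ ω x := by
  have ht' : (τ:ℂ) ≠ 0 := by exact_mod_cast hτ.ne'
  unfold Iw
  rw [← mul_assoc, ← Complex.exp_add]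
  congr 2
  field_simp
  linear_combination (-(x * τ)) * Complex.I_sq

lemma Iw_shift_plus {τ : ℝ} (ζ : ℝ) (hτ : 0 < τ) (ω x : ℂ) :
    Iw τ ζ (ω + Complex.I * τ / 2) x = Complex.exp (-(Real.pi * x)) * Iw τ ζ ω x := by
  have ht' : (τ:ℂ) ≠ 0 := by exact_mod_cast hτ.ne'
  unfold Iw
  rw [← mul_assoc, ← Complex.exp_add]
  congr 2
  field_simp
  linear_combination (x * τ) * Complex.I_sq

lemma two_cosh (z : ℂ) : 2 * Complex.cosh z = Complex.exp z + Complex.exp (-z) := by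
  rw [Complex.cosh]; ring

lemma exp_I_half : Complex.exp (Real.pi * Complex.I / 2) = Complex.I := by
  rw [show (Real.pi * Complex.I / 2 : ℂ) = Real.pi / 2 * Complex.I by ring]; exact Complex.exp_pi_div_two_mul_I

lemma exp_neg_I_half : Complex.exp (-(Real.pi * Complex.I / 2)) = -Complex.I := by
  rw [Complex.exp_neg, exp_I_half, Complex.inv_I]

lemma I_mul_exp (z : ℂ) : Complex.I * Complex.exp z = Complex.exp (Real.pi * Complex.I / 2 + z) := by
  rw [Complex.exp_add, exp_I_half]

lemma negI_mul_exp (z : ℂ) : -Complex.I * Complex.exp z = Complex.exp (-(Real.pi * Complex.I / 2) + z) := by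
  rw [Complex.exp_add, exp_neg_I_half]

/-- Pointwise relation from the functional equation of `ell`. -/
lemma Iw_FE {τ : ℝ} (ζ : ℝ) (hτ : 0 < τ) (hτ3 : τ < 1/3) (ω y : ℂ) (hy : y.im = -(1+τ)/4) :
    Iw τ ζ ω (y + Complex.I * τ / 2) * (2 * Complex.cosh (Real.pi * (y + Complex.I * (1 + τ) / 2)))
    = Complex.exp (-Real.pi * (ζ - Complex.I * (1 + τ) / 2 + 2 * ω)) *
      (2 * Complex.cosh (Real.pi * (y - ζ))) * Iw τ ζ ω (y - Complex.I * τ / 2) := by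
  have ht' : (τ:ℂ) ≠ 0 := by exact_mod_cast hτ.ne'
  have v1 : |(y - ζ).im| + τ/2 < 1/2 := by
    rw [im1, hy, abs_of_nonpos (by linarith)]; linarith
  have v2 : |(y + Complex.I * (1 + τ) / 2).im| + τ/2 < 1/2 := by
    rw [im2, hy, abs_of_nonneg (by linarith)]; linarith
  have f1 := ell_FE hτ v1
  have f2 := ell_FE hτ v2
  have g1 := exp_Lam (v := y - ζ) (by linarith)
  have g2 := exp_Lam (v := y + Complex.I * (1 + τ) / 2) (by linarith)
  rw [← g1, ← g2, ← f1, ← f2]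
  unfold Iw gx
  simp only [← Complex.exp_add]
  rw [show y - ζ + Complex.I * τ / 2 = y + Complex.I * τ / 2 - ζ by ring,
    show y - ζ - Complex.I * τ / 2 = y - Complex.I * τ / 2 - ζ by ring,
    show y + Complex.I * (1 + τ) / 2 + Complex.I * τ / 2 = y + Complex.I * τ / 2 + Complex.I * (1 + τ) / 2 by ring,
    show y + Complex.I * (1 + τ) / 2 - Complex.I * τ / 2 = y - Complex.I * τ / 2 + Complex.I * (1 + τ) / 2 by ring]
  congr 1
  field_simp
  linear_combination (Real.pi * τ * (8 * ω + 4 * ζ) - 2 * Real.pi * Complex.I * τ * (1 + τ)) * Complex.I_sq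

lemma Iw_FE2 {τ : ℝ} (ζ : ℝ) (hτ : 0 < τ) (hτ3 : τ < 1/3) (ω y : ℂ) (hy : y.im = -(1+τ)/4) :
    Iw τ ζ (ω - Complex.I * τ / 2) (y + Complex.I * τ / 2) - Iw τ ζ (ω + Complex.I * τ / 2) (y + Complex.I * τ / 2)
    = Complex.exp (-2 * Real.pi * (ω + ζ) + Complex.I * Real.pi * τ) * Iw τ ζ (ω - Complex.I * τ / 2) (y - Complex.I * τ / 2)
      + Complex.exp (-2 * Real.pi * ω) * Iw τ ζ (ω + Complex.I * τ / 2) (y - Complex.I * τ / 2) := by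
  have h := Iw_FE ζ hτ hτ3 ω y hy
  rw [two_cosh, two_cosh] at h
  simp only [Iw_shift_minus ζ hτ, Iw_shift_plus ζ hτ]
  have e1 : Complex.exp (Real.pi * (y + Complex.I * (1 + τ) / 2)) = Complex.I * Complex.exp (Real.pi * (y + Complex.I * τ / 2)) := by
    rw [I_mul_exp]; congr 1; ring
  have e2 : Complex.exp (-(Real.pi * (y + Complex.I * (1 + τ) / 2))) = -Complex.I * Complex.exp (-(Real.pi * (y + Complex.I * τ / 2))) := by
    rw [negI_mul_exp]; congr 1; ring
  have e3 : Complex.exp (-Real.pi * (ζ - Complex.I * (1 + τ) / 2 + 2 * ω)) * Complex.exp (Real.pi * (y - ζ))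
      = Complex.I * (Complex.exp (-2 * Real.pi * (ω + ζ) + Complex.I * Real.pi * τ) * Complex.exp (Real.pi * (y - Complex.I * τ / 2))) := by
    rw [← Complex.exp_add, ← Complex.exp_add, I_mul_exp]; congr 1; ring
  have e4 : Complex.exp (-Real.pi * (ζ - Complex.I * (1 + τ) / 2 + 2 * ω)) * Complex.exp (-(Real.pi * (y - ζ)))
      = Complex.I * (Complex.exp (-2 * Real.pi * ω) * Complex.exp (-(Real.pi * (y - Complex.I * τ / 2)))) := by
    rw [← Complex.exp_add, ← Complex.exp_add, I_mul_exp]; congr 1; ring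
  rw [e1, e2] at h
  apply mul_left_cancel₀ Complex.I_ne_zero
  linear_combination h + Iw τ ζ ω (y - Complex.I * τ / 2) * e3 + Iw τ ζ ω (y - Complex.I * τ / 2) * e4

lemma Ff_diff_eq {τ : ℝ} (ζ : ℝ) (hτ : 0 < τ) (hτ3 : τ < 1/3) {ω : ℂ} (h1 : τ/2 < ω.im) (h2 : ω.im < 1/2) :
    Ff τ ζ (ω - Complex.I * τ / 2) * (1 - Complex.exp (-2 * Real.pi * (ω + ζ) + Complex.I * Real.pi * τ))
    = Ff τ ζ (ω + Complex.I * τ / 2) * (1 + Complex.exp (-2 * Real.pi * ω)) := by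
  have im3 : (ω - Complex.I * τ / 2).im = ω.im - τ/2 := by
    rw [show Complex.I * τ / 2 = ((τ/2 : ℝ) : ℂ) * Complex.I by push_cast; ring]; simp
  have im4 : (ω + Complex.I * τ / 2).im = ω.im + τ/2 := by
    rw [show Complex.I * τ / 2 = ((τ/2 : ℝ) : ℂ) * Complex.I by push_cast; ring]; simp
  set yp : ℝ := -(1+τ)/4 + τ/2 with hyp
  set ym : ℝ := -(1+τ)/4 - τ/2 with hym
  have kp : |yp + (1+τ)/4| ≤ τ/2 := by rw [hyp, abs_le]; constructor <;> linarith
  have km : |ym + (1+τ)/4| ≤ τ/2 := by rw [hym, abs_le]; constructor <;> linarith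
  have a1 : 0 < (ω - Complex.I * τ / 2).im := by rw [im3]; linarith
  have a2 : (ω - Complex.I * τ / 2).im < (1+τ)/2 := by rw [im3]; linarith
  have a3 : 0 < (ω + Complex.I * τ / 2).im := by rw [im4]; linarith
  have a4 : (ω + Complex.I * τ / 2).im < (1+τ)/2 := by rw [im4]; linarith
  have e : ∀ X : ℝ, Iw τ ζ (ω - Complex.I * τ / 2) (X + yp * Complex.I) - Iw τ ζ (ω + Complex.I * τ / 2) (X + yp * Complex.I)
    = Complex.exp (-2 * Real.pi * (ω + ζ) + Complex.I * Real.pi * τ) * Iw τ ζ (ω - Complex.I * τ / 2) (X + ym * Complex.I)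
      + Complex.exp (-2 * Real.pi * ω) * Iw τ ζ (ω + Complex.I * τ / 2) (X + ym * Complex.I) := by
    intro X
    have := Iw_FE2 ζ hτ hτ3 ω (X + (-(1+τ)/4 : ℝ) * Complex.I) (by simp)
    rw [show (X + (-(1+τ)/4 : ℝ) * Complex.I + Complex.I * τ / 2 : ℂ) = X + yp * Complex.I by rw [hyp]; push_cast; ring,
      show (X + (-(1+τ)/4 : ℝ) * Complex.I - Complex.I * τ / 2 : ℂ) = X + ym * Complex.I by rw [hym]; push_cast; ring] at this
    exact this
  have e' := congrArg (fun f : ℝ → ℂ => ∫ X, f X) (funext e)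
  rw [integral_sub (Iw_integrable ζ hτ hτ3 a1 a2 kp) (Iw_integrable ζ hτ hτ3 a3 a4 kp),
    integral_add ((Iw_integrable ζ hτ hτ3 a1 a2 km).const_mul _) ((Iw_integrable ζ hτ hτ3 a3 a4 km).const_mul _),
    integral_const_mul, integral_const_mul, Ff_shift ζ hτ hτ3 a1 a2 kp, Ff_shift ζ hτ hτ3 a3 a4 kp,
    Ff_shift ζ hτ hτ3 a1 a2 km, Ff_shift ζ hτ hτ3 a3 a4 km] at e'
  linear_combination e'

lemma Ff_norm {τ : ℝ} (ζ : ℝ) (hτ : 0 < τ) (hτ3 : τ < 1/3) {a b : ℝ} (ha : 0 < a) (hb : b < (1+τ)/2) :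
    ∃ M, 0 ≤ M ∧ ∀ ω : ℂ, a ≤ ω.im → ω.im ≤ b → ‖Ff τ ζ ω‖ ≤ M * Real.exp (Real.pi * (1 + τ) / (2 * τ) * ω.re) := by
  obtain ⟨M, d, hM, hd, hB⟩ := Iw_bound ζ hτ hτ3 ha hb
  refine ⟨M * ∫ X : ℝ, Real.exp (-d * |X|), mul_nonneg hM (integral_nonneg fun _ => (Real.exp_pos _).le), fun ω h1 h2 => ?_⟩
  unfold Ff
  refine (norm_integral_le_of_norm_le ((exp_neg_abs_integrable hd).const_mul (M * Real.exp (Real.pi * (1 + τ) / (2 * τ) * ω.re))) ?_).trans ?_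
  · filter_upwards with X
    have hk : |(X + (-(1+τ)/4 : ℝ) * Complex.I : ℂ).im + (1+τ)/4| ≤ τ/2 := by
      simp only [Complex.add_im, Complex.mul_im, Complex.ofReal_re, Complex.ofReal_im, Complex.I_re, Complex.I_im, mul_zero, mul_one, zero_add, add_zero]
      rw [show -(1 + τ) / 4 + (1 + τ) / 4 = 0 by ring]; simp; linarith
    have := hB (X + (-(1+τ)/4 : ℝ) * Complex.I) ω hk h1 h2
    refine this.trans (le_of_eq ?_)
    simp only [Complex.add_re, Complex.add_im, Complex.mul_re, Complex.mul_im, Complex.ofReal_re, Complex.ofReal_im,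
        Complex.I_re, Complex.I_im, mul_zero, mul_one, sub_zero, zero_add, add_zero]
    congr 3
    field_simp
    ring
  · rw [integral_const_mul]
    apply le_of_eq; ring

lemma Ff_diff {τ : ℝ} (ζ : ℝ) (hτ : 0 < τ) (hτ3 : τ < 1/3) {ω : ℂ} (h1 : 0 < ω.im) (h2 : ω.im < (1+τ)/2) :
    DifferentiableAt ℂ (Ff τ ζ) ω := by
  set r := min (ω.im/2) (((1+τ)/2 - ω.im)/2) with hr
  have hr0 : 0 < r := lt_min (by linarith) (by linarith)
  have hr1 : r ≤ ω.im/2 := min_le_left _ _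
  have hr2 : r ≤ ((1+τ)/2 - ω.im)/2 := min_le_right _ _
  obtain ⟨M, d, hM, hd, hB⟩ := Iw_bound ζ hτ hτ3 (a := ω.im - r) (b := ω.im + r) (by linarith) (by linarith)
  have hk : |(-(1+τ)/4 : ℝ) + (1+τ)/4| ≤ τ/2 := by
    rw [show -(1 + τ) / 4 + (1 + τ) / 4 = 0 by ring]; simp; linarith
  have him : ∀ z ∈ Metric.ball ω r, ω.im - r ≤ z.im ∧ z.im ≤ ω.im + r ∧ |z.re| ≤ |ω.re| + r := by
    intro z hz
    rw [Metric.mem_ball, dist_eq_norm] at hz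
    have a1 := abs_le.1 (Complex.abs_im_le_norm (z - ω))
    have a2 := Complex.abs_re_le_norm (z - ω)
    simp at a1 a2
    have := abs_sub_abs_le_abs_sub z.re ω.re
    refine ⟨by linarith, by linarith, by linarith⟩
  have hω : ω ∈ Metric.ball ω r := Metric.mem_ball_self hr0
  have hp := Real.pi_pos
  set px : ℝ → ℂ := fun X => X + (-(1+τ)/4 : ℝ) * Complex.I with hpx
  have pre : ∀ X, (px X).re = X := by intro X; simp [hpx]
  have pim : ∀ X, (px X).im = -(1+τ)/4 := by intro X; simp [hpx]
  have hder := hasDerivAt_integral_of_dominated_loc_of_deriv_le (𝕜 := ℂ) (μ := (volume : Measure ℝ))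
    (F := fun z X => Iw τ ζ z (px X))
    (F' := fun z X => 2 * Real.pi * Complex.I / τ * px X * Iw τ ζ z (px X)) (x₀ := ω) (s := Metric.ball ω r)
    (bound := fun X => 2 * Real.pi / τ * (1 + 2/d) * (M * Real.exp (2 * Real.pi / τ * (|ω.re| + r))) * Real.exp (-(d/2) * |X|))
    (Metric.ball_mem_nhds ω hr0) ?_ ?_ ?_ ?_ ?_ ?_
  · exact hder.2.differentiableAt
  · filter_upwards [Metric.ball_mem_nhds ω hr0] with z hz
    obtain ⟨c1, c2, -⟩ := him z hz
    exact (Iw_integrable ζ hτ hτ3 (by linarith) (by linarith) hk).aestronglyMeasurable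
  · exact Iw_integrable ζ hτ hτ3 h1 h2 hk
  · refine AEStronglyMeasurable.mul ?_ (Iw_integrable ζ hτ hτ3 h1 h2 hk).aestronglyMeasurable
    refine Continuous.aestronglyMeasurable ?_
    rw [hpx]
    fun_prop
  · filter_upwards with X z hz
    obtain ⟨c1, c2, c3⟩ := him z hz
    have b1 := hB (px X) z (by rw [pim]; exact hk) c1 c2
    rw [pre, pim] at b1
    have b2 : ‖2 * Real.pi * Complex.I / τ * px X‖ ≤ 2 * Real.pi / τ * ((1 + 2/d) * Real.exp (d/2 * |X|)) := by
      rw [norm_mul]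
      have : ‖(2 * Real.pi * Complex.I / τ : ℂ)‖ = 2 * Real.pi / τ := by
        simp [abs_of_pos hp, abs_of_pos hτ]
      rw [this]
      gcongr
      have n1 := Complex.norm_le_abs_re_add_abs_im (px X)
      rw [pre, pim] at n1
      have n2 : |-(1+τ)/4| ≤ 1 := by rw [abs_le]; constructor <;> linarith
      have n3 := Real.add_one_le_exp (d/2 * |X|)
      have n4 := Real.one_le_exp (x := d/2 * |X|) (by positivity)
      have n5 : |X| ≤ 2/d * Real.exp (d/2 * |X|) := by
        calc |X| = 2/d * (d/2 * |X|) := by field_simp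
          _ ≤ _ := by gcongr; linarith
      linarith
    rw [norm_mul]
    have b3 : Real.exp (2 * Real.pi / τ * (-(-(1+τ)/4 * z.re))) ≤ Real.exp (2 * Real.pi / τ * (|ω.re| + r)) := by
      gcongr
      have := le_abs_self z.re
      have := abs_nonneg z.re
      nlinarith
    calc _ ≤ (2 * Real.pi / τ * ((1 + 2/d) * Real.exp (d/2 * |X|))) * ((M * Real.exp (2 * Real.pi / τ * (|ω.re| + r))) * Real.exp (-d * |X|)) := by
          gcongr
          refine b1.trans ?_
          gcongr
      _ = 2 * Real.pi / τ * (1 + 2/d) * (M * Real.exp (2 * Real.pi / τ * (|ω.re| + r))) * (Real.exp (d/2 * |X|) * Real.exp (-d * |X|)) := by ring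
      _ = _ := by rw [← Real.exp_add]; congr 2; ring
  · exact (exp_neg_abs_integrable (by positivity : 0 < d/2)).const_mul _
  · filter_upwards with X z hz
    unfold Iw
    have : HasDerivAt (fun z : ℂ => 2 * Real.pi * Complex.I / τ * px X * z) (2 * Real.pi * Complex.I / τ * px X) z := by
      simpa using (hasDerivAt_id z).const_mul (2 * Real.pi * Complex.I / τ * px X)
    refine (this.cexp.mul_const (gx τ ζ (px X))).congr_deriv ?_
    ring

lemma exp_quot_bound {p a M N r T : ℝ} (hM : 0 ≤ M) (hN : 0 ≤ N) (ha : 0 ≤ a)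
    (hT : 0 ≤ T) (hTr : 1 ≤ p * (T - r)) {Q : ℝ} (hQ : Real.exp (p * (T - r)) ≤ Q) {A : ℝ} (hA : A ≤ M * Real.exp (a * T) + N) :
    A / (Q - 1) ≤ 2 * (M + N) * Real.exp (p * r) * Real.exp (-(p - a) * |T|) := by
  have h2 : 2 ≤ Real.exp (p * (T - r)) := by
    have := Real.add_one_le_exp (p * (T - r)); linarith
  have hQ1 : Real.exp (p * (T - r)) / 2 ≤ Q - 1 := by linarith
  rw [abs_of_nonneg hT, div_le_iff₀ (by linarith)]
  have h1 : 1 ≤ Real.exp (a * T) := Real.one_le_exp (by positivity)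
  have hA2 : A ≤ (M + N) * Real.exp (a * T) := by nlinarith
  refine hA2.trans ?_
  calc (M + N) * Real.exp (a * T) = 2 * (M + N) * Real.exp (p * r) * Real.exp (-(p - a) * T) * (Real.exp (p * (T - r)) / 2) := by
        rw [show a * T = p * r + -(p - a) * T + p * (T - r) by ring, Real.exp_add, Real.exp_add]; ring
    _ ≤ _ := by gcongr

lemma periodic_const_aux {R : ℂ → ℂ} {c τ M a : ℝ} (hτ : 0 < τ) (hM : 0 ≤ M) (ha : 0 ≤ a) (hap : a < 2 * Real.pi / τ)
    (hR : ∀ z : ℂ, z.im ∈ Set.Icc c (c + τ) → DifferentiableAt ℂ R z)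
    (hper : ∀ x : ℝ, R (x + (c + τ : ℝ) * Complex.I) = R (x + c * Complex.I))
    (hb : ∀ z : ℂ, z.im ∈ Set.Icc c (c + τ) → ‖R z‖ ≤ M * Real.exp (a * |z.re|))
    {w : ℂ} (hw1 : c < w.im) (hw2 : w.im < c + τ) :
    Filter.Tendsto (fun T : ℝ => ∫ y in c..(c+τ), R ((-T:ℝ) + y * Complex.I)) Filter.atTop (nhds (τ * R w)) := by
  have hp := Real.pi_pos
  have ht' : (τ:ℂ) ≠ 0 := by exact_mod_cast hτ.ne'
  have hpi := pi_c_ne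
  set p := 2 * Real.pi / τ with hpdef
  have hp0 : 0 < p := by positivity
  set E : ℂ → ℂ := fun z => Complex.exp (p * (z - w)) - 1 with hE
  have hEd : Differentiable ℂ E := by rw [hE]; fun_prop
  have hEw : E w = 0 := by simp [hE]
  have hE0 : ∀ z : ℂ, z.im ∈ Set.Icc c (c + τ) → z ≠ w → E z ≠ 0 := by
    intro z hz hzw h0
    rw [hE] at h0
    simp only [sub_eq_zero] at h0
    rw [Complex.exp_eq_one_iff] at h0
    obtain ⟨n, hn⟩ := h0
    have hn2 : z - w = ((n * τ : ℝ) : ℂ) * Complex.I := by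
      rw [hpdef] at hn
      push_cast at hn ⊢
      field_simp at hn
      linear_combination hn
    have him := congrArg Complex.im hn2
    simp at him
    have hlt : |(n:ℝ)| < 1 := by
      have : |(n:ℝ) * τ| < 1 * τ := by
        rw [← him, abs_lt]
        constructor <;> linarith [hz.1, hz.2]
      rw [abs_mul, abs_of_pos hτ] at this
      exact lt_of_mul_lt_mul_right this hτ.le
    have hn0 : n = 0 := by
      have : |n| < 1 := by exact_mod_cast hlt
      exact Int.abs_lt_one_iff.1 this
    rw [hn0] at hn2
    simp [sub_eq_zero] at hn2
    exact hzw hn2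
  set W : Set ℂ := {z | z.im ∈ Set.Icc c (c + τ)} with hW
  have hWn : W ∈ nhds w := by
    have : Complex.im ⁻¹' (Set.Ioo c (c+τ)) ∈ nhds w :=
      (isOpen_Ioo.preimage Complex.continuous_im).mem_nhds ⟨hw1, hw2⟩
    exact Filter.mem_of_superset this (fun z hz => ⟨hz.1.le, hz.2.le⟩)
  have d1 : DifferentiableOn ℂ (dslope R w) W :=
    (Complex.differentiableOn_dslope hWn).2 fun z hz => (hR z hz).differentiableWithinAt
  have d2 : DifferentiableOn ℂ (dslope E w) W :=
    (Complex.differentiableOn_dslope hWn).2 hEd.differentiableOn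
  have dE : deriv E w = p := by
    have h1 : HasDerivAt (fun z : ℂ => (p:ℂ) * (z - w)) p w := by
      simpa using ((hasDerivAt_id w).sub_const w).const_mul (p:ℂ)
    have h2 := (h1.cexp.sub_const 1).deriv
    rw [hE]
    rw [h2]; simp
  have hne : ∀ z ∈ W, dslope E w z ≠ 0 := by
    intro z hz
    by_cases hzw : z = w
    · rw [hzw, dslope_same, dE]
      exact_mod_cast hp0.ne'
    · rw [dslope_of_ne _ hzw, slope_def_field, hEw, sub_zero]
      exact div_ne_zero (hE0 z hz hzw) (sub_ne_zero.2 hzw)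
  set h : ℂ → ℂ := fun z => dslope R w z / dslope E w z with hh
  have hval : ∀ z, z ≠ w → h z = (R z - R w) / E z := by
    intro z hzw
    rw [hh]
    simp only
    rw [dslope_of_ne _ hzw, dslope_of_ne _ hzw, slope_def_field, slope_def_field, hEw, sub_zero,
      div_div_div_cancel_right₀ (sub_ne_zero.2 hzw)]
  have hdiff : DifferentiableOn ℂ h W := d1.div d2 hne
  have hhper : ∀ x : ℝ, h (x + (c + τ : ℝ) * Complex.I) = h (x + c * Complex.I) := by
    intro x
    rw [hval _ (by intro h0; have := congrArg Complex.im h0; simp at this; linarith),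
      hval _ (by intro h0; have := congrArg Complex.im h0; simp at this; linarith), hper]
    congr 1
    rw [hE]
    simp only
    congr 1
    rw [show (p:ℂ) * (x + (c + τ : ℝ) * Complex.I - w) = p * (x + c * Complex.I - w) + 2 * Real.pi * Complex.I by
      rw [hpdef]; push_cast; field_simp; ring, Complex.exp_periodic]
  have rect : ∀ T : ℝ, (∫ y in c..(c+τ), h ((T:ℝ) + y * Complex.I)) = ∫ y in c..(c+τ), h ((-T:ℝ) + y * Complex.I) := by
    intro T
    have := Complex.integral_boundary_rect_eq_zero_of_differentiableOn h ((-T:ℝ) + c * Complex.I) (T + (c + τ : ℝ) * Complex.I) ?_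
    · simp only [Complex.add_re, Complex.add_im, Complex.mul_re, Complex.mul_im, Complex.ofReal_re, Complex.ofReal_im,
        Complex.I_re, Complex.I_im, mul_zero, mul_one, sub_zero, zero_add, add_zero, smul_eq_mul, hhper, sub_self] at this
      apply mul_left_cancel₀ Complex.I_ne_zero
      linear_combination this
    · refine hdiff.mono fun z hz => ?_
      rw [Complex.mem_reProdIm] at hz
      have := hz.2
      simp at this
      rwa [Set.uIcc_of_le (by linarith)] at this
  set r := |w.re| with hr
  set D := 2 * (M + ‖R w‖) * Real.exp (p * r) with hD
  have hcl : c ≤ c + τ := by linarith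
  have uio : ∀ y ∈ Set.uIoc c (c+τ), y ∈ Set.Icc c (c+τ) := by
    intro y hy
    rw [Set.uIoc_of_le hcl] at hy
    exact ⟨hy.1.le, hy.2⟩
  have nq : ∀ x y : ℝ, ‖Complex.exp (p * ((x:ℂ) + y * Complex.I - w))‖ = Real.exp (p * (x - w.re)) := by
    intro x y
    rw [Complex.norm_exp, Complex.re_ofReal_mul]
    simp
  have hwre := abs_le.1 (le_refl |w.re|)
  have bigT : ∀ T : ℝ, r + 1/p ≤ T → 0 ≤ T ∧ 1 ≤ p * (T - r) ∧ r < T := by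
    intro T hT
    have h1 : 0 < 1/p := by positivity
    have h0 : 0 ≤ r := abs_nonneg _
    refine ⟨by linarith, ?_, by linarith⟩
    calc 1 = p * (1/p) := by field_simp
      _ ≤ _ := by gcongr; linarith
  have right : Filter.Tendsto (fun T : ℝ => ∫ y in c..(c+τ), h ((T:ℝ) + y * Complex.I)) Filter.atTop (nhds 0) := by
    refine squeeze_zero_norm' (a := fun T => (D * |c + τ - c|) * Real.exp (-(p - a) * |T|)) ?_ (exp_neg_abs_tendsto_top (by linarith) _)
    filter_upwards [Filter.eventually_ge_atTop (r + 1/p)] with T hT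
    obtain ⟨t1, t2, t3⟩ := bigT T hT
    have := intervalIntegral.norm_integral_le_of_norm_le_const (a := c) (b := c+τ) (f := fun y : ℝ => h ((T:ℝ) + y * Complex.I)) (C := D * Real.exp (-(p - a) * |T|)) ?_
    · refine this.trans (le_of_eq ?_); ring
    · intro y hy
      have hzw : (T:ℂ) + y * Complex.I ≠ w := by
        intro h0; have := congrArg Complex.re h0; simp at this; linarith
      rw [hval _ hzw, norm_div]
      have q1 : Real.exp (p * (T - r)) ≤ ‖Complex.exp (p * ((T:ℂ) + y * Complex.I - w))‖ := by
        rw [nq]; gcongr; linarith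
      have q2 : ‖Complex.exp (p * ((T:ℂ) + y * Complex.I - w))‖ - 1 ≤ ‖E ((T:ℂ) + y * Complex.I)‖ := by
        have := norm_sub_norm_le (Complex.exp (p * ((T:ℂ) + y * Complex.I - w))) 1
        rwa [norm_one] at this
      have q3 : ‖R ((T:ℂ) + y * Complex.I) - R w‖ ≤ M * Real.exp (a * T) + ‖R w‖ := by
        refine (norm_sub_le _ _).trans ?_
        have := hb ((T:ℂ) + y * Complex.I) (by simpa using uio y hy)
        simp only [Complex.add_re, Complex.mul_re, Complex.ofReal_re, Complex.ofReal_im, Complex.I_re, Complex.I_im, mul_zero, mul_one, sub_zero, add_zero, abs_of_nonneg t1] at this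
        linarith
      refine le_trans ?_ (exp_quot_bound hM (norm_nonneg (R w)) ha t1 t2 q1 q3)
      have := Real.add_one_le_exp (p * (T - r))
      apply div_le_div_of_nonneg_left (norm_nonneg _) (by linarith) q2
  have left : Filter.Tendsto (fun T : ℝ => ∫ y in c..(c+τ), (h ((-T:ℝ) + y * Complex.I) + (R ((-T:ℝ) + y * Complex.I) - R w))) Filter.atTop (nhds 0) := by
    refine squeeze_zero_norm' (a := fun T => (D * |c + τ - c|) * Real.exp (-(p - a) * |T|)) ?_ (exp_neg_abs_tendsto_top (by linarith) _)
    filter_upwards [Filter.eventually_ge_atTop (r + 1/p)] with T hT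
    obtain ⟨t1, t2, t3⟩ := bigT T hT
    have := intervalIntegral.norm_integral_le_of_norm_le_const (a := c) (b := c+τ) (f := fun y : ℝ => (h ((-T:ℝ) + y * Complex.I) + (R ((-T:ℝ) + y * Complex.I) - R w))) (C := D * Real.exp (-(p - a) * |T|)) ?_
    · refine this.trans (le_of_eq ?_); ring
    · intro y hy
      have hzw : ((-T:ℝ):ℂ) + y * Complex.I ≠ w := by
        intro h0; have := congrArg Complex.re h0; simp at this; linarith
      rw [hval _ hzw]
      have hE1 := hE0 _ (by simpa using uio y hy) hzw
      set q := Complex.exp (p * (((-T:ℝ):ℂ) + y * Complex.I - w)) with hq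
      have hq0 : q ≠ 0 := Complex.exp_ne_zero _
      have hEq : E (((-T:ℝ):ℂ) + y * Complex.I) = q - 1 := rfl
      have e : (R (((-T:ℝ):ℂ) + y * Complex.I) - R w) / E (((-T:ℝ):ℂ) + y * Complex.I) + (R (((-T:ℝ):ℂ) + y * Complex.I) - R w)
          = (R (((-T:ℝ):ℂ) + y * Complex.I) - R w) / (1 - q⁻¹) := by
        rw [hEq] at hE1 ⊢
        have : 1 - q⁻¹ ≠ 0 := by
          intro h0; apply hE1
          field_simp at h0; simpa using h0
        field_simp
        ring
      rw [e, norm_div]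
      have q1 : Real.exp (p * (T - r)) ≤ ‖q⁻¹‖ := by
        rw [norm_inv, hq, nq, ← Real.exp_neg, ← mul_neg]; gcongr; linarith
      have q2 : ‖q⁻¹‖ - 1 ≤ ‖1 - q⁻¹‖ := by
        have := norm_sub_norm_le (q⁻¹) 1
        rwa [norm_one, norm_sub_rev] at this
      have q3 : ‖R (((-T:ℝ):ℂ) + y * Complex.I) - R w‖ ≤ M * Real.exp (a * T) + ‖R w‖ := by
        refine (norm_sub_le _ _).trans ?_
        have := hb (((-T:ℝ):ℂ) + y * Complex.I) (by simpa using uio y hy)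
        simp only [Complex.add_re, Complex.mul_re, Complex.ofReal_re, Complex.ofReal_im, Complex.I_re, Complex.I_im, mul_zero, mul_one, sub_zero, add_zero, abs_neg, abs_of_nonneg t1] at this
        linarith
      refine le_trans ?_ (exp_quot_bound hM (norm_nonneg (R w)) ha t1 t2 q1 q3)
      have := Real.add_one_le_exp (p * (T - r))
      apply div_le_div_of_nonneg_left (norm_nonneg _) (by linarith) q2
  have hci : ∀ (g : ℂ → ℂ), ContinuousOn g W → ∀ T : ℝ, IntervalIntegrable (fun y : ℝ => g ((T:ℂ) + y * Complex.I)) volume c (c+τ) := by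
    intro g hg T
    apply ContinuousOn.intervalIntegrable
    apply hg.comp (by fun_prop)
    intro y hy
    rw [Set.uIcc_of_le hcl] at hy
    simpa [hW] using hy
  have hRc : ContinuousOn R W := fun z hz => (hR z hz).continuousAt.continuousWithinAt
  have fin := (left.sub right).add_const (τ * R w)
  rw [sub_zero, zero_add] at fin
  refine fin.congr fun T => ?_
  rw [rect T, intervalIntegral.integral_add (hci h hdiff.continuousOn (-T)) ((hci R hRc (-T)).sub intervalIntegrable_const),
    intervalIntegral.integral_sub (hci R hRc (-T)) intervalIntegrable_const, intervalIntegral.integral_const]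
  simp only [add_sub_cancel_left, Complex.real_smul]
  ring

lemma periodic_const {R : ℂ → ℂ} {c τ M a : ℝ} (hτ : 0 < τ) (hM : 0 ≤ M) (ha : 0 ≤ a) (hap : a < 2 * Real.pi / τ)
    (hR : ∀ z : ℂ, z.im ∈ Set.Icc c (c + τ) → DifferentiableAt ℂ R z)
    (hper : ∀ x : ℝ, R (x + (c + τ : ℝ) * Complex.I) = R (x + c * Complex.I))
    (hb : ∀ z : ℂ, z.im ∈ Set.Icc c (c + τ) → ‖R z‖ ≤ M * Real.exp (a * |z.re|))
    {w w' : ℂ} (hw1 : c < w.im) (hw2 : w.im < c + τ) (hw1' : c < w'.im) (hw2' : w'.im < c + τ) : R w = R w' := by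
  have := tendsto_nhds_unique (periodic_const_aux hτ hM ha hap hR hper hb hw1 hw2) (periodic_const_aux hτ hM ha hap hR hper hb hw1' hw2')
  have ht' : (τ:ℂ) ≠ 0 := by exact_mod_cast hτ.ne'
  exact mul_left_cancel₀ ht' this

noncomputable def al (τ ζ : ℝ) : ℂ := Real.pi / τ * ((1 + τ)/2 + Complex.I * ζ)
noncomputable def ka (τ ζ : ℝ) : ℂ := ζ - Complex.I * (1 + τ) / 2
noncomputable def rc (τ ζ : ℝ) (ω : ℂ) : ℂ :=
  Complex.exp (-(al τ ζ * ω) - ell τ (ω + ka τ ζ) + ell τ ω)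

lemma ka_im (τ ζ : ℝ) (ω : ℂ) : (ω + ka τ ζ).im = ω.im - (1 + τ)/2 := by
  rw [ka, show Complex.I * (1 + τ) / 2 = (((1+τ)/2 : ℝ) : ℂ) * Complex.I by push_cast; ring]
  simp; ring
lemma ka_re (τ ζ : ℝ) (ω : ℂ) : (ω + ka τ ζ).re = ω.re + ζ := by
  rw [ka, show Complex.I * (1 + τ) / 2 = (((1+τ)/2 : ℝ) : ℂ) * Complex.I by push_cast; ring]
  simp

lemma diff_rc {τ : ℝ} (ζ : ℝ) (hτ : 0 < τ) {ω : ℂ} (h1 : τ/2 < ω.im) (h2 : ω.im < 1/2) :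
    DifferentiableAt ℂ (rc τ ζ) ω := by
  unfold rc
  have a1 : DifferentiableAt ℂ (fun x : ℂ => ell τ (x + ka τ ζ)) ω := by
    have := diff_ell hτ (v := ω + ka τ ζ) (by rw [ka_im, abs_lt]; constructor <;> linarith)
    exact DifferentiableAt.comp (f := fun x : ℂ => x + ka τ ζ) ω this (by fun_prop)
  have a2 : DifferentiableAt ℂ (ell τ) ω := diff_ell hτ (by rw [abs_lt]; constructor <;> linarith)
  fun_prop

lemma rc_bound {τ : ℝ} (ζ : ℝ) (hτ : 0 < τ) (hτ1 : τ ≤ 1) {c1 c2 : ℝ} (hc1 : τ/2 < c1) (hc2 : c2 < 1/2) :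
    ∃ M, 0 ≤ M ∧ ∀ ω : ℂ, c1 ≤ ω.im → ω.im ≤ c2 →
      ‖rc τ ζ ω‖ ≤ M * Real.exp (-(Real.pi * (1+τ)/τ * min ω.re 0)) := by
  have hp := Real.pi_pos
  have ht' : (τ:ℂ) ≠ 0 := by exact_mod_cast hτ.ne'
  obtain ⟨M1, hM1⟩ := Dp_bound hτ hτ1 (|ζ|) (ρ := max c2 ((1+τ)/2 - c1)) (max_lt hc2 (by linarith))
  set K : ℂ := Complex.I * Real.pi / (2 * τ) * (ka τ ζ)^2 with hK
  refine ⟨Real.exp (2 * Real.pi / τ * |ζ| + ‖K‖ + 2 * M1), (Real.exp_pos _).le, fun ω h1 h2 => ?_⟩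
  rw [← Real.exp_add]
  have hz1 := neg_abs_le ζ
  have hz2 := le_abs_self ζ
  have hz0 := abs_nonneg ζ
  have b1 : |ω.im| ≤ max c2 ((1+τ)/2 - c1) := by
    refine le_trans ?_ (le_max_left _ _); rw [abs_le]; constructor <;> linarith
  have b2 : |(ω + ka τ ζ).im| ≤ max c2 ((1+τ)/2 - c1) := by
    refine le_trans ?_ (le_max_right _ _); rw [ka_im, abs_le]; constructor <;> linarith
  have l1 : |ω.im| < 1/2 := by rw [abs_lt]; constructor <;> linarith
  have l2 : |(ω + ka τ ζ).im| < 1/2 := by rw [ka_im, abs_lt]; constructor <;> linarith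
  have hpos : 0 ≤ 2 * Real.pi / τ * |ζ| := by positivity
  unfold rc
  rcases le_total 0 ω.re with h | h
  · have e : -(al τ ζ * ω) - ell τ (ω + ka τ ζ) + ell τ ω = K + (Dp τ ω - Dp τ (ω + ka τ ζ)) := by
      rw [ell_eq_Dp hτ l1, ell_eq_Dp hτ l2, hK, al, ka]
      field_simp
      linear_combination (-96 * Real.pi * ω * (1 + τ)) * Complex.I_sq
    have e1 := hM1 ω (by linarith) b1
    have e2 := hM1 (ω + ka τ ζ) (by rw [ka_re]; linarith) b2
    rw [e, Complex.norm_exp, Real.exp_le_exp, min_eq_right h]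
    have r1 := (abs_le.1 (Complex.abs_re_le_norm (Dp τ ω))).2
    have r2 := (abs_le.1 (Complex.abs_re_le_norm (Dp τ (ω + ka τ ζ)))).1
    have r3 := (abs_le.1 (Complex.abs_re_le_norm K)).2
    rw [Complex.add_re, Complex.sub_re]
    linarith
  · have e : -(al τ ζ * ω) - ell τ (ω + ka τ ζ) + ell τ ω = -(2 * al τ ζ * ω) - K - (Dp τ (-ω) - Dp τ (-(ω + ka τ ζ))) := by
      rw [ell_eq_Dp_neg hτ l1, ell_eq_Dp_neg hτ l2, hK, al, ka]
      field_simp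
      linear_combination (96 * Real.pi * ω * (1 + τ)) * Complex.I_sq
    have e1 := hM1 (-ω) (by simp; linarith) (by simpa using b1)
    have e2 := hM1 (-(ω + ka τ ζ)) (by rw [Complex.neg_re, ka_re]; linarith) (by rw [Complex.neg_im, abs_neg]; exact b2)
    rw [e, Complex.norm_exp, Real.exp_le_exp, min_eq_left h]
    have r1 := (abs_le.1 (Complex.abs_re_le_norm (Dp τ (-ω)))).1
    have r2 := (abs_le.1 (Complex.abs_re_le_norm (Dp τ (-(ω + ka τ ζ))))).2
    have r3 := (abs_le.1 (Complex.abs_re_le_norm K)).1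
    have r4 : (-(2 * al τ ζ * ω)).re = -(Real.pi * (1+τ)/τ * ω.re) + 2 * Real.pi / τ * (ζ * ω.im) := by
      rw [al, show -(2 * (Real.pi / τ * ((1 + τ)/2 + Complex.I * ζ)) * ω) =
        ((-(Real.pi * (1 + τ)/τ) : ℝ) : ℂ) * ω + ((-(2 * Real.pi / τ * ζ) : ℝ) : ℂ) * (ω * Complex.I) by
          push_cast; field_simp; ring, Complex.add_re, Complex.re_ofReal_mul, Complex.re_ofReal_mul]
      simp
      ring
    have r5 : 2 * Real.pi / τ * (ζ * ω.im) ≤ 2 * Real.pi / τ * |ζ| := by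
      gcongr
      have : 0 < ω.im := by linarith
      nlinarith
    rw [Complex.sub_re, Complex.sub_re, r4, Complex.sub_re]
    linarith

lemma rc_FE {τ : ℝ} (ζ : ℝ) (hτ : 0 < τ) {ω : ℂ} (h1 : τ < ω.im) (h2 : ω.im + τ/2 < 1/2) :
    rc τ ζ (ω + Complex.I * τ / 2) * (1 - Complex.exp (-2 * Real.pi * (ω + ζ) + Complex.I * Real.pi * τ))
    = rc τ ζ (ω - Complex.I * τ / 2) * (1 + Complex.exp (-2 * Real.pi * ω)) ∧
    1 - Complex.exp (-2 * Real.pi * (ω + ζ) + Complex.I * Real.pi * τ) ≠ 0 := by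
  have ht' : (τ:ℂ) ≠ 0 := by exact_mod_cast hτ.ne'
  have v1 : |ω.im| + τ/2 < 1/2 := by rw [abs_of_pos (by linarith)]; exact h2
  have v2 : |(ω + ka τ ζ).im| + τ/2 < 1/2 := by
    have : |(ω + ka τ ζ).im| < 1/2 - τ/2 := by rw [ka_im, abs_lt]; constructor <;> linarith
    linarith
  have f1 := ell_FE hτ v1
  have f2 := ell_FE hτ v2
  have g1 := exp_Lam (v := ω) (by linarith)
  have g2 := exp_Lam (v := ω + ka τ ζ) (by linarith)
  rw [cosh_mul_exp] at g1 g2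
  have e0 : 1 + Complex.exp (-2 * Real.pi * (ω + ka τ ζ)) = 1 - Complex.exp (-2 * Real.pi * (ω + ζ) + Complex.I * Real.pi * τ) := by
    rw [show -2 * Real.pi * (ω + ka τ ζ) = -2 * Real.pi * (ω + ζ) + Complex.I * Real.pi * τ + Real.pi * Complex.I by rw [ka]; ring,
      Complex.exp_add _ (Real.pi * Complex.I), Complex.exp_pi_mul_I]
    ring
  rw [e0] at g2
  have hne : 1 - Complex.exp (-2 * Real.pi * (ω + ζ) + Complex.I * Real.pi * τ) ≠ 0 := by
    intro h0
    rw [h0, mul_zero] at g2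
    exact Complex.exp_ne_zero _ g2
  refine ⟨?_, hne⟩
  apply mul_left_cancel₀ (Complex.exp_ne_zero (Real.pi * ω))
  have g1' : Complex.exp (Real.pi * ω) * (1 + Complex.exp (-2 * Real.pi * ω)) = Complex.exp (Lam ω) := g1.symm
  have g2' : Complex.exp (Real.pi * ω) * (1 - Complex.exp (-2 * Real.pi * (ω + ζ) + Complex.I * Real.pi * τ))
      = Complex.exp (Lam (ω + ka τ ζ) - Real.pi * ka τ ζ) := by
    have e3 : Complex.exp (Real.pi * (ω + ka τ ζ)) = Complex.exp (Real.pi * ω) * Complex.exp (Real.pi * ka τ ζ) := by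
      rw [← Complex.exp_add]; congr 1; ring
    rw [Complex.exp_sub, g2, e3]
    have e4 := Complex.exp_ne_zero (Real.pi * ka τ ζ)
    generalize (1 - Complex.exp (-2 * Real.pi * (ω + ζ) + Complex.I * Real.pi * τ)) = q
    generalize Complex.exp (Real.pi * ka τ ζ) = q2 at *
    field_simp
  rw [mul_left_comm, g2', mul_left_comm, g1', ← f1, ← f2]
  unfold rc
  rw [← Complex.exp_add, ← Complex.exp_add,
    show ω + ka τ ζ + Complex.I * τ / 2 = ω + Complex.I * τ / 2 + ka τ ζ by ring,
    show ω + ka τ ζ - Complex.I * τ / 2 = ω - Complex.I * τ / 2 + ka τ ζ by ring]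
  congr 1
  rw [al]
  rw [show Real.pi * ka τ ζ = Real.pi * (ζ - Complex.I * (1 + τ) / 2) by rw [ka]]
  field_simp
  linear_combination (-4 * Real.pi * τ * ζ) * Complex.I_sq

lemma R_const {τ : ℝ} (ζ : ℝ) (hτ : 0 < τ) (hτ7 : τ < 1/7) {ω ω' : ℂ} (h1 : τ/2 < ω.im) (h2 : ω.im < 1/2)
    (h1' : τ/2 < ω'.im) (h2' : ω'.im < 1/2) : Ff τ ζ ω * rc τ ζ ω = Ff τ ζ ω' * rc τ ζ ω' := by
  have hp := Real.pi_pos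
  set R : ℂ → ℂ := fun ω => Ff τ ζ ω * rc τ ζ ω with hRdef
  have hRd : ∀ z : ℂ, τ/2 < z.im → z.im < 1/2 → DifferentiableAt ℂ R z := fun z a b =>
    (Ff_diff ζ hτ (by linarith) (by linarith) (by linarith)).mul (diff_rc ζ hτ a b)
  obtain ⟨M1, hM1, hB1⟩ := Ff_norm ζ hτ (by linarith) (a := 3*τ/4) (b := 3*τ/4 + τ) (by linarith) (by linarith)
  obtain ⟨M2, hM2, hB2⟩ := rc_bound ζ hτ (by linarith) (c1 := 3*τ/4) (c2 := 3*τ/4 + τ) (by linarith) (by linarith)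
  have win : ∀ w w' : ℂ, 3*τ/4 < w.im → w.im < 3*τ/4 + τ → 3*τ/4 < w'.im → w'.im < 3*τ/4 + τ → R w = R w' := by
    intro w w' a1 a2 a3 a4
    refine periodic_const (c := 3*τ/4) (M := M1 * M2) (a := Real.pi * (1+τ)/(2*τ)) hτ (by positivity) (by positivity) ?_ ?_ ?_ ?_ a1 a2 a3 a4
    · rw [div_lt_div_iff₀ (by positivity) hτ]
      nlinarith [mul_pos hp hτ]
    · intro z hz
      exact hRd z (by linarith [hz.1]) (by linarith [hz.2])
    · intro x
      set ω0 : ℂ := x + (5*τ/4 : ℝ) * Complex.I with hω0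
      have i0 : ω0.im = 5*τ/4 := by simp [hω0]
      have p1 : (x + (3*τ/4 + τ : ℝ) * Complex.I : ℂ) = ω0 + Complex.I * τ / 2 := by
        rw [hω0]; push_cast; ring
      have p2 : (x + (3*τ/4 : ℝ) * Complex.I : ℂ) = ω0 - Complex.I * τ / 2 := by
        rw [hω0]; push_cast; ring
      rw [p1, p2]
      obtain ⟨q1, q2⟩ := rc_FE ζ hτ (ω := ω0) (by linarith) (by linarith)
      have q3 := Ff_diff_eq ζ hτ (by linarith) (ω := ω0) (by linarith) (by linarith)
      apply mul_right_cancel₀ q2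
      simp only [hRdef]
      linear_combination Ff τ ζ (ω0 + Complex.I * τ / 2) * q1 - rc τ ζ (ω0 - Complex.I * τ / 2) * q3
    · intro z hz
      have b1 := hB1 z hz.1 hz.2
      have b2 := hB2 z hz.1 hz.2
      simp only [hRdef]
      rw [norm_mul]
      calc _ ≤ (M1 * Real.exp (Real.pi * (1 + τ) / (2 * τ) * z.re)) * (M2 * Real.exp (-(Real.pi * (1+τ)/τ * min z.re 0))) := by gcongr
        _ = M1 * M2 * Real.exp (Real.pi * (1 + τ) / (2 * τ) * z.re + -(Real.pi * (1+τ)/τ * min z.re 0)) := by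
          rw [Real.exp_add]; ring
        _ = _ := by
          congr 2
          rcases le_total 0 z.re with h | h
          · rw [min_eq_right h, abs_of_nonneg h]; ring
          · rw [min_eq_left h, abs_of_nonpos h]; field_simp; ring
  have hS : IsOpen {z : ℂ | τ/2 < z.im ∧ z.im < 1/2} :=
    (isOpen_lt continuous_const Complex.continuous_im).inter (isOpen_lt Complex.continuous_im continuous_const)
  have hSc : Convex ℝ {z : ℂ | τ/2 < z.im ∧ z.im < 1/2} :=
    (convex_halfSpace_im_gt _).inter (convex_halfSpace_im_lt _)
  have hA : AnalyticOnNhd ℂ R {z : ℂ | τ/2 < z.im ∧ z.im < 1/2} :=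
    DifferentiableOn.analyticOnNhd (fun z hz => (hRd z hz.1 hz.2).differentiableWithinAt) hS
  set w0 : ℂ := (τ:ℝ) * Complex.I with hw0
  have iw0 : w0.im = τ := by simp [hw0]
  have hEq : Set.EqOn R (fun _ => R w0) {z : ℂ | τ/2 < z.im ∧ z.im < 1/2} := by
    apply hA.eqOn_of_preconnected_of_eventuallyEq analyticOnNhd_const hSc.isPreconnected (z₀ := w0)
    · exact ⟨by rw [iw0]; linarith, by rw [iw0]; linarith⟩
    · have : Complex.im ⁻¹' (Set.Ioo (3*τ/4) (3*τ/4 + τ)) ∈ nhds w0 :=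
        (isOpen_Ioo.preimage Complex.continuous_im).mem_nhds ⟨by rw [iw0]; linarith, by rw [iw0]; linarith⟩
      filter_upwards [this] with z hz
      exact win z w0 hz.1 hz.2 (by rw [iw0]; linarith) (by rw [iw0]; linarith)
  exact (hEq ⟨h1, h2⟩).trans (hEq ⟨h1', h2'⟩).symm

lemma abel_limit {h : ℝ → ℂ} (hc : Continuous h) {M c a : ℝ} {L : ℂ} (hM : 0 ≤ M) (hc0 : 0 < c) (ha : 0 < a)
    (hb : ∀ X, ‖h X‖ ≤ M * Real.exp (c * min X 0)) (hL : Filter.Tendsto h Filter.atTop (nhds L)) :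
    Filter.Tendsto (fun ε : ℝ => (ε:ℂ) * ∫ X : ℝ, (Real.exp (-(a * ε * X)) : ℂ) * h X)
      (nhdsWithin 0 (Set.Ioi 0)) (nhds (L / a)) := by
  have e1 : ∀ᶠ ε : ℝ in nhdsWithin 0 (Set.Ioi 0), (∫ t : ℝ, (Real.exp (-(a * t)) : ℂ) * h (ε⁻¹ * t))
      = (ε:ℂ) * ∫ X : ℝ, (Real.exp (-(a * ε * X)) : ℂ) * h X := by
    filter_upwards [self_mem_nhdsWithin] with ε hε
    have hε : 0 < ε := hε
    have := Measure.integral_comp_mul_left (fun X : ℝ => (Real.exp (-(a * ε * X)) : ℂ) * h X) ε⁻¹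
    rw [inv_inv, abs_of_pos hε] at this
    rw [← Complex.real_smul, ← this]
    congr 1; ext t
    congr 4
    field_simp
  refine Filter.Tendsto.congr' e1 ?_
  have e2 : (∫ t : ℝ, Set.indicator (Set.Ioi 0) (fun t : ℝ => (Real.exp (-(a * t)) : ℂ) * L) t) = L / a := by
    rw [integral_indicator measurableSet_Ioi, integral_mul_const, integral_complex_ofReal]
    have := integral_exp_mul_Ioi (a := -a) (by linarith) 0
    simp only [neg_mul] at this
    rw [this]
    simp
    field_simp
  rw [← e2]
  apply tendsto_integral_filter_of_dominated_convergence (fun t => M * Real.exp (-a * |t|))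
  · filter_upwards with ε
    exact (Continuous.aestronglyMeasurable (by fun_prop))
  · have : Set.Ioo 0 (c/(2*a)) ∈ nhdsWithin (0:ℝ) (Set.Ioi 0) := Ioo_mem_nhdsGT (by positivity)
    filter_upwards [this] with ε hε
    obtain ⟨h0, h1⟩ := hε
    filter_upwards with t
    rw [norm_mul, Complex.norm_real, Real.norm_of_nonneg (Real.exp_pos _).le]
    calc _ ≤ Real.exp (-(a*t)) * (M * Real.exp (c * min (ε⁻¹ * t) 0)) := by gcongr; exact hb _
      _ = M * Real.exp (-(a*t) + c * min (ε⁻¹ * t) 0) := by rw [Real.exp_add]; ring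
      _ ≤ _ := by
        gcongr
        rcases le_total 0 t with h | h
        · rw [min_eq_right (by positivity), abs_of_nonneg h]; linarith
        · rw [min_eq_left (mul_nonpos_of_nonneg_of_nonpos (by positivity) h), abs_of_nonpos h]
          have : 2 * a ≤ c * ε⁻¹ := by
            rw [lt_div_iff₀ (by positivity)] at h1
            rw [← div_eq_mul_inv, le_div_iff₀ h0]; linarith
          nlinarith
  · exact (exp_neg_abs_integrable ha).const_mul M
  · have hne : ∀ᵐ t : ℝ, t ≠ 0 := by
      rw [ae_iff]; simp
    filter_upwards [hne] with t ht
    have hinv : Filter.Tendsto (fun ε : ℝ => ε⁻¹) (nhdsWithin 0 (Set.Ioi 0)) Filter.atTop := tendsto_inv_nhdsGT_zero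
    rcases lt_or_gt_of_ne ht with h0 | h0
    · rw [Set.indicator_of_notMem (by simp; linarith [h0])]
      have : Filter.Tendsto (fun ε : ℝ => h (ε⁻¹ * t)) (nhdsWithin 0 (Set.Ioi 0)) (nhds 0) := by
        have t1 : Filter.Tendsto (fun ε : ℝ => M * Real.exp (c * (ε⁻¹ * t))) (nhdsWithin 0 (Set.Ioi 0)) (nhds 0) := by
          have t2 : Filter.Tendsto (fun ε : ℝ => c * (ε⁻¹ * t)) (nhdsWithin 0 (Set.Ioi 0)) Filter.atBot :=
            Filter.Tendsto.const_mul_atBot hc0 (Filter.Tendsto.atTop_mul_const_of_neg h0 hinv)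
          simpa using (Real.tendsto_exp_atBot.comp t2).const_mul M
        refine squeeze_zero_norm' ?_ t1
        filter_upwards [self_mem_nhdsWithin] with ε hε
        have hε : 0 < ε := hε
        refine (hb _).trans (by rw [min_eq_left (mul_nonpos_of_nonneg_of_nonpos (by positivity) h0.le)])
      simpa using this.const_mul ((Real.exp (-(a * t)) : ℝ) : ℂ)
    · rw [Set.indicator_of_mem (by exact h0)]
      exact (hL.comp (Filter.Tendsto.atTop_mul_const h0 hinv)).const_mul _

lemma Ff_abel {τ : ℝ} (ζ : ℝ) (hτ : 0 < τ) (hτ3 : τ < 1/3) :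
    Filter.Tendsto (fun ε : ℝ => (ε:ℂ) * Ff τ ζ (-ζ + ε * Complex.I)) (nhdsWithin 0 (Set.Ioi 0))
      (nhds (τ / (2 * Real.pi) * Complex.exp (-Kc τ ζ))) := by
  have hp := Real.pi_pos
  have ht' : (τ:ℂ) ≠ 0 := by exact_mod_cast hτ.ne'
  set ln : ℝ → ℂ := fun X => X + (-(1+τ)/4 : ℝ) * Complex.I with hln
  have lim : ∀ X, (ln X).im = -(1+τ)/4 := fun X => by simp [hln]
  have lre : ∀ X, (ln X).re = X := fun X => by simp [hln]
  have lc : Continuous ln := by fun_prop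
  set h : ℝ → ℂ := fun X => Complex.exp (2 * Real.pi * Complex.I / τ * ln X * (-ζ)) * gx τ ζ (ln X) with hh
  have hc : Continuous h := by
    have : Continuous (fun X => gx τ ζ (ln X)) := by
      rw [continuous_iff_continuousAt]
      intro X
      exact ContinuousAt.comp (g := gx τ ζ) (diff_gx hτ (by rw [lim]; linarith) (by rw [lim]; linarith)).continuousAt lc.continuousAt
    fun_prop
  obtain ⟨M, hM, hB⟩ := gx_bound ζ hτ hτ3
  have hb : ∀ X, ‖h X‖ ≤ (Real.exp (2 * Real.pi / τ * (-(-(1+τ)/4 * -ζ))) * M) * Real.exp (Real.pi * (1+τ)/τ * min X 0) := by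
    intro X
    have := hB (ln X) (by rw [lim]; rw [show -(1+τ)/4 + (1+τ)/4 = 0 by ring]; simp; positivity)
    rw [lre] at this
    simp only [hh]
    rw [norm_mul, norm_ew, lim, mul_assoc]
    simp only [Complex.neg_im, Complex.ofReal_im, Complex.neg_re, Complex.ofReal_re, neg_zero, mul_zero, zero_add]
    gcongr
  have hL : Filter.Tendsto h Filter.atTop (nhds (Complex.exp (-Kc τ ζ))) := by
    have q1 := (tendsto_Dp hτ (y := -(1+τ)/4) (by rw [abs_lt]; constructor <;> linarith)).comp
      (Filter.tendsto_atTop_add_const_right Filter.atTop (-ζ) Filter.tendsto_id)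
    have q2 := tendsto_Dp hτ (y := (1+τ)/4) (by rw [abs_lt]; constructor <;> linarith)
    have q3 := ((q1.sub q2).const_add (-Kc τ ζ)).cexp
    rw [sub_self, add_zero] at q3
    refine q3.congr fun X => ?_
    simp only [hh]
    rw [gx_eq_pos hτ (by rw [lim]; linarith) (by rw [lim]; linarith), ← Complex.exp_add]
    congr 1
    simp only [Function.comp, id, hln]
    rw [show ((X + -ζ : ℝ) : ℂ) + (-(1+τ)/4 : ℝ) * Complex.I = X + (-(1+τ)/4 : ℝ) * Complex.I - ζ by push_cast; ring,
      show (X + (-(1+τ)/4 : ℝ) * Complex.I + Complex.I * (1 + τ)/2 : ℂ) = X + ((1+τ)/4 : ℝ) * Complex.I by push_cast; ring]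
    ring
  have A := abel_limit hc (a := 2 * Real.pi / τ) (by positivity) (by positivity) (by positivity) hb hL
  have B : Filter.Tendsto (fun ε : ℝ => Complex.exp (2 * Real.pi / τ * (ε * ((1+τ)/4 * Complex.I)))) (nhdsWithin 0 (Set.Ioi 0)) (nhds 1) := by
    have : Continuous (fun ε : ℝ => Complex.exp (2 * Real.pi / τ * (ε * ((1+τ)/4 * Complex.I)))) := by fun_prop
    have := this.tendsto 0
    simp only [Complex.ofReal_zero, zero_mul, mul_zero, Complex.exp_zero] at this
    exact this.mono_left nhdsWithin_le_nhds
  have C := B.mul A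
  rw [one_mul] at C
  convert! C using 2 with ε
  · rw [mul_left_comm]
    congr 1
    rw [Ff, ← integral_const_mul]
    congr 1; ext X
    simp only [hh, Iw]
    rw [Complex.ofReal_exp, ← mul_assoc, ← mul_assoc, ← Complex.exp_add, ← Complex.exp_add]
    congr 2
    simp only [hln]
    push_cast
    field_simp
    linear_combination (4 * X * ε - Complex.I * ε * (τ + 1)) * Complex.I_sq
  · push_cast; field_simp

lemma Ff_val {τ : ℝ} (ζ : ℝ) (hτ : 0 < τ) (hτ3 : τ < 1/3) :
    Ff τ ζ (-ζ + τ * Complex.I) * (1 + Complex.exp (2 * Real.pi * ζ - Complex.I * Real.pi * τ))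
      = Complex.I * τ * Complex.exp (-Kc τ ζ) := by
  have hp := Real.pi_pos
  have hp' := pi_c_ne
  have A := Ff_abel ζ hτ hτ3
  have B : Filter.Tendsto (fun ε : ℝ => (ε:ℂ)⁻¹ * (1 - Complex.exp (-(2 * Real.pi * Complex.I * ε)))) (nhdsWithin 0 (Set.Ioi 0))
      (nhds (2 * Real.pi * Complex.I)) := by
    have h1 : HasDerivAt (fun ε : ℂ => 1 - Complex.exp (-(2 * Real.pi * Complex.I * ε))) (2 * Real.pi * Complex.I) ((0:ℝ):ℂ) := by
      have := (((hasDerivAt_id ((0:ℝ):ℂ)).const_mul (2 * Real.pi * Complex.I)).neg.cexp).const_sub 1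
      refine this.congr_deriv ?_
      simp
    have h2 := h1.comp_ofReal.tendsto_slope_zero_right
    refine h2.congr fun ε => ?_
    simp
  have D : Filter.Tendsto (fun ε : ℝ => Ff τ ζ (-ζ + τ * Complex.I + ε * Complex.I) *
      (1 + Complex.exp (-2 * Real.pi * (-ζ + (τ/2 + ε) * Complex.I)))) (nhdsWithin 0 (Set.Ioi 0))
      (nhds (Ff τ ζ (-ζ + τ * Complex.I) * (1 + Complex.exp (2 * Real.pi * ζ - Complex.I * Real.pi * τ)))) := by
    have c1 : ContinuousAt (fun ε : ℝ => Ff τ ζ (-ζ + τ * Complex.I + ε * Complex.I)) 0 := by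
      refine ContinuousAt.comp (g := Ff τ ζ) (f := fun ε : ℝ => (-ζ + τ * Complex.I + ε * Complex.I : ℂ)) ?_ (by fun_prop)
      exact (Ff_diff ζ hτ hτ3 (by simp; linarith) (by simp; linarith)).continuousAt
    have c2 : ContinuousAt (fun ε : ℝ => Ff τ ζ (-ζ + τ * Complex.I + ε * Complex.I) *
      (1 + Complex.exp (-2 * Real.pi * (-ζ + (τ/2 + ε) * Complex.I)))) 0 := by fun_prop
    have := c2.tendsto.mono_left (nhdsWithin_le_nhds (s := Set.Ioi 0))
    convert! this using 2
    congr 1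
    · simp
    · congr 2
      simp
      ring
  have E := A.mul B
  refine (tendsto_nhds_unique (D.congr' ?_) E).trans ?_
  · have : Set.Ioo 0 (1/12) ∈ nhdsWithin (0:ℝ) (Set.Ioi 0) := Ioo_mem_nhdsGT (by positivity)
    filter_upwards [this] with ε hε
    obtain ⟨h0, h1⟩ := hε
    have he : (ε:ℂ) ≠ 0 := by exact_mod_cast h0.ne'
    have := Ff_diff_eq ζ hτ hτ3 (ω := -ζ + (τ/2 + ε : ℝ) * Complex.I) (by simp; linarith) (by simp; linarith)
    rw [show (-ζ + (τ/2 + ε : ℝ) * Complex.I - Complex.I * τ / 2 : ℂ) = -ζ + ε * Complex.I by push_cast; ring,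
      show (-ζ + (τ/2 + ε : ℝ) * Complex.I + Complex.I * τ / 2 : ℂ) = -ζ + τ * Complex.I + ε * Complex.I by push_cast; ring,
      show (-2 * Real.pi * (-ζ + (τ/2 + ε : ℝ) * Complex.I + ζ) + Complex.I * Real.pi * τ : ℂ) = -(2 * Real.pi * Complex.I * ε) by push_cast; ring] at this
    push_cast at this
    rw [← this]
    field_simp
  · field_simp

lemma Mfun_eq {b ζ : ℝ} (hb : 0 < b) (ω : ℂ) :
    Mfun b (ζ/b) (ω/b) = Complex.exp (ell (b^2) ζ) * ((b:ℂ)⁻¹ * Ff (b^2) ζ ω) := by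
  have hb' : (b:ℂ) ≠ 0 := by exact_mod_cast hb.ne'
  unfold Mfun Ff
  have := Measure.integral_comp_mul_left (fun X : ℝ => Iw (b^2) ζ ω (X + (-(1+b^2)/4 : ℝ) * Complex.I)) b
  rw [abs_of_pos (inv_pos.2 hb), Complex.real_smul, Complex.ofReal_inv] at this
  rw [← this]
  congr 1
  · rw [sb, Complex.ofReal_div, Lb_eq_ell hb]
  · congr 1; ext x
    unfold sb Iw gx
    rw [show (x - Complex.I * Qb b / 4 - (ζ/b : ℝ) : ℂ) = (((b * x : ℝ) : ℂ) + (-(1+b^2)/4 : ℝ) * Complex.I - ζ) / b by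
        rw [Qb]; push_cast; field_simp; ring,
      show (x - Complex.I * Qb b / 4 + Complex.I * Qb b / 2 : ℂ) = (((b * x : ℝ) : ℂ) + (-(1+b^2)/4 : ℝ) * Complex.I + Complex.I * (1 + (b^2 : ℝ))/2) / b by
        rw [Qb]; push_cast; field_simp; ring,
      Lb_eq_ell hb, Lb_eq_ell hb, ← Complex.exp_add, ← Complex.exp_sub, ← Complex.exp_add, ← add_sub_assoc, ← add_assoc]
    congr 3
    rw [Qb]
    push_cast
    field_simp
    ring

lemma M_closed {b ζ : ℝ} (hb : 0 < b) (hb7 : b^2 < 1/7) {ω : ℂ} (h1 : b^2/2 < ω.im) (h2 : ω.im < 1/2) :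
    Mfun b (ζ/b) (ω/b) = Complex.exp (-Kc (b^2) ζ + al (b^2) ζ * (ζ + ω) + ell (b^2) (ω + ka (b^2) ζ) - ell (b^2) ω) := by
  have hb' : (b:ℂ) ≠ 0 := by exact_mod_cast hb.ne'
  rw [Mfun_eq hb]
  have hτ : 0 < b^2 := by positivity
  have hlog : (b:ℂ) = Complex.exp ((Real.log (b^2) : ℂ)/2) := by
    rw [Real.log_pow, show (((2:ℕ) * Real.log b : ℝ) : ℂ) / 2 = ((Real.log b : ℝ) : ℂ) by push_cast; ring, ← Complex.ofReal_exp, Real.exp_log hb]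
  have hbt : (b:ℂ) * b = ((b^2 : ℝ) : ℂ) := by push_cast; ring
  generalize b^2 = τ at *
  have ht' : (τ:ℂ) ≠ 0 := by exact_mod_cast hτ.ne'
  have V := Ff_val ζ hτ (by linarith)
  have R := R_const ζ hτ hb7 h1 h2 (ω' := -ζ + τ * Complex.I) (by simp; linarith) (by simp; linarith)
  have F := ell_FE hτ (v := -ζ + Complex.I * τ / 2) (by simp; rw [abs_of_pos (by linarith : 0 < τ/2)]; linarith)
  rw [show (-ζ + Complex.I * τ / 2 + Complex.I * τ / 2 : ℂ) = -ζ + τ * Complex.I by ring, add_sub_cancel_right, ell_neg] at F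
  have X := exp_Lam (v := -ζ + Complex.I * τ / 2) (by simp; rw [abs_of_pos (by linarith : 0 < τ/2)]; linarith)
  rw [cosh_mul_exp, show (-2 * Real.pi * (-ζ + Complex.I * τ/2) : ℂ) = 2 * Real.pi * ζ - Complex.I * Real.pi * τ by ring] at X
  have S := ell_special hτ
  have S2 : ell τ (-ζ + τ * Complex.I + ka τ ζ) = (Real.log τ : ℂ)/2 := by
    rw [show (-ζ + τ * Complex.I + ka τ ζ : ℂ) = -(Complex.I * (1 - τ)/2) by rw [ka]; ring, ell_neg, S]; ring
  have V2 : Ff τ ζ (-ζ + τ * Complex.I) * rc τ ζ (-ζ + τ * Complex.I) = b * Complex.exp (-Kc τ ζ + al τ ζ * ζ - ell τ ζ) := by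
    unfold rc
    rw [S2, show ell τ (-ζ + τ * Complex.I) = Lam (-ζ + Complex.I * τ / 2) - ell τ ζ by linear_combination F]
    have e1 : -(al τ ζ * (-ζ + τ * Complex.I)) - (Real.log τ : ℂ) / 2 + (Lam (-ζ + Complex.I * τ / 2) - ell τ ζ)
        = -(Real.pi * Complex.I / 2) + -(Real.pi * (-ζ + Complex.I * τ / 2)) + -((Real.log τ : ℂ) / 2) + (al τ ζ * ζ - ell τ ζ)
          + Lam (-ζ + Complex.I * τ / 2) := by
      rw [al]; field_simp
      linear_combination (-2 * Real.pi * τ * ζ) * Complex.I_sq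
    rw [e1, Complex.exp_add _ (Lam _), Complex.exp_add, Complex.exp_add, Complex.exp_add, X, Complex.exp_neg ((Real.log τ : ℂ)/2), ← hlog,
      Complex.exp_neg (Real.pi * (-ζ + Complex.I * τ / 2)), Complex.exp_neg (Real.pi * Complex.I / 2), exp_I_half,
      show -Kc τ ζ + al τ ζ * ζ - ell τ ζ = -Kc τ ζ + (al τ ζ * ζ - ell τ ζ) by ring, Complex.exp_add (-Kc τ ζ)]
    have hne := Complex.exp_ne_zero (Real.pi * (-ζ + Complex.I * τ / 2))
    generalize Complex.exp (Real.pi * (-ζ + Complex.I * τ / 2)) = y at *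
    generalize Complex.exp (-Kc τ ζ) = k at *
    generalize Complex.exp (al τ ζ * ζ - ell τ ζ) = a at *
    generalize (1 + Complex.exp (2 * Real.pi * ζ - Complex.I * Real.pi * τ)) = q at *
    have : Ff τ ζ (-ζ + τ * Complex.I) * (Complex.I⁻¹ * y⁻¹ * (b:ℂ)⁻¹ * a * (y * q)) = (Ff τ ζ (-ζ + τ * Complex.I) * q) * (Complex.I⁻¹ * (b:ℂ)⁻¹ * a) := by
      field_simp
    rw [this, V, ← hbt]
    field_simp
  rw [V2] at R
  have e2 : Complex.exp (-Kc τ ζ + al τ ζ * (ζ + ω) + ell τ (ω + ka τ ζ) - ell τ ω) * rc τ ζ ω = Complex.exp (ell τ ζ) * Complex.exp (-Kc τ ζ + al τ ζ * ζ - ell τ ζ) := by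
    rw [rc, ← Complex.exp_add, ← Complex.exp_add]
    congr 1; ring
  have e3 : rc τ ζ ω ≠ 0 := Complex.exp_ne_zero _
  apply mul_right_cancel₀ e3
  rw [e2, mul_assoc, mul_assoc, R]
  field_simp

lemma exp_inj_of {a b : ℂ} (h : Complex.exp a = Complex.exp b) (h1 : |a.im - b.im| < 2 * Real.pi) : a = b := by
  obtain ⟨n, hn⟩ := Complex.exp_eq_exp_iff_exists_int.1 h
  have hp := Real.pi_pos
  have e : a.im - b.im = n * (2 * Real.pi) := by rw [hn]; simp
  rw [e, abs_mul, abs_of_pos (by positivity : 0 < 2 * Real.pi)] at h1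
  have : |(n:ℝ)| < 1 := by nlinarith
  have : n = 0 := by
    have : |n| < 1 := by exact_mod_cast this
    simpa [Int.abs_lt_one_iff] using this
  rw [hn, this]; simp

lemma log_im_pos {z : ℂ} (h : 0 < z.im) : 0 < (Complex.log z).im ∧ (Complex.log z).im < Real.pi := by
  rw [Complex.log_im]
  refine ⟨?_, ?_⟩
  · exact lt_of_le_of_ne (Complex.arg_nonneg_iff.2 h.le) (fun h0 => by
      rw [eq_comm, Complex.arg_eq_zero_iff] at h0; linarith [h0.2])
  · exact Complex.arg_lt_pi_iff.2 (Or.inr h.ne')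

lemma log_im_neg {z : ℂ} (h : z.im < 0) : -Real.pi < (Complex.log z).im ∧ (Complex.log z).im < 0 := by
  rw [Complex.log_im]
  exact ⟨Complex.neg_pi_lt_arg _, Complex.arg_neg_iff.2 h⟩

/-- `u(ω)`. -/
noncomputable def uf (ζ : ℝ) (ω : ℂ) : ℂ := Complex.exp ((Real.pi:ℂ) * (ζ:ℂ)) * Complex.cosh ((Real.pi:ℂ) * ω)
        / Complex.sinh ((Real.pi:ℂ) * ((ζ:ℂ) + ω))

/-- `W(ω)`. -/
noncomputable def Wf (ω : ℂ) : ℂ := Complex.exp (-2 * Real.pi * ω)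
/-- `1/Z`. -/
noncomputable def Zi (ζ : ℝ) : ℝ := Real.exp (-2 * Real.pi * ζ)

lemma Zi_pos (ζ : ℝ) : 0 < Zi ζ := Real.exp_pos _

lemma Wf_im {ω : ℂ} (h1 : 0 < ω.im) (h2 : ω.im < 1/2) : (Wf ω).im < 0 := by
  have hp := Real.pi_pos
  rw [Wf, Complex.exp_im]
  have e : (-2 * Real.pi * ω).im = -(2 * Real.pi * ω.im) := by simp
  rw [e, Real.sin_neg]
  have := Real.sin_pos_of_pos_of_lt_pi (x := 2 * Real.pi * ω.im) (by positivity) (by nlinarith)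
  nlinarith [Real.exp_pos (-2 * Real.pi * ω).re]

lemma im1W {ω : ℂ} (h1 : 0 < ω.im) (h2 : ω.im < 1/2) : (1 + Wf ω).im < 0 := by
  simpa using Wf_im h1 h2

lemma im1q (ζ : ℝ) {ω : ℂ} (h1 : 0 < ω.im) (h2 : ω.im < 1/2) : 0 < (1 - Zi ζ * Wf ω).im := by
  have := Wf_im h1 h2
  have hz := Zi_pos ζ
  simp
  nlinarith

lemma sinh_eq (ζ : ℝ) (ω : ℂ) : Complex.sinh ((Real.pi:ℂ) * ((ζ:ℂ) + ω)) =
    Complex.exp (Real.pi * ζ) * Complex.exp (Real.pi * ω) * (1 - Zi ζ * Wf ω) / 2 := by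
  rw [Complex.sinh, Zi, Wf, Complex.ofReal_exp, mul_sub, ← Complex.exp_add, ← Complex.exp_add, ← Complex.exp_add]
  congr 2
  · rw [mul_one]; congr 1; ring
  · congr 1; push_cast; ring

lemma cosh_eq (ω : ℂ) : Complex.cosh ((Real.pi:ℂ) * ω) = Complex.exp (Real.pi * ω) * (1 + Wf ω) / 2 := by
  rw [Wf, ← cosh_mul_exp]; ring

lemma ne_of_im {z : ℂ} (h : z.im ≠ 0) : z ≠ 0 := by rintro rfl; simp at h

lemma uf_eq (ζ : ℝ) (ω : ℂ) : uf ζ ω = (1 + Wf ω) / (1 - Zi ζ * Wf ω) := by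
  rw [uf, sinh_eq, cosh_eq]
  have a1 := Complex.exp_ne_zero (Real.pi * ζ)
  have a2 := Complex.exp_ne_zero (Real.pi * ω)
  generalize Complex.exp (Real.pi * ζ) = x at *
  generalize Complex.exp (Real.pi * ω) = y at *
  by_cases h : 1 - (Zi ζ : ℂ) * Wf ω = 0
  · rw [h]; simp
  · field_simp

lemma uf_im (ζ : ℝ) {ω : ℂ} (h1 : 0 < ω.im) (h2 : ω.im < 1/2) : (uf ζ ω).im < 0 := by
  have hW := Wf_im h1 h2
  have hz := Zi_pos ζ
  have hq := ne_of_im (im1q ζ h1 h2).ne'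
  have hn := Complex.normSq_pos.2 hq
  rw [uf_eq, Complex.div_im, ← sub_div]
  apply div_neg_of_neg_of_pos _ hn
  simp
  nlinarith

lemma log_uf (ζ : ℝ) {ω : ℂ} (h1 : 0 < ω.im) (h2 : ω.im < 1/2) :
    Complex.log (uf ζ ω) = Complex.log (1 + Wf ω) - Complex.log (1 - Zi ζ * Wf ω) := by
  have hu := uf_im ζ h1 h2
  have a := im1W h1 h2
  have b := im1q ζ h1 h2
  apply exp_inj_of
  · rw [Complex.exp_sub, Complex.exp_log (ne_of_im hu.ne), Complex.exp_log (ne_of_im a.ne), Complex.exp_log (ne_of_im b.ne'), uf_eq]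
  · have x1 := log_im_neg hu
    have x2 := log_im_neg a
    have x3 := log_im_pos b
    rw [Complex.sub_im, abs_lt]
    constructor <;> linarith [x1.1, x1.2, x2.1, x2.2, x3.1, x3.2]

lemma log_saddle (ζ : ℝ) {ω : ℂ} (h1 : 0 < ω.im) (h2 : ω.im < 1/2) :
    Complex.log (1 + Zi ζ * uf ζ ω) - Complex.log (1 - uf ζ ω) = 2 * Real.pi * ω - Real.pi * Complex.I := by
  have hp := Real.pi_pos
  have hu := uf_im ζ h1 h2
  have hz := Zi_pos ζ
  have a : (1 + Zi ζ * uf ζ ω).im < 0 := by simp; nlinarith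
  have b : 0 < (1 - uf ζ ω).im := by simpa using hu
  apply exp_inj_of
  · have hq := ne_of_im (im1q ζ h1 h2).ne'
    have hb := ne_of_im b.ne'
    rw [Complex.exp_sub, Complex.exp_log (ne_of_im a.ne), Complex.exp_log hb, Complex.exp_sub, Complex.exp_pi_mul_I,
      show Complex.exp (2 * Real.pi * ω) = (Wf ω)⁻¹ by rw [Wf, ← Complex.exp_neg]; congr 1; ring]
    have hW : Wf ω ≠ 0 := Complex.exp_ne_zero _
    rw [div_eq_div_iff hb (by norm_num), uf_eq]
    field_simp
    ring
  · have x2 := log_im_neg a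
    have x3 := log_im_pos b
    have e : (2 * Real.pi * ω - Real.pi * Complex.I : ℂ).im = 2 * Real.pi * ω.im - Real.pi := by simp
    rw [Complex.sub_im, e, abs_lt]
    constructor <;> nlinarith [x2.1, x2.2, x3.1, x3.2]

lemma slit_im {z : ℂ} (h : z.im ≠ 0) : z ∈ Complex.slitPlane := Or.inr h

lemma fM_eq_uf (ζ : ℝ) (ω : ℂ) : fM ζ ω = -(Li2 (-Complex.exp (2 * (Real.pi:ℂ) * (ζ:ℂ)))
    + Li2 (-(Zi ζ * uf ζ ω)) - Li2 (uf ζ ω)) / (2 * (Real.pi:ℂ) * Complex.I)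
  + Complex.I * (Real.pi:ℂ) * (ζ:ℂ)^2 + Complex.I * (ω - Complex.I / 2) * Complex.log (uf ζ ω) + Complex.I * (Real.pi:ℂ) / 6 := by
  rw [fM]
  have : Complex.exp (-((Real.pi:ℂ) * (ζ:ℂ))) * Complex.cosh ((Real.pi:ℂ) * ω) / Complex.sinh ((Real.pi:ℂ) * ((ζ:ℂ) + ω)) = Zi ζ * uf ζ ω := by
    rw [uf, Zi, Complex.ofReal_exp, ← mul_div_assoc, ← mul_assoc, ← Complex.exp_add]
    congr 3
    push_cast; ring
  rw [this]
  rfl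

/-- The simplified exponent. -/
noncomputable def Tf (ζ : ℝ) (ω : ℂ) : ℂ := Complex.I / (2 * Real.pi) * (Li2 (-Wf ω) - Li2 (Zi ζ * Wf ω))

lemma hasDerivAt_Wf (ω : ℂ) : HasDerivAt Wf (-2 * Real.pi * Wf ω) ω := by
  unfold Wf
  refine (((hasDerivAt_id ω).const_mul (-2 * Real.pi : ℂ)).cexp).congr_deriv ?_
  simp; ring

lemma hasDerivAt_Tf (ζ : ℝ) {ω : ℂ} (h1 : 0 < ω.im) (h2 : ω.im < 1/2) :
    HasDerivAt (Tf ζ) (Complex.I * Complex.log (uf ζ ω)) ω := by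
  have hp := pi_c_ne
  have d1 := hasDerivAt_Li2_comp (g := fun w => -Wf w) (a := -2 * Real.pi) (v := ω) (hasDerivAt_Wf ω).neg (by ring)
    (by rw [sub_neg_eq_add]; exact slit_im (im1W h1 h2).ne)
  have d2 := hasDerivAt_Li2_comp (g := fun w => Zi ζ * Wf w) (a := -2 * Real.pi) (v := ω) ((hasDerivAt_Wf ω).const_mul (Zi ζ : ℂ)) (by ring)
    (slit_im (im1q ζ h1 h2).ne')
  refine ((d1.sub d2).const_mul (Complex.I / (2 * Real.pi))).congr_deriv ?_
  rw [log_uf ζ h1 h2, sub_neg_eq_add]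
  field_simp

lemma diffAt_uf (ζ : ℝ) {ω : ℂ} (h : 1 - Zi ζ * Wf ω ≠ 0) : DifferentiableAt ℂ (uf ζ) ω := by
  have : uf ζ = fun w => (1 + Wf w) / (1 - Zi ζ * Wf w) := funext (uf_eq ζ)
  rw [this]
  have := (hasDerivAt_Wf ω).differentiableAt
  fun_prop (disch := assumption)

lemma hasDerivAt_fM (ζ : ℝ) {ω : ℂ} (h1 : 0 < ω.im) (h2 : ω.im < 1/2) :
    HasDerivAt (fM ζ) (Complex.I * Complex.log (uf ζ ω)) ω := by
  have hp := pi_c_ne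
  have hu := uf_im ζ h1 h2
  have hu0 := ne_of_im hu.ne
  have hz := Zi_pos ζ
  have hd := (diffAt_uf ζ (ne_of_im (im1q ζ h1 h2).ne')).hasDerivAt
  set u' := deriv (uf ζ) ω
  have d1 := hasDerivAt_Li2_comp (g := uf ζ) (a := u' / uf ζ ω) (v := ω) hd (by field_simp)
    (by apply slit_im; simpa using hu.ne)
  have d2 := hasDerivAt_Li2_comp (g := fun w => -(Zi ζ * uf ζ w)) (a := u' / uf ζ ω) (v := ω) (hd.const_mul (Zi ζ : ℂ)).neg (by field_simp)
    (by apply slit_im; simp; exact ⟨hz.ne', hu.ne⟩)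
  have d3 := hd.clog (slit_im hu.ne)
  have d4 := (((hasDerivAt_id ω).sub_const (Complex.I/2)).const_mul Complex.I).mul d3
  have d5 := (((((d2.const_add (Li2 (-Complex.exp (2 * (Real.pi:ℂ) * (ζ:ℂ))))).sub d1).neg.div_const (2 * (Real.pi:ℂ) * Complex.I)).add_const
    (Complex.I * (Real.pi:ℂ) * (ζ:ℂ)^2)).add d4).add_const (Complex.I * (Real.pi:ℂ) / 6)
  rw [show fM ζ = _ from funext (fM_eq_uf ζ)]
  refine d5.congr_deriv ?_
  have s := log_saddle ζ h1 h2
  rw [sub_neg_eq_add, show Complex.log (1 + Zi ζ * uf ζ ω) = 2 * Real.pi * ω - Real.pi * Complex.I + Complex.log (1 - uf ζ ω) by rw [← s]; ring]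
  simp only [id]
  field_simp
  linear_combination (u' * Real.pi * (2 * ω - Complex.I)) * Complex.I_sq

lemma mul_log_tendsto {l : Filter ℝ} {r u : ℝ → ℂ} {c : ℂ} (hr : Filter.Tendsto r l (nhds 0)) (hr0 : ∀ᶠ x in l, r x ≠ 0)
    (hu0 : ∀ᶠ x in l, u x ≠ 0) (hc : c ≠ 0) (hq : Filter.Tendsto (fun x => u x / r x) l (nhds c)) :
    Filter.Tendsto (fun x => r x * Complex.log (u x)) l (nhds 0) := by
  have hrn : Filter.Tendsto (fun x => ‖r x‖) l (nhds 0) := by simpa using hr.norm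
  have t1 : Filter.Tendsto (fun x => ‖r x‖ * Real.log ‖r x‖) l (nhds 0) := by
    have := (Real.continuous_mul_log.tendsto 0).comp hrn
    simpa [Function.comp_def] using this
  have t2 : Filter.Tendsto (fun x => ‖r x‖ * Real.log ‖u x / r x‖) l (nhds 0) := by
    have := (Real.continuousAt_log (norm_ne_zero_iff.2 hc)).tendsto.comp hq.norm
    simpa using hrn.mul this
  have t3 : Filter.Tendsto (fun x => |‖r x‖ * Real.log ‖r x‖ + ‖r x‖ * Real.log ‖u x / r x‖| + ‖r x‖ * Real.pi) l (nhds 0) := by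
    simpa using (t1.add t2).abs.add (hrn.mul_const Real.pi)
  refine squeeze_zero_norm' ?_ t3
  filter_upwards [hr0, hu0] with x h0 h1
  have e : Real.log ‖u x‖ = Real.log ‖r x‖ + Real.log ‖u x / r x‖ := by
    rw [norm_div, Real.log_div (norm_ne_zero_iff.2 h1) (norm_ne_zero_iff.2 h0)]; ring
  have a := Complex.norm_le_abs_re_add_abs_im (Complex.log (u x))
  rw [Complex.log_re, Complex.log_im] at a
  have a2 := Complex.abs_arg_le_pi (u x)
  rw [norm_mul, ← mul_add, ← e, abs_mul, abs_of_nonneg (norm_nonneg (r x)), ← mul_add]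
  gcongr
  linarith

lemma fM_eq (ζ : ℝ) {ω : ℂ} (h1 : 0 < ω.im) (h2 : ω.im < 1/2) : fM ζ ω = Tf ζ ω := by
  have hp := Real.pi_pos
  have hp' := pi_c_ne
  have hz := Zi_pos ζ
  have hS : IsOpen {z : ℂ | 0 < z.im ∧ z.im < 1/2} :=
    (isOpen_lt continuous_const Complex.continuous_im).inter (isOpen_lt Complex.continuous_im continuous_const)
  have hSc : Convex ℝ {z : ℂ | 0 < z.im ∧ z.im < 1/2} :=
    (convex_halfSpace_im_gt _).inter (convex_halfSpace_im_lt _)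
  have hd : ∀ z ∈ {z : ℂ | 0 < z.im ∧ z.im < 1/2}, HasDerivAt (fun w => fM ζ w - Tf ζ w) 0 z := fun z hz =>
    ((hasDerivAt_fM ζ hz.1 hz.2).sub (hasDerivAt_Tf ζ hz.1 hz.2)).congr_deriv (sub_self _)
  have hconst : ∀ z ∈ {z : ℂ | 0 < z.im ∧ z.im < 1/2}, fM ζ z - Tf ζ z = fM ζ ω - Tf ζ ω := by
    intro z hz
    exact hS.is_const_of_deriv_eq_zero hSc.isPreconnected (f := fun w => fM ζ w - Tf ζ w)
      (fun w hw => (hd w hw).differentiableAt.differentiableWithinAt) (fun w hw => (hd w hw).deriv) hz ⟨h1, h2⟩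
  -- the path
  set l := nhdsWithin (0:ℝ) (Set.Ioi 0) with hl
  set r : ℝ → ℂ := fun ε => ε * (1 - Complex.I) with hrdef
  set p : ℝ → ℂ := fun ε => Complex.I / 2 + r ε with hpdef
  have pim : ∀ ε, (p ε).im = 1/2 - ε := fun ε => by simp [hpdef, hrdef]; ring
  have pre : ∀ ε, (p ε).re = ε := fun ε => by simp [hpdef, hrdef]
  have hr : Filter.Tendsto r l (nhds 0) := by
    have : Continuous r := by fun_prop
    have := this.tendsto 0
    simp only [hrdef, Complex.ofReal_zero, zero_mul] at this
    exact this.mono_left nhdsWithin_le_nhds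
  have hpt : Filter.Tendsto p l (nhds (Complex.I/2)) := by simpa using hr.const_add (Complex.I/2)
  have hpos : ∀ᶠ ε in l, 0 < ε := self_mem_nhdsWithin
  have hsm : ∀ᶠ ε in l, 0 < ε ∧ ε < 1/2 := Ioo_mem_nhdsGT (by norm_num)
  have hr0 : ∀ᶠ ε in l, r ε ≠ 0 := by
    filter_upwards [hpos] with ε h h0
    have := pre ε
    simp only [hpdef, h0] at this
    simp at this
    linarith
  have W0 : Wf (Complex.I/2) = -1 := by
    rw [Wf, show -2 * Real.pi * (Complex.I/2) = -(Real.pi * Complex.I) by ring, Complex.exp_neg, Complex.exp_pi_mul_I]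
    norm_num
  have hWt : Filter.Tendsto (fun ε => Wf (p ε)) l (nhds (-1)) := by
    rw [← W0]
    exact (hasDerivAt_Wf _).continuousAt.tendsto.comp hpt
  have hq0 : 1 - (Zi ζ : ℂ) * Wf (Complex.I/2) ≠ 0 := by
    rw [W0]
    have : ((1 + Zi ζ : ℝ) : ℂ) ≠ 0 := by exact_mod_cast (by positivity)
    intro h; apply this; push_cast; linear_combination h
  have u0 : uf ζ (Complex.I/2) = 0 := by rw [uf_eq, W0]; simp
  have hud : HasDerivAt (uf ζ) (2 * Real.pi / (1 - Zi ζ * Wf (Complex.I/2))) (Complex.I/2) := by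
    have hW := hasDerivAt_Wf (Complex.I/2)
    have := (hW.const_add 1).div ((hW.const_mul (Zi ζ : ℂ)).const_sub 1) hq0
    rw [show uf ζ = _ from funext (uf_eq ζ)]
    refine this.congr_deriv ?_
    rw [W0] at hq0 ⊢
    rw [div_eq_div_iff (pow_ne_zero 2 hq0) hq0]
    ring
  have hut : Filter.Tendsto (fun ε => uf ζ (p ε)) l (nhds 0) := by
    rw [← u0]; exact hud.continuousAt.tendsto.comp hpt
  have hslope : Filter.Tendsto (fun ε => uf ζ (p ε) / r ε) l (nhds (2 * Real.pi / (1 - Zi ζ * Wf (Complex.I/2)))) := by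
    have h3 := hud.tendsto_slope_zero
    have h4 : Filter.Tendsto r l (nhdsWithin 0 {0}ᶜ) := tendsto_nhdsWithin_iff.2 ⟨hr, hr0⟩
    refine (h3.comp h4).congr fun ε => ?_
    simp only [Function.comp, u0, sub_zero, smul_eq_mul, hpdef]
    exact (div_eq_inv_mul _ _).symm
  have hun : ∀ᶠ ε in l, uf ζ (p ε) ≠ 0 := by
    filter_upwards [hsm] with ε h
    exact ne_of_im (uf_im ζ (by rw [pim]; linarith [h.2]) (by rw [pim]; linarith [h.1])).ne
  have L1 := mul_log_tendsto hr hr0 hun (div_ne_zero (by simp [hp']) hq0) hslope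
  have one_slit : (1 - 0 : ℂ) ∈ Complex.slitPlane := by simp
  have L2 : Filter.Tendsto (fun ε => Li2 (uf ζ (p ε))) l (nhds 0) := by
    have := (diffAt_Li2 one_slit).continuousAt.tendsto.comp hut
    rwa [Li2_zero] at this
  have L3 : Filter.Tendsto (fun ε => Li2 (-(Zi ζ * uf ζ (p ε)))) l (nhds 0) := by
    have := (diffAt_Li2 one_slit).continuousAt.tendsto.comp (f := fun ε => -((Zi ζ : ℂ) * uf ζ (p ε))) (x := l) (by simpa using (hut.const_mul (Zi ζ : ℂ)).neg)
    rwa [Li2_zero] at this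
  have L4 : Filter.Tendsto (fun ε => Li2 (-Wf (p ε))) l (nhds ((Real.pi:ℂ)^2/6)) := by
    refine tendsto_Li2_one.comp (tendsto_nhdsWithin_iff.2 ⟨by simpa using hWt.neg, ?_⟩)
    filter_upwards [hpos] with ε h
    rw [mem_ball_zero_iff, norm_neg, Wf, Complex.norm_exp]
    have : (-2 * Real.pi * p ε).re = -(2 * Real.pi * ε) := by
      rw [show (-2 * Real.pi * p ε : ℂ) = ((-2 * Real.pi : ℝ) : ℂ) * p ε by push_cast; ring, Complex.re_ofReal_mul, pre]; ring
    rw [this, Real.exp_lt_one_iff]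
    have : 0 < 2 * Real.pi * ε := by positivity
    linarith
  have L5 : Filter.Tendsto (fun ε => Li2 (Zi ζ * Wf (p ε))) l (nhds (Li2 (-(Zi ζ:ℂ)))) := by
    refine Filter.Tendsto.comp (g := Li2) (y := nhds (-(Zi ζ:ℂ))) (diffAt_Li2 ?_).continuousAt.tendsto ?_
    · rw [sub_neg_eq_add]; left; simp; linarith
    · simpa using hWt.const_mul (Zi ζ : ℂ)
  have A := (((((L3.const_add (Li2 (-Complex.exp (2 * (Real.pi:ℂ) * (ζ:ℂ))))).sub L2).neg.div_const (2 * (Real.pi:ℂ) * Complex.I)).add_const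
    (Complex.I * (Real.pi:ℂ) * (ζ:ℂ)^2)).add (L1.const_mul Complex.I)).add_const (Complex.I * (Real.pi:ℂ) / 6)
  have B := (L4.sub L5).const_mul (Complex.I / (2 * Real.pi))
  have inv : Li2 (-(Zi ζ:ℂ)) + Li2 (-Complex.exp (2 * Real.pi * ζ)) = -(2 * Real.pi^2 * ζ^2 + Real.pi^2/6) := by
    have := Gf_neg (v := ζ) (by simp)
    rw [Gf, Gf, Hf, Hf, show -2 * Real.pi * (-ζ : ℂ) = 2 * Real.pi * ζ by ring] at this
    rw [Zi, Complex.ofReal_exp]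
    push_cast
    have hI := Complex.I_ne_zero
    generalize Li2 (-Complex.exp (2 * Real.pi * ζ)) = y1 at *
    generalize Li2 (-Complex.exp (-2 * Real.pi * ζ)) = y2 at *
    field_simp at this
    linear_combination (-1/24) * this
  have C := A.sub B
  have E : Filter.Tendsto (fun _ : ℝ => fM ζ ω - Tf ζ ω) l (nhds (fM ζ ω - Tf ζ ω)) := tendsto_const_nhds
  have := tendsto_nhds_unique (E.congr' ?_) C
  · rw [← sub_eq_zero, this]
    have : Li2 (-(Zi ζ:ℂ)) = -(2 * Real.pi^2 * ζ^2 + Real.pi^2/6) - Li2 (-Complex.exp (2 * Real.pi * ζ)) := by rw [← inv]; ring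
    rw [this]
    generalize Li2 (-Complex.exp (2 * Real.pi * ζ)) = y
    have hI := Complex.I_ne_zero
    field_simp
    linear_combination (-6 * y) * Complex.I_sq
  · filter_upwards [hsm] with ε h
    rw [← hconst (p ε) ⟨by rw [pim]; linarith [h.2], by rw [pim]; linarith [h.1]⟩, fM_eq_uf, Tf]
    have e : p ε - Complex.I/2 = r ε := by simp [hpdef]
    rw [e, mul_assoc Complex.I (r ε)]

lemma hasDerivAt_Hf {v : ℂ} (hv : |v.im| < 1/2) : HasDerivAt Hf (-Complex.I * Complex.log (1 + Complex.exp (-2 * Real.pi * v))) v := by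
  have h := (hasDerivAt_Gf hv).add ((((hasDerivAt_id v).pow 2).const_mul (Real.pi/2 : ℂ)).const_mul Complex.I)
  have h2 := h.add_const (Complex.I * (Real.pi/24))
  refine (h2.congr_of_eventuallyEq (Filter.Eventually.of_forall fun w => ?_)).congr_deriv ?_
  · simp [Gf]; ring
  · simp [Lam]; ring

lemma Hf_taylor {v : ℂ} (hv : |v.im| < 1/2) : ∃ C, ∃ δ > 0, ∀ y : ℂ, ‖y‖ < δ →
    ‖Hf (v + y) - Hf v - y * (-Complex.I * Complex.log (1 + Complex.exp (-2 * Real.pi * v)))‖ ≤ C * ‖y‖^2 := by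
  have hO : IsOpen {z : ℂ | |z.im| < 1/2} := isOpen_lt (by fun_prop) continuous_const
  have hd : DifferentiableOn ℂ Hf {z : ℂ | |z.im| < 1/2} := fun z hz => (hasDerivAt_Hf hz).differentiableAt.differentiableWithinAt
  obtain ⟨p, hp⟩ := hd.analyticAt (hO.mem_nhds hv)
  have h := hp.isBigO_sub_partialSum_pow 2
  obtain ⟨C, hC⟩ := h.bound
  obtain ⟨δ, hδ, hB⟩ := Metric.eventually_nhds_iff.1 hC
  refine ⟨C, δ, hδ, fun y hy => ?_⟩
  have := hB (y := y) (by simpa using hy)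
  rw [Real.norm_of_nonneg (by positivity)] at this
  refine le_trans (le_of_eq ?_) this
  congr 1
  have e1 : p 1 (fun _ => y) = y * (-Complex.I * Complex.log (1 + Complex.exp (-2 * Real.pi * v))) := by
    rw [← (hasDerivAt_Hf hv).deriv, hp.deriv, FormalMultilinearSeries.apply_eq_pow_smul_coeff, FormalMultilinearSeries.apply_eq_pow_smul_coeff]
    simp
  rw [FormalMultilinearSeries.partialSum, Finset.sum_range_succ, Finset.sum_range_one, e1, hp.coeff_zero]
  ring

lemma coth_eq (ζ : ℝ) {ω : ℂ} (h1 : 0 < ω.im) (h2 : ω.im < 1/2) :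
    ((Complex.cosh ((Real.pi:ℂ)*((ζ:ℂ)+ω)) / Complex.sinh ((Real.pi:ℂ)*((ζ:ℂ)+ω)) + 1)/2) ^ ((1:ℂ)/2)
      = Complex.exp (-Complex.log (1 - Zi ζ * Wf ω) / 2) := by
  have hq := im1q ζ h1 h2
  have hq0 := ne_of_im hq.ne'
  have a1 := Complex.exp_ne_zero (Real.pi * ζ)
  have a2 := Complex.exp_ne_zero (Real.pi * ω)
  have e : (Complex.cosh ((Real.pi:ℂ)*((ζ:ℂ)+ω)) / Complex.sinh ((Real.pi:ℂ)*((ζ:ℂ)+ω)) + 1)/2 = (1 - Zi ζ * Wf ω)⁻¹ := by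
    have hs := sinh_eq ζ ω
    have hc : Complex.cosh ((Real.pi:ℂ)*((ζ:ℂ)+ω)) = Complex.exp (Real.pi * ζ) * Complex.exp (Real.pi * ω) - Complex.sinh ((Real.pi:ℂ)*((ζ:ℂ)+ω)) := by
      rw [← Complex.exp_add, ← mul_add, ← Complex.cosh_add_sinh]; ring
    rw [hc, hs]
    generalize Complex.exp (Real.pi * ζ) = x at *
    generalize Complex.exp (Real.pi * ω) = y at *
    field_simp
    ring
  rw [e, Complex.cpow_def_of_ne_zero (inv_ne_zero hq0), Complex.log_inv _ (by
    have := (log_im_pos hq).2; rw [Complex.log_im] at this; exact this.ne)]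
  congr 1; ring

lemma main_thm (ζ : ℝ) (ω : ℂ) (hω1 : 0 < ω.im) (hω2 : ω.im < 1/2) :
    ∃ C > (0:ℝ), ∃ b₀ ∈ Set.Ioo (0:ℝ) 1, ∀ b ∈ Set.Ioo (0:ℝ) b₀,
      ‖Mfun b (ζ/b) (ω/(b:ℂ)) * Complex.exp (-(fM ζ ω)/(b:ℂ)^2)
        - ((Complex.cosh ((Real.pi:ℂ)*((ζ:ℂ)+ω)) / Complex.sinh ((Real.pi:ℂ)*((ζ:ℂ)+ω)) + 1)/2)
            ^ ((1:ℂ)/2)‖ ≤ C * b := by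
  rw [coth_eq ζ hω1 hω2, fM_eq ζ hω1 hω2]
  set v : ℂ := ω + ζ - Complex.I / 2 with hv
  have vim : v.im = ω.im - 1/2 := by simp [hv]
  have hv2 : |v.im| < 1/2 := by rw [vim, abs_lt]; constructor <;> linarith
  have eW : Complex.exp (-2 * Real.pi * v) = -(Zi ζ * Wf ω) := by
    rw [hv, Zi, Wf, Complex.ofReal_exp, ← Complex.exp_add,
      show -2 * Real.pi * (ω + ζ - Complex.I/2) = ((-2 * Real.pi * ζ : ℝ) : ℂ) + -2 * Real.pi * ω + Real.pi * Complex.I by push_cast; ring,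
      Complex.exp_add _ (Real.pi * Complex.I), Complex.exp_pi_mul_I]
    ring
  have hT : Tf ζ ω = Hf v - Hf ω := by
    rw [Tf, Hf, Hf, eW, neg_neg, Wf]; ring
  obtain ⟨C1, δ, hδ, hC1⟩ := Hf_taylor hv2
  rw [eW, ← sub_eq_add_neg] at hC1
  set Lq := Complex.log (1 - Zi ζ * Wf ω) with hLq
  obtain ⟨C2, hC2⟩ := Er_bound (ρ := max ω.im (1/2 - ω.im/2)) (max_lt hω2 (by linarith))
  set K := |C1| + 2 * |C2| + 1 with hK
  have hK0 : 0 < K := by positivity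
  set A := ‖Complex.exp (-Lq/2)‖ with hA
  have hA0 : 0 < A := norm_pos_iff.2 (Complex.exp_ne_zero _)
  set b₀ := min (min (1/4) ω.im) (min δ K⁻¹) with hb0
  have hb0p : 0 < b₀ := lt_min (lt_min (by norm_num) hω1) (lt_min hδ (by positivity))
  refine ⟨A * (2 * K), by positivity, b₀, ⟨hb0p, ?_⟩, ?_⟩
  · exact lt_of_le_of_lt ((min_le_left _ _).trans (min_le_left _ _)) (by norm_num)
  rintro b ⟨hb, hbb⟩
  have k1 : b < 1/4 := hbb.trans_le ((min_le_left _ _).trans (min_le_left _ _))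
  have k2 : b < ω.im := hbb.trans_le ((min_le_left _ _).trans (min_le_right _ _))
  have k3 : b < δ := hbb.trans_le ((min_le_right _ _).trans (min_le_left _ _))
  have k4 : b < K⁻¹ := hbb.trans_le ((min_le_right _ _).trans (min_le_right _ _))
  have hbsq : b^2 ≤ b := by nlinarith
  rw [M_closed hb (by nlinarith) (by linarith) hω2, ← Complex.exp_add]
  rw [show (b:ℂ)^2 = ((b^2 : ℝ) : ℂ) by push_cast; rfl]
  have hτ : 0 < b^2 := by positivity
  have hτb : b^2 < 1/16 := by nlinarith
  generalize b^2 = τ at *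
  have ht' : (τ:ℂ) ≠ 0 := by exact_mod_cast hτ.ne'
  set y : ℂ := -(Complex.I * τ / 2) with hy
  have hyn : ‖y‖ = τ/2 := by rw [hy, norm_neg]; simp [abs_of_pos hτ]
  have ekv : ω + ka τ ζ = v + y := by rw [ka, hv, hy]; ring
  have kim := ka_im τ ζ ω
  rw [ekv] at kim
  have vy : |(v + y).im| ≤ max ω.im (1/2 - ω.im/2) := by
    refine le_trans ?_ (le_max_right _ _); rw [kim, abs_le]; constructor <;> linarith
  have wy : |ω.im| ≤ max ω.im (1/2 - ω.im/2) := by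
    rw [abs_of_pos hω1]; exact le_max_left _ _
  have vy2 : |(v + y).im| < 1/2 := by rw [kim, abs_lt]; constructor <;> linarith
  have wy2 : |ω.im| < 1/2 := by rw [abs_of_pos hω1]; exact hω2
  have b1 := hC1 y (by rw [hyn]; linarith)
  have b2 := hC2 τ hτ (by linarith) _ vy
  have b3 := hC2 τ hτ (by linarith) _ wy
  set R := Hf (v + y) - Hf v - y * (-Complex.I * Lq) with hR
  set err := (R + Er τ (v + y) - Er τ ω) / τ with herr
  have key : -Kc τ ζ + al τ ζ * (ζ + ω) + ell τ (ω + ka τ ζ) - ell τ ω + -Tf ζ ω / τ = -Lq/2 + err := by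
    rw [ekv, ell_eq hτ vy2, ell_eq hτ wy2, herr, hR, hT, Gf, Gf, Kc, al, hy, hv]
    generalize Hf ω = h1
    generalize Er τ ω = h2
    generalize Hf (ω + ζ - Complex.I/2) = h3
    generalize Hf (ω + ζ - Complex.I/2 + -(Complex.I * τ / 2)) = h4
    generalize Er τ (ω + ζ - Complex.I/2 + -(Complex.I * τ / 2)) = h5
    field_simp
    linear_combination (Real.pi * (384 * ζ * (1 + τ) + 384 * ω * (1 + τ) - 96 * Complex.I * (1 + τ)^2) + 384 * τ * Lq) * Complex.I_sq
  have herrb : ‖err‖ ≤ K * τ := by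
    rw [herr, norm_div, Complex.norm_real, Real.norm_of_nonneg hτ.le, div_le_iff₀ hτ]
    have s1 : ‖R + Er τ (v + y) - Er τ ω‖ ≤ ‖R‖ + ‖Er τ (v + y)‖ + ‖Er τ ω‖ :=
      (norm_sub_le _ _).trans (by gcongr; exact norm_add_le _ _)
    rw [hyn] at b1
    have s2 : C1 * (τ/2)^2 ≤ |C1| * τ^2 := by
      have := le_abs_self C1
      have := abs_nonneg C1
      nlinarith [sq_nonneg τ]
    have s3 : C2 * τ^2 ≤ |C2| * τ^2 := by gcongr; exact le_abs_self C2
    rw [hK]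
    nlinarith [sq_nonneg τ]
  have hK1 : K * b < 1 := by
    rw [← one_div, lt_div_iff₀ hK0] at k4; linarith
  have herr2 : ‖err‖ ≤ K * b := herrb.trans (by gcongr)
  rw [key, Complex.exp_add, ← mul_sub_one, norm_mul, ← hA, mul_assoc]
  gcongr
  have := Complex.norm_exp_sub_one_le (x := err) (by linarith)
  linarith

/-- Semiclassical limit of `𝓜`: for `ζ ∈ ℝ` and `0 < Im ω < 1/2`,
`𝓜(b, ζ/b, ω/b) = √((coth(π(ζ+ω))+1)/2) · e^{f_𝓜(ζ,ω)/b²} (1 + O(b))` as `b → 0⁺`. -/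
theorem semiclassical_limit_M (ζ : ℝ) (ω : ℂ) (hω1 : 0 < ω.im) (hω2 : ω.im < 1/2) :
    ∃ C > (0:ℝ), ∃ b₀ ∈ Set.Ioo (0:ℝ) 1, ∀ b ∈ Set.Ioo (0:ℝ) b₀,
      ‖Mfun b (ζ/b) (ω/(b:ℂ)) * Complex.exp (-(fM ζ ω)/(b:ℂ)^2)
        - ((Complex.cosh ((Real.pi:ℂ)*((ζ:ℂ)+ω)) / Complex.sinh ((Real.pi:ℂ)*((ζ:ℂ)+ω)) + 1)/2)
            ^ ((1:ℂ)/2)‖ ≤ C * b := by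
  exact main_thm ζ ω hω1 hω2
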